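/- arXiv:2407.01778 — 4 statements merged into one kernel-verified Lean document; each statement's English description precedes it below -/
import Mathlib

section
/- Let k ≥ 3 be an integer, N ≥ 4 an integer, and 0 < δ < 1/4. Let f be a real-valued function of class C^k on [N, 2N] such that there exist λ_k > 0 and c_k ≥ 1 with λ_k ≤ |f^{(k)}(x)| ≤ c_k·λ_k for all x ∈ [N, 2N]. Then R(f,N,δ) ≤ α_k·N·λ_k^{2/(k(k+1))} + β_k·N·δ^{2/(k(k-1))} + 16·k³·(δ/λ_k)^{1/k} + 2·k²·(5e³+1), where α_k = 2k²·c_k^{2/(k(k+1))} and β_k = 30e³·k²·c_k^{2/(k(k-1))} + 4k². -/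
open Set

/-- `F 0, F 1, …, F k` are successive derivatives of one another on `I`. -/
def IsDerivChain (F : ℕ → ℝ → ℝ) (k : ℕ) (I : Set ℝ) : Prop :=
  ∀ i < k, ∀ x ∈ I, HasDerivWithinAt (F i) (F (i + 1) x) I x

theorem IsDerivChain.tail {F : ℕ → ℝ → ℝ} {k : ℕ} {I : Set ℝ} (h : IsDerivChain F (k + 1) I) :
    IsDerivChain (fun i => F (i + 1)) k I :=
  fun i hi x hx => h (i + 1) (by omega) x hx

theorem IsDerivChain.sub_polynomial {F : ℕ → ℝ → ℝ} {k : ℕ} {I : Set ℝ} (h : IsDerivChain F k I)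
    (P : Polynomial ℝ) :
    IsDerivChain (fun i x => F i x - (Polynomial.derivative^[i] P).eval x) k I := by
  intro i hi x hx
  have h2 := (Polynomial.hasDerivAt (Polynomial.derivative^[i] P) x).hasDerivWithinAt (s := I)
  rw [← Function.iterate_succ_apply' (f := Polynomial.derivative)] at h2
  exact (h i hi x hx).sub h2

theorem IsDerivChain.of_contDiffOn {f : ℝ → ℝ} {k : ℕ} {a b : ℝ} (hab : a < b)
    (hf : ContDiffOn ℝ k f (Icc a b)) :
    IsDerivChain (fun i => iteratedDerivWithin i f (Icc a b)) k (Icc a b) := by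
  intro i hi x hx
  have h := hf.differentiableOn_iteratedDerivWithin (m := i) (by exact_mod_cast hi)
    (uniqueDiffOn_Icc hab)
  have h2 := (h x hx).hasDerivWithinAt
  rwa [← iteratedDerivWithin_succ] at h2

/-- Iterated Rolle theorem along an increasing sequence of zeros. -/
theorem IsDerivChain.exists_eq_zero_of_seq {a b : ℝ} (k : ℕ) (F : ℕ → ℝ → ℝ)
    (h : IsDerivChain F k (Icc a b)) (t : ℕ → ℝ) (ht : ∀ i < k, t i < t (i + 1))
    (hI : ∀ i ≤ k, t i ∈ Icc a b) (h0 : ∀ i ≤ k, F 0 (t i) = 0) :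
    ∃ ξ ∈ Icc a b, F k ξ = 0 := by
  induction k generalizing F t with
  | zero => exact ⟨t 0, hI 0 le_rfl, h0 0 le_rfl⟩
  | succ k ih =>
    have key : ∀ i, i ≤ k → ∃ y ∈ Ioo (t i) (t (i + 1)), F 1 y = 0 := by
      intro i hi
      have hsub : Icc (t i) (t (i + 1)) ⊆ Icc a b :=
        Icc_subset_Icc (hI i (by omega)).1 (hI (i + 1) (by omega)).2
      refine exists_hasDerivAt_eq_zero (f := F 0) (ht i (by omega)) ?_ ?_ ?_
      · exact fun x hx => ((h 0 (by omega) x (hsub hx)).continuousWithinAt).mono hsub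
      · rw [h0 i (by omega), h0 (i + 1) (by omega)]
      · intro x hx
        refine (h 0 (by omega) x (hsub (Ioo_subset_Icc_self hx))).hasDerivAt ?_
        exact Filter.mem_of_superset (Icc_mem_nhds hx.1 hx.2) hsub
    choose! y hy hy0 using key
    refine ih (fun i => F (i + 1)) h.tail y ?_ ?_ hy0
    · intro i hi
      exact (hy i (by omega)).2.trans (hy (i + 1) (by omega)).1
    · intro i hi
      exact ⟨(hI i (by omega)).1.trans (hy i hi).1.le,
        (hy i hi).2.le.trans (hI (i + 1) (by omega)).2⟩

theorem IsDerivChain.exists_eq_zero {a b : ℝ} {k : ℕ} {F : ℕ → ℝ → ℝ}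
    (h : IsDerivChain F k (Icc a b)) (T : Finset ℝ) (hT : T.card = k + 1)
    (hI : ∀ x ∈ T, x ∈ Icc a b) (h0 : ∀ x ∈ T, F 0 x = 0) :
    ∃ ξ ∈ Icc a b, F k ξ = 0 := by
  let t : ℕ → ℝ := fun i => if hi : i < k + 1 then T.orderEmbOfFin hT ⟨i, hi⟩ else 0
  have hmem : ∀ i ≤ k, t i ∈ T := by
    intro i hi
    simp only [t, dif_pos (Nat.lt_succ_of_le hi)]
    exact Finset.orderEmbOfFin_mem _ _ _
  refine h.exists_eq_zero_of_seq k F t ?_ (fun i hi => hI _ (hmem i hi))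
    (fun i hi => h0 _ (hmem i hi))
  intro i hi
  simp only [t, dif_pos (show i < k + 1 by omega), dif_pos (show i + 1 < k + 1 by omega)]
  exact (T.orderEmbOfFin hT).strictMono (by simp [Fin.lt_def])

/-- The divided difference of the values `r` at the nodes `v i`, `i ∈ s`. -/
noncomputable def divDiff {ι : Type*} [DecidableEq ι] (s : Finset ι) (v r : ι → ℝ) : ℝ :=
  ∑ i ∈ s, r i / ∏ j ∈ s.erase i, (v i - v j)

section
variable {ι : Type*} [DecidableEq ι] {s : Finset ι} {v : ι → ℝ}

theorem divDiff_sub (r r' : ι → ℝ) :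
    divDiff s v (fun i => r i - r' i) = divDiff s v r - divDiff s v r' := by
  simp [divDiff, sub_div, Finset.sum_sub_distrib]

theorem divDiff_polynomial {k : ℕ} (hs : s.card = k + 1) (hv : InjOn v s) {P : Polynomial ℝ}
    (hP : P.degree < k) : divDiff s v (fun i => P.eval (v i)) = 0 := by
  have h1 : P.degree < s.card := by
    rw [hs]
    exact hP.trans (by exact_mod_cast Nat.lt_succ_self k)
  have h := Lagrange.coeff_eq_sum hv h1
  rw [hs, Nat.add_sub_cancel, Polynomial.coeff_eq_zero_of_degree_lt hP] at h
  exact h.symm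

/-- Mean value theorem for divided differences. -/
theorem IsDerivChain.exists_divDiff_eq {a b : ℝ} {k : ℕ} {F : ℕ → ℝ → ℝ}
    (h : IsDerivChain F k (Icc a b)) (hs : s.card = k + 1) (hv : InjOn v s)
    (hI : ∀ i ∈ s, v i ∈ Icc a b) :
    ∃ ξ ∈ Icc a b, divDiff s v (fun i => F 0 (v i)) = F k ξ / k.factorial := by
  set Q := Lagrange.interpolate s v (fun i => F 0 (v i)) with hQ
  have hdeg : Q.degree < s.card := Lagrange.degree_interpolate_lt _ hv
  have hev : ∀ i ∈ s, Q.eval (v i) = F 0 (v i) :=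
    fun i hi => Lagrange.eval_interpolate_at_node _ hv hi
  have hco := Lagrange.coeff_eq_sum hv hdeg
  obtain ⟨ξ, hξ, h0⟩ := (h.sub_polynomial Q).exists_eq_zero (s.image v)
    (by rw [Finset.card_image_of_injOn hv, hs])
    (by simpa using hI) (by simpa [sub_eq_zero] using fun i hi => (hev i hi).symm)
  refine ⟨ξ, hξ, ?_⟩
  have hnd : Q.natDegree ≤ k := by
    rw [hs] at hdeg
    exact Polynomial.natDegree_le_of_degree_le (Order.lt_succ_iff.mp (by exact_mod_cast hdeg))
  have hder : (Polynomial.derivative^[k] Q).eval ξ = k.factorial * Q.coeff k := by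
    have h1 : (Polynomial.derivative^[k] Q).natDegree = 0 := by
      have := Polynomial.natDegree_iterate_derivative Q k
      omega
    rw [Polynomial.eq_C_of_natDegree_eq_zero h1, Polynomial.eval_C,
      Polynomial.coeff_iterate_derivative]
    simp [Nat.descFactorial_self]
  have : divDiff s v (fun i => F 0 (v i)) = Q.coeff k := by
    rw [hs, Nat.add_sub_cancel] at hco
    rw [hco, divDiff]
    exact Finset.sum_congr rfl fun i hi => by rw [hev i hi]
  rw [this, eq_div_iff (by positivity)]
  rw [hder] at h0
  linarith

theorem divDiff_insert {i : ι} (hi : i ∉ s) (r : ι → ℝ) :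
    divDiff (insert i s) v r = r i / ∏ j ∈ s, (v i - v j) +
      ∑ l ∈ s, r l / ((v l - v i) * ∏ j ∈ s.erase l, (v l - v j)) := by
  rw [divDiff, Finset.sum_insert hi, Finset.erase_insert hi]
  congr 1
  refine Finset.sum_congr rfl fun l hl => ?_
  have : (insert i s).erase l = insert i (s.erase l) :=
    Finset.erase_insert_of_ne (fun h => hi (h ▸ hl))
  rw [this, Finset.prod_insert (fun h => hi (Finset.mem_of_mem_erase h))]

end

/-- The product of the differences `y - x` over the pairs `x < y` in `T`. -/
def diffProd (T : Finset ℤ) : ℤ := ∏ x ∈ T, ∏ y ∈ T, if x < y then y - x else 1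

theorem diffProd_insert {a : ℤ} {T : Finset ℤ} (ha : a ∉ T) :
    diffProd (insert a T) = (∏ y ∈ T, |a - y|) * diffProd T := by
  simp only [diffProd, Finset.prod_insert ha, lt_irrefl, if_false, one_mul,
    Finset.prod_mul_distrib]
  rw [← mul_assoc, ← Finset.prod_mul_distrib]
  congr 1
  refine Finset.prod_congr rfl fun y hy => ?_
  rcases lt_trichotomy a y with h | h | h
  · rw [if_pos h, if_neg (by omega), mul_one, abs_of_neg (by omega)]; ring
  · exact absurd (h ▸ hy) ha
  · rw [if_neg (by omega), if_pos h, one_mul, abs_of_pos (by omega)]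

theorem diffProd_pos (T : Finset ℤ) : 0 < diffProd T := by
  refine Finset.prod_pos fun x _ => Finset.prod_pos fun y _ => ?_
  split_ifs with h <;> omega

theorem diffProd_le (T : Finset ℤ) (d : ℝ) (hd : ∀ x ∈ T, ∀ y ∈ T, ((y - x : ℤ) : ℝ) ≤ d) :
    (diffProd T : ℝ) ≤ d ^ (T.card.choose 2) := by
  induction T using Finset.induction_on with
  | empty => simp [diffProd]
  | insert a T ha ih =>
    have hd0 : 0 ≤ d := by simpa using hd a (by simp) a (by simp)
    rw [diffProd_insert ha, Finset.card_insert_of_notMem ha, Nat.choose_succ_succ' T.card 1,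
      pow_add, Nat.choose_one_right, Int.cast_mul, Int.cast_prod]
    have ih' := ih fun x hx y hy => hd x (by simp [hx]) y (by simp [hy])
    have hp : ∏ y ∈ T, ((|a - y| : ℤ) : ℝ) ≤ d ^ T.card := by
      rw [← Finset.prod_const]
      refine Finset.prod_le_prod (fun y _ => by positivity) fun y hy => ?_
      rw [Int.cast_abs, abs_le']
      refine ⟨hd y (by simp [hy]) a (by simp), ?_⟩
      have := hd a (by simp) y (by simp [hy])
      push_cast at this ⊢
      linarith
    have := diffProd_pos T
    gcongr

theorem diffProd_div {T : Finset ℤ} {x : ℤ} (hx : x ∈ T) :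
    ∃ ε : ℤ, |ε| = 1 ∧ (diffProd T : ℝ) / ∏ j ∈ T.erase x, ((x : ℝ) - j) =
      ε * diffProd (T.erase x) := by
  have h1 : diffProd T = (∏ y ∈ T.erase x, |x - y|) * diffProd (T.erase x) := by
    rw [← diffProd_insert (Finset.notMem_erase x T), Finset.insert_erase hx]
  have h0 : (∏ j ∈ T.erase x, ((x : ℝ) - j)) ≠ 0 := by
    refine Finset.prod_ne_zero_iff.mpr fun j hj => ?_
    rw [sub_ne_zero]
    exact_mod_cast (Finset.ne_of_mem_erase hj).symm
  have h2 : ((∏ y ∈ T.erase x, |x - y| : ℤ) : ℝ) = |∏ j ∈ T.erase x, ((x : ℝ) - j)| := by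
    rw [Finset.abs_prod]; push_cast; rfl
  rw [h1, Int.cast_mul, h2]
  rcases abs_choice (∏ j ∈ T.erase x, ((x : ℝ) - j)) with h | h
  · exact ⟨1, by simp, by rw [h]; field_simp; simp⟩
  · exact ⟨-1, by simp, by rw [h]; field_simp; simp⟩

theorem diffProd_mul_divDiff_int (T : Finset ℤ) (m : ℤ → ℤ) :
    ∃ z : ℤ, (diffProd T : ℝ) * divDiff T (fun n : ℤ => (n : ℝ)) (fun n => (m n : ℝ)) = z := by
  have key : ∀ x ∈ T, ∃ z : ℤ,
      (diffProd T : ℝ) * ((m x : ℝ) / ∏ j ∈ T.erase x, ((x : ℝ) - j)) = z := by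
    intro x hx
    obtain ⟨ε, -, h⟩ := diffProd_div hx
    refine ⟨m x * (ε * diffProd (T.erase x)), ?_⟩
    push_cast
    rw [← h]; ring
  choose! z hz using key
  refine ⟨∑ x ∈ T, z x, ?_⟩
  rw [divDiff, Finset.mul_sum, Int.cast_sum]
  exact Finset.sum_congr rfl hz

theorem abs_diffProd_mul_divDiff_le (T : Finset ℤ) (r : ℤ → ℝ) :
    |(diffProd T : ℝ) * divDiff T (fun n : ℤ => (n : ℝ)) r| ≤
      ∑ x ∈ T, |r x| * diffProd (T.erase x) := by
  rw [divDiff, Finset.mul_sum]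
  refine (Finset.abs_sum_le_sum_abs _ _).trans (Finset.sum_le_sum fun x hx => ?_)
  obtain ⟨ε, h1, h⟩ := diffProd_div hx
  have h1' : |(ε : ℝ)| = 1 := by exact_mod_cast h1
  have hpos : (0 : ℝ) < diffProd (T.erase x) := by exact_mod_cast diffProd_pos _
  have : (diffProd T : ℝ) * (r x / ∏ j ∈ T.erase x, ((x : ℝ) - j)) =
      r x * (ε * diffProd (T.erase x)) := by rw [← h]; ring
  rw [this, abs_mul, abs_mul, h1', one_mul, abs_of_pos hpos]

theorem abs_diffProd_mul_divDiff_insert {k : ℕ} {U : Finset ℤ} {s : ℤ} (hs : s ∉ U)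
    (hU : U.card = k) (m : ℤ → ℤ) {P : Polynomial ℝ} (hP : P.degree < k)
    (hPm : ∀ n ∈ U, P.eval (n : ℝ) = m n) :
    |(diffProd (insert s U) : ℝ) *
      divDiff (insert s U) (fun n : ℤ => (n : ℝ)) (fun n => (m n : ℝ))| =
      diffProd U * |m s - P.eval (s : ℝ)| := by
  have h0 := divDiff_polynomial (s := insert s U) (v := fun n : ℤ => (n : ℝ)) (k := k)
    (by rw [Finset.card_insert_of_notMem hs, hU]) (Int.cast_injective.injOn) hP
  have h1 := divDiff_sub (s := insert s U) (v := fun n : ℤ => (n : ℝ)) (fun n : ℤ => (m n : ℝ))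
    (fun n : ℤ => P.eval (n : ℝ))
  rw [h0, sub_zero, divDiff_insert hs, Finset.sum_eq_zero, add_zero] at h1
  · have hp : (0 : ℝ) < ∏ j ∈ U, |(s : ℝ) - j| := by
      refine Finset.prod_pos fun j hj => abs_pos.mpr (sub_ne_zero.mpr ?_)
      exact_mod_cast fun h : s = j => hs (h ▸ hj)
    have hpos : (0 : ℝ) < diffProd U := by exact_mod_cast diffProd_pos U
    rw [← h1, diffProd_insert hs, abs_mul, abs_div, Finset.abs_prod]
    push_cast
    rw [abs_mul, abs_of_pos hpos, abs_of_pos hp]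
    field_simp
  · intro n hn
    rw [hPm n hn]; simp

theorem one_le_diffProd_mul_abs_sub {k : ℕ} {U : Finset ℤ} {s : ℤ} (hs : s ∉ U)
    (hU : U.card = k) (m : ℤ → ℤ) {P : Polynomial ℝ} (hP : P.degree < k)
    (hPm : ∀ n ∈ U, P.eval (n : ℝ) = m n) (hPs : P.eval (s : ℝ) ≠ m s) :
    1 ≤ diffProd U * |m s - P.eval (s : ℝ)| := by
  have h := abs_diffProd_mul_divDiff_insert hs hU m hP hPm
  obtain ⟨z, hz⟩ := diffProd_mul_divDiff_int (insert s U) m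
  have hpos : (0 : ℝ) < diffProd U := by exact_mod_cast diffProd_pos U
  have h2 : 0 < diffProd U * |m s - P.eval (s : ℝ)| :=
    mul_pos hpos (abs_pos.mpr (sub_ne_zero.mpr hPs.symm))
  rw [hz] at h
  rw [← h] at h2 ⊢
  have : z ≠ 0 := by rintro rfl; simp at h2
  exact_mod_cast Int.one_le_abs this

theorem succ_le_two_pow_choose_two {k : ℕ} (hk : 3 ≤ k) : 2 * (k + 1) ≤ 2 ^ (k.choose 2) := by
  induction k, hk using Nat.le_induction with
  | base => decide
  | succ n hn ih =>
    rw [Nat.choose_succ_succ' n 1, pow_add, Nat.choose_one_right]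
    have : 2 ≤ 2 ^ n := Nat.le_self_pow (by omega) 2
    nlinarith

theorem le_choose_two {k : ℕ} (hk : 3 ≤ k) : k ≤ k.choose 2 := by
  induction k, hk using Nat.le_induction with
  | base => decide
  | succ n hn ih =>
    have : (n + 1).choose 2 = n.choose 1 + n.choose 2 := Nat.choose_succ_succ' n 1
    rw [Nat.choose_one_right] at this
    omega

/-- Points close to the curve that do not lie on a common curve of degree less than `k` cannot be
too close to each other. -/
theorem one_le_spread_mul {k : ℕ} (hk : 3 ≤ k) {a b : ℝ} {F : ℕ → ℝ → ℝ}
    (hF : IsDerivChain F k (Icc a b)) {u d l : ℝ} (hu : 0 ≤ u) (hd : 0 ≤ d)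
    (hFk : ∀ x ∈ Icc a b, |F k x| ≤ u ^ ((k + 1).choose 2))
    {U : Finset ℤ} {s : ℤ} (hs : s ∉ U) (hU : U.card = k)
    (hI : ∀ n ∈ insert s U, (n : ℝ) ∈ Icc a b) (m : ℤ → ℤ)
    (hm : ∀ n ∈ insert s U, |F 0 n - m n| ≤ d ^ (k.choose 2))
    {P : Polynomial ℝ} (hP : P.degree < k)
    (hPm : ∀ n ∈ U, P.eval (n : ℝ) = m n) (hPs : P.eval (s : ℝ) ≠ m s)
    (hl : ∀ x ∈ insert s U, ∀ y ∈ insert s U, ((y - x : ℤ) : ℝ) ≤ l) :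
    1 ≤ l * (u + 2 * d) := by
  have hl0 : 0 ≤ l := by simpa using hl s (by simp) s (by simp)
  have hcard : (insert s U).card = k + 1 := by rw [Finset.card_insert_of_notMem hs, hU]
  have h1 := one_le_diffProd_mul_abs_sub hs hU m hP hPm hPs
  rw [← abs_diffProd_mul_divDiff_insert hs hU m hP hPm] at h1
  obtain ⟨ξ, hξ, hmv⟩ := hF.exists_divDiff_eq hcard
    (Int.cast_injective.injOn (s := (insert s U : Finset ℤ))) hI
  have hsub := divDiff_sub (s := insert s U) (v := fun n : ℤ => (n : ℝ)) (fun n : ℤ => F 0 n)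
    (fun n : ℤ => (m n : ℝ))
  set V : ℝ := ((diffProd (insert s U) : ℤ) : ℝ) with hV
  have hVpos : 0 < V := by rw [hV]; exact_mod_cast diffProd_pos _
  have hVle : V ≤ l ^ ((k + 1).choose 2) := by
    rw [← hcard]; exact diffProd_le _ _ hl
  have h2 : |V * divDiff (insert s U) (fun n : ℤ => (n : ℝ)) (fun n : ℤ => F 0 n)| ≤
      (l * u) ^ ((k + 1).choose 2) / k.factorial := by
    rw [hmv, abs_mul, abs_div, abs_of_pos hVpos, Nat.abs_cast, mul_pow, mul_div_assoc]
    have := hFk ξ hξ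
    gcongr
  have h3 : |V * divDiff (insert s U) (fun n : ℤ => (n : ℝ)) (fun n : ℤ => F 0 n - m n)| ≤
      (k + 1) * (l * d) ^ (k.choose 2) := by
    refine (abs_diffProd_mul_divDiff_le _ _).trans ?_
    have : ∀ x ∈ insert s U, |F 0 x - m x| * (diffProd ((insert s U).erase x) : ℝ) ≤
        (l * d) ^ (k.choose 2) := by
      intro x hx
      have hc : ((insert s U).erase x).card = k := by
        rw [Finset.card_erase_of_mem hx, hcard, Nat.add_sub_cancel]
      have h4 := diffProd_le ((insert s U).erase x) l fun y hy z hz =>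
        hl y (Finset.mem_of_mem_erase hy) z (Finset.mem_of_mem_erase hz)
      rw [hc] at h4
      have h5 : (0 : ℝ) < diffProd ((insert s U).erase x) := by exact_mod_cast diffProd_pos _
      have := hm x hx
      rw [mul_pow, mul_comm (l ^ _)]
      gcongr
    refine (Finset.sum_le_card_nsmul _ _ _ this).trans ?_
    rw [hcard, nsmul_eq_mul]
    push_cast
    rfl
  have h6 : 1 ≤ (l * u) ^ ((k + 1).choose 2) / k.factorial + (k + 1) * (l * d) ^ (k.choose 2) := by
    have h7 : V * divDiff (insert s U) (fun n : ℤ => (n : ℝ)) (fun n : ℤ => (m n : ℝ)) =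
        V * divDiff (insert s U) (fun n : ℤ => (n : ℝ)) (fun n : ℤ => F 0 n) -
        V * divDiff (insert s U) (fun n : ℤ => (n : ℝ)) (fun n : ℤ => F 0 n - m n) := by
      rw [hsub]; ring
    rw [h7] at h1
    exact h1.trans ((abs_sub _ _).trans (add_le_add h2 h3))
  by_contra! hcon
  have hlu : 0 ≤ l * u := by positivity
  have hld : 0 ≤ l * d := by positivity
  have h8 : (l * u) ^ ((k + 1).choose 2) ≤ 1 := pow_le_one₀ hlu (by nlinarith)
  have h9 : (l * d) ^ (k.choose 2) ≤ (1 / 2) ^ (k.choose 2) :=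
    pow_le_pow_left₀ hld (by nlinarith) _
  have h10 : ((2 * (k + 1) : ℕ) : ℝ) ≤ ((2 ^ (k.choose 2) : ℕ) : ℝ) :=
    Nat.cast_le.mpr (succ_le_two_pow_choose_two hk)
  push_cast at h10
  have h11 : (6 : ℝ) ≤ k.factorial := by
    have := Nat.factorial_le hk
    exact_mod_cast this
  have h12 : (l * u) ^ ((k + 1).choose 2) / k.factorial ≤ 1 / 6 := by gcongr
  have h13 : (k + 1) * (l * d) ^ (k.choose 2) ≤ 1 / 2 := by
    calc (k + 1) * (l * d) ^ (k.choose 2) ≤ (k + 1) * (1 / 2) ^ (k.choose 2) := by gcongr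
      _ = (k + 1) / 2 ^ (k.choose 2) := by rw [one_div, inv_pow]; rfl
      _ ≤ 1 / 2 := by
        rw [div_le_div_iff₀ (by positivity) (by norm_num)]; linarith
  linarith

theorem prod_erase_abs_sub {m i : ℕ} (hi : i ≤ m) :
    ∏ j ∈ (Finset.range (m + 1)).erase i, |(i : ℝ) - j| = i.factorial * (m - i).factorial := by
  induction m, hi using Nat.le_induction with
  | base =>
    rw [Finset.range_add_one, Finset.erase_insert Finset.notMem_range_self, Nat.sub_self,
      Nat.factorial_zero, Nat.cast_one, mul_one, ← Finset.prod_range_add_one_eq_factorial,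
      ← Finset.prod_range_reflect, Nat.cast_prod]
    refine Finset.prod_congr rfl fun j hj => ?_
    have hj' := Finset.mem_range.mp hj
    have h1 : ((i - 1 - j : ℕ) : ℝ) = i - (j + 1) := by
      rw [Nat.sub_sub, Nat.cast_sub (by omega)]
      push_cast
      ring
    rw [h1, sub_sub_cancel, abs_of_pos (by positivity)]
    push_cast
    rfl
  | succ m hm ih =>
    have h : (Finset.range (m + 1 + 1)).erase i =
        insert (m + 1) ((Finset.range (m + 1)).erase i) := by
      rw [Finset.range_add_one (n := m + 1), Finset.erase_insert_of_ne (by omega)]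
    rw [h, Finset.prod_insert (by simp), ih, Nat.succ_sub hm, Nat.factorial_succ]
    have : (i : ℝ) ≤ m := by exact_mod_cast hm
    rw [abs_of_neg (by push_cast; linarith)]
    push_cast [Nat.cast_sub hm]
    ring

theorem sum_inv_prod_equidistant (m : ℕ) {a h : ℝ} (hh : 0 < h) :
    ∑ i ∈ Finset.range (m + 1), 1 / ∏ j ∈ (Finset.range (m + 1)).erase i,
      |(a + i * h) - (a + j * h)| = (2 / h) ^ m / m.factorial := by
  have h1 : ∀ i ∈ Finset.range (m + 1), 1 / ∏ j ∈ (Finset.range (m + 1)).erase i,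
      |(a + i * h) - (a + j * h)| = (1 / h) ^ m / m.factorial * (m.choose i : ℝ) := by
    intro i hi
    have him : i ≤ m := Nat.lt_succ_iff.mp (Finset.mem_range.mp hi)
    have h2 : ∀ j ∈ (Finset.range (m + 1)).erase i,
        |(a + i * h) - (a + j * h)| = h * |(i : ℝ) - j| := by
      intro j _
      rw [← abs_of_pos hh, ← abs_mul, abs_of_pos hh]
      ring_nf
    rw [Finset.prod_congr rfl h2, Finset.prod_mul_distrib, prod_erase_abs_sub him,
      Finset.prod_const, Finset.card_erase_of_mem hi, Finset.card_range, Nat.add_sub_cancel,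
      Nat.cast_choose ℝ him, one_div_pow]
    field_simp
  rw [Finset.sum_congr rfl h1, ← Finset.mul_sum, ← Nat.cast_sum, Nat.sum_range_choose]
  push_cast
  rw [div_pow, div_pow, one_pow]
  ring

/-- A function that stays small on an interval while its `k`-th derivative is large. -/
theorem mul_length_pow_le {k : ℕ} (hk : 1 ≤ k) {a b : ℝ} (hab : a < b) {F : ℕ → ℝ → ℝ}
    (hF : IsDerivChain F k (Icc a b)) {lam δ : ℝ}
    (hFk : ∀ x ∈ Icc a b, lam ≤ |F k x|) (h0 : ∀ x ∈ Icc a b, |F 0 x| ≤ δ) :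
    lam * (b - a) ^ k ≤ δ * (2 * k) ^ k := by
  have hk0 : (0 : ℝ) < k := by exact_mod_cast hk
  set h := (b - a) / k with hh
  have hL : 0 < b - a := by linarith
  have hpos : 0 < h := by positivity
  have hkh : k * h = b - a := by rw [hh]; field_simp
  have hδ : 0 ≤ δ := (abs_nonneg _).trans (h0 a ⟨le_rfl, hab.le⟩)
  have hI : ∀ i ∈ Finset.range (k + 1), a + (i : ℝ) * h ∈ Icc a b := by
    intro i hi
    have : (i : ℝ) ≤ k := by exact_mod_cast Nat.lt_succ_iff.mp (Finset.mem_range.mp hi)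
    constructor
    · have : 0 ≤ (i : ℝ) * h := by positivity
      linarith
    · nlinarith
  obtain ⟨ξ, hξ, hmv⟩ := hF.exists_divDiff_eq (s := Finset.range (k + 1))
    (v := fun i : ℕ => a + i * h) (by simp)
    (by
      intro i _ j _ hij
      have : (i : ℝ) * h = j * h := by simpa using hij
      exact_mod_cast mul_right_cancel₀ hpos.ne' this) hI
  have h1 : |divDiff (Finset.range (k + 1)) (fun i : ℕ => a + i * h)
      (fun i : ℕ => F 0 (a + i * h))| ≤ δ * ((2 / h) ^ k / k.factorial) := by
    rw [← sum_inv_prod_equidistant k (a := a) hpos, Finset.mul_sum, divDiff]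
    refine (Finset.abs_sum_le_sum_abs _ _).trans (Finset.sum_le_sum fun i hi => ?_)
    rw [abs_div, Finset.abs_prod, mul_one_div]
    have := h0 _ (hI i hi)
    gcongr
  rw [hmv, abs_div, Nat.abs_cast, ← mul_div_assoc, div_le_div_iff_of_pos_right (by positivity),
    div_pow, ← mul_div_assoc, le_div_iff₀ (by positivity)] at h1
  have h2 := mul_le_mul_of_nonneg_right (hFk ξ hξ) (pow_nonneg hpos.le k)
  have h3 := mul_le_mul_of_nonneg_right (h2.trans h1) (pow_nonneg hk0.le k)
  rw [mul_assoc, mul_assoc, ← mul_pow, ← mul_pow, mul_comm h, hkh] at h3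
  exact h3

/-- Growth of a function away from an interval on which it is small. -/
theorem abs_le_of_small_on {k : ℕ} (hk : 1 ≤ k) {a b s : ℝ} (hab : a < b) (hbs : b ≤ s)
    {F : ℕ → ℝ → ℝ}
    (hF : IsDerivChain F k (Icc a s)) {Λ δ : ℝ}
    (hFk : ∀ x ∈ Icc a s, |F k x| ≤ Λ) (h0 : ∀ x ∈ Icc a b, |F 0 x| ≤ δ) :
    |F 0 s| ≤ δ * (s - a) ^ (k - 1) * ((2 * k / (b - a)) ^ (k - 1) / (k - 1).factorial) +
      Λ * (s - a) ^ k / k.factorial := by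
  obtain ⟨m, rfl⟩ : ∃ m, k = m + 1 := ⟨k - 1, by omega⟩
  simp only [Nat.add_sub_cancel]
  set K : ℝ := ((m + 1 : ℕ) : ℝ) with hK
  have hk0 : (0 : ℝ) < K := by positivity
  set h := (b - a) / K with hh
  have hL : 0 < b - a := by linarith
  have hpos : 0 < h := by positivity
  have hkh : K * h = b - a := by rw [hh]; field_simp
  have hδ : 0 ≤ δ := (abs_nonneg _).trans (h0 a ⟨le_rfl, hab.le⟩)
  set v : ℕ → ℝ := fun i => if i < m + 1 then a + i * h else s with hv
  have hvi : ∀ i ∈ Finset.range (m + 1), v i = a + i * h := fun i hi => by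
    simp only [hv, if_pos (Finset.mem_range.mp hi)]
  have hvs : v (m + 1) = s := by simp [hv]
  have hle : ∀ i ∈ Finset.range (m + 1), a ≤ v i ∧ v i < b := by
    intro i hi
    have h1 : (i : ℝ) < K := by rw [hK]; exact_mod_cast Finset.mem_range.mp hi
    rw [hvi i hi]
    constructor
    · have : 0 ≤ (i : ℝ) * h := by positivity
      linarith
    · nlinarith
  have hI : ∀ i ∈ insert (m + 1) (Finset.range (m + 1)), v i ∈ Icc a s := by
    intro i hi
    rcases Finset.mem_insert.mp hi with rfl | hi
    · rw [hvs]; exact ⟨by linarith, le_rfl⟩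
    · exact ⟨(hle i hi).1, by linarith [(hle i hi).2]⟩
  have hinj : InjOn v (insert (m + 1) (Finset.range (m + 1)) : Finset ℕ) := by
    intro i hi j hj hij
    rcases Finset.mem_insert.mp (Finset.mem_coe.mp hi) with rfl | hi <;>
      rcases Finset.mem_insert.mp (Finset.mem_coe.mp hj) with rfl | hj
    · rfl
    · rw [hvs] at hij; linarith [(hle j hj).2]
    · rw [hvs] at hij; linarith [(hle i hi).2]
    · rw [hvi i hi, hvi j hj] at hij
      have : (i : ℝ) * h = j * h := by simpa using hij
      exact_mod_cast mul_right_cancel₀ hpos.ne' this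
  obtain ⟨ξ, hξ, hmv⟩ := hF.exists_divDiff_eq (s := insert (m + 1) (Finset.range (m + 1)))
    (v := v) (by simp) hinj hI
  rw [divDiff_insert (by simp), hvs] at hmv
  set Q := ∏ j ∈ Finset.range (m + 1), (s - v j) with hQ
  have hsv : ∀ j ∈ Finset.range (m + 1), 0 < s - v j ∧ s - v j ≤ s - a := fun j hj =>
    ⟨by linarith [(hle j hj).2], by linarith [(hle j hj).1]⟩
  have hQ0 : 0 < Q := Finset.prod_pos fun j hj => (hsv j hj).1
  have hQle : Q ≤ (s - a) ^ (m + 1) := by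
    have := Finset.prod_le_prod (fun j hj => (hsv j hj).1.le) (fun j hj => (hsv j hj).2)
    simpa using this
  have hterm : ∀ l ∈ Finset.range (m + 1),
      |Q * (F 0 (v l) / ((v l - s) * ∏ j ∈ (Finset.range (m + 1)).erase l, (v l - v j)))| ≤
      δ * (s - a) ^ m * (1 / ∏ j ∈ (Finset.range (m + 1)).erase l,
        |(a + l * h) - (a + j * h)|) := by
    intro l hl
    have e1 : Q = (s - v l) * ∏ j ∈ (Finset.range (m + 1)).erase l, (s - v j) :=
      (Finset.mul_prod_erase _ _ hl).symm
    have e2 : ∏ j ∈ (Finset.range (m + 1)).erase l, |(a + l * h) - (a + j * h)| =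
        |∏ j ∈ (Finset.range (m + 1)).erase l, (v l - v j)| := by
      rw [Finset.abs_prod]
      refine Finset.prod_congr rfl fun j hj => ?_
      rw [hvi l hl, hvi j (Finset.mem_of_mem_erase hj)]
    have e3 : ∏ j ∈ (Finset.range (m + 1)).erase l, (s - v j) ≤ (s - a) ^ m := by
      have := Finset.prod_le_prod (s := (Finset.range (m + 1)).erase l)
        (fun j hj => (hsv j (Finset.mem_of_mem_erase hj)).1.le)
        (fun j hj => (hsv j (Finset.mem_of_mem_erase hj)).2)
      rw [Finset.prod_const, Finset.card_erase_of_mem hl, Finset.card_range,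
        Nat.add_sub_cancel] at this
      exact this
    have e4 : 0 < ∏ j ∈ (Finset.range (m + 1)).erase l, (s - v j) :=
      Finset.prod_pos fun j hj => (hsv j (Finset.mem_of_mem_erase hj)).1
    have e5 : |F 0 (v l)| ≤ δ := h0 _ ⟨(hle l hl).1, (hle l hl).2.le⟩
    rw [e2, abs_mul, abs_div, abs_mul, abs_of_pos hQ0, abs_sub_comm (v l) s,
      abs_of_pos (hsv l hl).1, e1]
    have e6 := (hsv l hl).1
    calc _ = |F 0 (v l)| * (∏ j ∈ (Finset.range (m + 1)).erase l, (s - v j)) *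
          (1 / |∏ j ∈ (Finset.range (m + 1)).erase l, (v l - v j)|) := by
            field_simp
      _ ≤ _ := by gcongr
  have hsum : |Q * ∑ l ∈ Finset.range (m + 1), F 0 (v l) / ((v l - s) *
      ∏ j ∈ (Finset.range (m + 1)).erase l, (v l - v j))| ≤
      δ * (s - a) ^ m * ((2 * K / (b - a)) ^ m / m.factorial) := by
    have : 2 * K / (b - a) = 2 / h := by rw [hh]; field_simp
    rw [this, ← sum_inv_prod_equidistant m (a := a) hpos, Finset.mul_sum, Finset.mul_sum]
    exact (Finset.abs_sum_le_sum_abs _ _).trans (Finset.sum_le_sum hterm)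
  have heq : F 0 s = Q * (F (m + 1) ξ / (m + 1).factorial) -
      Q * ∑ l ∈ Finset.range (m + 1), F 0 (v l) / ((v l - s) *
      ∏ j ∈ (Finset.range (m + 1)).erase l, (v l - v j)) := by
    rw [← hmv]; field_simp; ring
  have hlast : |Q * (F (m + 1) ξ / (m + 1).factorial)| ≤
      Λ * (s - a) ^ (m + 1) / (m + 1).factorial := by
    rw [abs_mul, abs_div, abs_of_pos hQ0, Nat.abs_cast, ← mul_div_assoc, mul_comm Λ]
    have := hFk ξ hξ
    have hsa : 0 ≤ s - a := by linarith
    gcongr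
  rw [heq]
  refine (abs_sub _ _).trans ?_
  linarith

theorem IsDerivChain.mono {F : ℕ → ℝ → ℝ} {k : ℕ} {I J : Set ℝ} (h : IsDerivChain F k I)
    (hJ : J ⊆ I) : IsDerivChain F k J :=
  fun i hi x hx => (h i hi x (hJ hx)).mono hJ

theorem abs_le_of_small_on' {k : ℕ} (hk : 1 ≤ k) {a b s : ℝ} (hab : a < b) (hbs : b ≤ s)
    {F : ℕ → ℝ → ℝ} (hF : IsDerivChain F k (Icc a s)) {lam c δ : ℝ} (hc : 1 ≤ c)
    (hFk : ∀ x ∈ Icc a s, lam ≤ |F k x| ∧ |F k x| ≤ c * lam) (h0 : ∀ x ∈ Icc a b, |F 0 x| ≤ δ) :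
    |F 0 s| ≤ 2 * (c * δ) * (2 * Real.exp 1 * ((s - a) / (b - a))) ^ k := by
  have hδ : 0 ≤ δ := (abs_nonneg _).trans (h0 a ⟨le_rfl, hab.le⟩)
  have hsub : Icc a b ⊆ Icc a s := Icc_subset_Icc le_rfl hbs
  have hlen := mul_length_pow_le hk hab (hF.mono hsub) (fun x hx => (hFk x (hsub hx)).1) h0
  refine (abs_le_of_small_on hk hab hbs hF (fun x hx => (hFk x hx).2) h0).trans ?_
  have hL : 0 < b - a := by linarith
  have hx : b - a ≤ s - a := by linarith
  have hx0 : 0 < s - a := by linarith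
  have hke : (k : ℝ) ^ k / k.factorial ≤ Real.exp 1 ^ k := by
    rw [← Real.exp_nat_mul, mul_one]
    exact Real.pow_div_factorial_le_exp (k : ℝ) (by positivity) k
  set y := (s - a) / (b - a) with hy
  have hy1 : 1 ≤ y := (one_le_div hL).mpr hx
  have h1 : δ * (s - a) ^ (k - 1) * ((2 * k / (b - a)) ^ (k - 1) / (k - 1).factorial) ≤
      c * δ * (2 * Real.exp 1 * y) ^ k := by
    obtain ⟨m, rfl⟩ : ∃ m, k = m + 1 := ⟨k - 1, by omega⟩
    simp only [Nat.add_sub_cancel]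
    calc δ * (s - a) ^ m * ((2 * ((m + 1 : ℕ) : ℝ) / (b - a)) ^ m / m.factorial)
        = δ * (2 * y) ^ m * (((m + 1 : ℕ) : ℝ) ^ (m + 1) / (m + 1).factorial) := by
          rw [hy, Nat.factorial_succ]
          push_cast
          simp only [mul_pow, div_pow, pow_succ]
          field_simp
      _ ≤ δ * (2 * y) ^ (m + 1) * Real.exp 1 ^ (m + 1) := by
          have : (2 * y) ^ m ≤ (2 * y) ^ (m + 1) :=
            pow_le_pow_right₀ (by linarith) (Nat.le_succ m)
          gcongr
      _ = δ * (2 * Real.exp 1 * y) ^ (m + 1) := by rw [mul_assoc, ← mul_pow]; ring_nf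
      _ ≤ c * δ * (2 * Real.exp 1 * y) ^ (m + 1) := by
          have : δ ≤ c * δ := by nlinarith
          gcongr
  have h2 : c * lam * (s - a) ^ k / k.factorial ≤ c * δ * (2 * Real.exp 1 * y) ^ k := by
    calc c * lam * (s - a) ^ k / k.factorial
        = c * (lam * (b - a) ^ k) * y ^ k / k.factorial := by
          rw [hy, div_pow]; field_simp
      _ ≤ c * (δ * (2 * k) ^ k) * y ^ k / k.factorial := by gcongr
      _ = c * δ * (2 * y) ^ k * ((k : ℝ) ^ k / k.factorial) := by
          simp only [mul_pow]; ring
      _ ≤ c * δ * (2 * y) ^ k * Real.exp 1 ^ k := by gcongr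
      _ = c * δ * (2 * Real.exp 1 * y) ^ k := by rw [mul_assoc, ← mul_pow]; ring_nf
  linarith

/-- If the `k`-th derivative does not vanish, the integers at which a function is small split into
at most `k` classes such that the function stays small between members of the same class. -/
theorem exists_large_component {k : ℕ} (hk : 1 ≤ k) {a b : ℝ} {G : ℕ → ℝ → ℝ}
    (hG : IsDerivChain G k (Icc a b)) (hGk : ∀ x ∈ Icc a b, G k x ≠ 0) {W : Finset ℤ}
    (hI : ∀ n ∈ W, (n : ℝ) ∈ Icc a b) {δ : ℝ} (hW : ∀ n ∈ W, |G 0 n| < δ) :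
    ∃ W' ⊆ W, W.card ≤ k * W'.card ∧
      ∀ x ∈ W', ∀ y ∈ W', ∀ t ∈ Icc (x : ℝ) y, |G 0 t| ≤ δ := by
  classical
  obtain ⟨m, rfl⟩ : ∃ m, k = m + 1 := ⟨k - 1, by omega⟩
  have hno : ∀ T : Finset ℝ, (∀ x ∈ T, x ∈ Icc a b ∧ G 1 x = 0) → T.card ≠ m + 1 := by
    intro T hT hc
    obtain ⟨ξ, hξ, h⟩ := hG.tail.exists_eq_zero T hc (fun x hx => (hT x hx).1)
      (fun x hx => (hT x hx).2)
    exact hGk ξ hξ h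
  have hfin : {x | x ∈ Icc a b ∧ G 1 x = 0}.Finite := by
    by_contra hinf
    obtain ⟨T, hT, hc⟩ := Set.Infinite.exists_subset_card_eq hinf (m + 1)
    exact hno T (fun x hx => hT hx) hc
  set Z := hfin.toFinset with hZ
  have hZmem : ∀ x, x ∈ Z ↔ x ∈ Icc a b ∧ G 1 x = 0 := fun x => by simp [hZ]
  have hZcard : Z.card < m + 1 := by
    by_contra! hcon
    obtain ⟨T, hT, hc⟩ := Finset.exists_subset_card_eq hcon
    exact hno T (fun x hx => (hZmem x).mp (hT hx)) hc
  let φ : ℤ → ℕ := fun w => (Z.filter (· < (w : ℝ))).card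
  have hφ : ∀ w ∈ W, φ w ∈ Finset.range (m + 1) := fun w _ =>
    Finset.mem_range.mpr ((Finset.card_filter_le _ _).trans_lt hZcard)
  obtain ⟨y, -, hy⟩ := Finset.exists_max_image (Finset.range (m + 1))
    (fun y => (W.filter (φ · = y)).card) ⟨0, by simp⟩
  refine ⟨W.filter (φ · = y), Finset.filter_subset _ _, ?_, ?_⟩
  · have := Finset.card_le_mul_card_image_of_maps_to hφ _ hy
    rwa [Finset.card_range, mul_comm] at this
  · intro p hp q hq t ht
    obtain ⟨hpW, hpy⟩ := Finset.mem_filter.mp hp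
    obtain ⟨hqW, hqy⟩ := Finset.mem_filter.mp hq
    by_contra! hcon
    have hpq : (p : ℝ) ≤ q := ht.1.trans ht.2
    have hsub : Icc (p : ℝ) q ⊆ Icc a b := Icc_subset_Icc (hI p hpW).1 (hI q hqW).2
    have hcont : ContinuousOn (fun x => (G 0 x) ^ 2) (Icc (p : ℝ) q) := by
      refine ContinuousOn.pow (fun x hx => ?_) 2
      exact ((hG 0 (by omega) x (hsub hx)).continuousWithinAt).mono hsub
    obtain ⟨z, hz, hmax⟩ := isCompact_Icc.exists_isMaxOn ⟨t, ht⟩ hcont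
    have hδz : δ < |G 0 z| := by
      have h1 : (G 0 t) ^ 2 ≤ (G 0 z) ^ 2 := hmax ht
      exact hcon.trans_le (sq_le_sq.mp h1)
    have hδ0 : 0 < δ := (abs_nonneg _).trans_lt (hW p hpW)
    have hzp : (p : ℝ) < z := lt_of_le_of_ne hz.1 fun h => by
      have := hW p hpW
      rw [h] at this
      linarith
    have hzq : z < q := lt_of_le_of_ne hz.2 fun h => by
      have := hW q hqW
      rw [← h] at this
      linarith
    have hnhds : Icc (p : ℝ) q ∈ nhds z := Icc_mem_nhds hzp hzq
    have hder : HasDerivAt (G 0) (G 1 z) z :=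
      (hG 0 (by omega) z (hsub hz)).hasDerivAt (Filter.mem_of_superset hnhds hsub)
    have hzero := (hmax.isLocalMax hnhds).hasDerivAt_eq_zero (hder.pow 2)
    have hG1 : G 1 z = 0 := by
      have : G 0 z ≠ 0 := abs_pos.mp (hδ0.trans hδz)
      simpa [this] using hzero
    have hlt : φ p < φ q := by
      refine Finset.card_lt_card ⟨?_, ?_⟩
      · intro x hx
        rw [Finset.mem_filter] at hx ⊢
        exact ⟨hx.1, hx.2.trans_le hpq⟩
      · intro hsub'
        have : z ∈ Z.filter (· < (q : ℝ)) :=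
          Finset.mem_filter.mpr ⟨(hZmem z).mpr ⟨hsub hz, hG1⟩, hzq⟩
        have := (Finset.mem_filter.mp (hsub' this)).2
        linarith
    omega

theorem card_le_of_spread {k : ℕ} (hk : 1 ≤ k) {W : Finset ℤ} {D L a : ℝ} (hD : 0 < D)
    (hL : 0 ≤ L) (hW : ∀ n ∈ W, a ≤ n ∧ (n : ℝ) ≤ a + L)
    (hU : ∀ U ⊆ W, U.card = k → ∃ x ∈ U, ∃ y ∈ U, D ≤ ((y - x : ℤ) : ℝ)) :
    (W.card : ℝ) ≤ (k - 1) * (L / D + 1) := by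
  have hf : ∀ n ∈ W, ⌊((n : ℝ) - a) / D⌋₊ ∈ Finset.range (⌊L / D⌋₊ + 1) := by
    intro n hn
    rw [Finset.mem_range, Nat.lt_succ_iff]
    refine Nat.floor_le_floor ?_
    have := (hW n hn).2
    gcongr
    linarith
  have h1 := Finset.card_le_mul_card_image_of_maps_to hf (k - 1) (by
    intro i _
    by_contra! hcon
    obtain ⟨U, hUs, hUc⟩ := Finset.exists_subset_card_eq 
      (show k ≤ (W.filter fun n : ℤ => ⌊((n : ℝ) - a) / D⌋₊ = i).card by omega)
    obtain ⟨x, hx, y, hy, hxy⟩ := hU U (hUs.trans (Finset.filter_subset _ _)) hUc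
    obtain ⟨hxW, hxi⟩ := Finset.mem_filter.mp (hUs hx)
    obtain ⟨hyW, hyi⟩ := Finset.mem_filter.mp (hUs hy)
    have h2 : (i : ℝ) ≤ ((x : ℝ) - a) / D := by
      rw [← hxi]
      exact Nat.floor_le (div_nonneg (by linarith [(hW x hxW).1]) hD.le)
    have h3 : ((y : ℝ) - a) / D < i + 1 := by
      rw [← hyi]
      exact Nat.lt_floor_add_one _
    rw [le_div_iff₀ hD] at h2
    rw [div_lt_iff₀ hD] at h3
    push_cast at hxy
    nlinarith)
  rw [Finset.card_range] at h1
  have h4 : (W.card : ℝ) ≤ ((k - 1) * (⌊L / D⌋₊ + 1) : ℕ) := by exact_mod_cast h1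
  push_cast [Nat.cast_sub hk] at h4
  have h5 : (⌊L / D⌋₊ : ℝ) ≤ L / D := Nat.floor_le (by positivity)
  have h6 : (0 : ℝ) ≤ k - 1 := by
    have : (1 : ℝ) ≤ k := by exact_mod_cast hk
    linarith
  exact h4.trans (by gcongr)

theorem exists_min_spread {k : ℕ} (hk : 2 ≤ k) {W : Finset ℤ} (hW : k ≤ W.card) :
    ∃ U ⊆ W, U.card = k ∧ ∃ d : ℕ, 1 ≤ d ∧ (∀ x ∈ U, ∀ y ∈ U, y - x ≤ d) ∧
      ∀ U' ⊆ W, U'.card = k → ∃ x ∈ U', ∃ y ∈ U', d ≤ y - x := by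
  let sp : Finset ℤ → ℕ := fun U => (U ×ˢ U).sup fun p => (p.2 - p.1).toNat
  obtain ⟨U, hU, hmin⟩ := Finset.exists_min_image (W.powersetCard k) sp
    (Finset.powersetCard_nonempty.mpr hW)
  obtain ⟨hUW, hUk⟩ := Finset.mem_powersetCard.mp hU
  have hle : ∀ x ∈ U, ∀ y ∈ U, (y - x).toNat ≤ sp U := fun x hx y hy =>
    Finset.le_sup (f := fun p : ℤ × ℤ => (p.2 - p.1).toNat) (Finset.mk_mem_product hx hy)
  have hd : 1 ≤ sp U := by
    obtain ⟨x, hx, y, hy, hxy⟩ := Finset.one_lt_card.mp (show 1 < U.card by omega)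
    have h1 := hle x hx y hy
    have h2 := hle y hy x hx
    omega
  refine ⟨U, hUW, hUk, sp U, hd, fun x hx y hy => ?_, fun U' hU' hk' => ?_⟩
  · have := hle x hx y hy
    omega
  · have hne : U'.Nonempty := Finset.card_pos.mp (by omega)
    obtain ⟨p, hp, hpe⟩ := Finset.exists_mem_eq_sup (U' ×ˢ U') (hne.product hne)
      (fun p => (p.2 - p.1).toNat)
    have h1 := hmin U' (Finset.mem_powersetCard.mpr ⟨hU', hk'⟩)
    obtain ⟨hp1, hp2⟩ := Finset.mem_product.mp hp
    refine ⟨p.1, hp1, p.2, hp2, ?_⟩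
    have h2 : sp U' = (p.2 - p.1).toNat := hpe
    omega

theorem iterate_derivative_sub_eq {F : ℕ → ℝ → ℝ} {k : ℕ} {P : Polynomial ℝ} (hP : P.degree < k)
    (x : ℝ) : F k x - (Polynomial.derivative^[k] P).eval x = F k x := by
  rw [Polynomial.iterate_derivative_eq_zero_of_degree_lt hP, Polynomial.eval_zero, sub_zero]

/-- The number of points on a common curve of degree less than `k`, in terms of the distance to a
further point that does not lie on this curve. -/
theorem card_run_le {k : ℕ} (hk : 3 ≤ k) {a b : ℝ} {F : ℕ → ℝ → ℝ}
    (hF : IsDerivChain F k (Icc a b)) {lam c δ d l : ℝ} (hlam : 0 < lam) (hc : 1 ≤ c)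
    (hδ : 0 < δ) (hd : 0 ≤ d) (hdk : d ^ (k.choose 2) = c * δ) (hl0 : 0 ≤ l)
    (hFk : ∀ x ∈ Icc a b, lam ≤ |F k x| ∧ |F k x| ≤ c * lam)
    {W : Finset ℤ} {s : ℤ} (hs : ∀ n ∈ W, n < s)
    (hI : ∀ n ∈ insert s W, (n : ℝ) ∈ Icc a b) (m : ℤ → ℤ)
    (hm : ∀ n ∈ insert s W, |F 0 n - m n| < δ)
    {P : Polynomial ℝ} (hP : P.degree < k)
    (hPm : ∀ n ∈ W, P.eval (n : ℝ) = m n) (hPs : P.eval (s : ℝ) ≠ m s)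
    (hl : ∀ n ∈ W, (s : ℝ) - n ≤ l) :
    (W.card : ℝ) ≤ 2 * k ^ 2 + 8 * Real.exp 1 * k ^ 2 * d * l := by
  have hk3 : (3 : ℝ) ≤ k := by exact_mod_cast hk
  have he : 1 ≤ Real.exp 1 := Real.one_le_exp (by norm_num)
  have hdl : 0 ≤ d * l := by positivity
  by_contra! hcon
  have hbig : (2 * k ^ 2 : ℝ) < W.card := by
    have : 0 ≤ 8 * Real.exp 1 * k ^ 2 * d * l := by positivity
    linarith
  have hcard : k ≤ W.card := by
    have : (k : ℝ) ≤ W.card := by nlinarith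
    exact_mod_cast this
  obtain ⟨U, hUW, hUk, A, hA1, hUA, hUmin⟩ := exists_min_spread (by omega) hcard
  have hA0 : (0 : ℝ) < A := by exact_mod_cast hA1
  have hspread : ∀ U' ⊆ W, U'.card = k → ∃ x ∈ U', ∃ y ∈ U', (A : ℝ) ≤ ((y - x : ℤ) : ℝ) := by
    intro U' h1 h2
    obtain ⟨x, hx, y, hy, h⟩ := hUmin U' h1 h2
    exact ⟨x, hx, y, hy, by exact_mod_cast h⟩
  have hM1 : k.choose 2 ≠ 0 := by
    have := le_choose_two hk
    omega
  rcases le_or_gt 1 (2 * (d * A)) with hcase | hcase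
  · have h1 := card_le_of_spread (a := s - l) (by omega) hA0 hl0 (fun n hn => by
      have h2 : (n : ℝ) < s := by exact_mod_cast hs n hn
      have h3 := hl n hn
      constructor <;> linarith) hspread
    have h2 : l / A ≤ 2 * (d * l) := by
      rw [div_le_iff₀ hA0]
      nlinarith
    have h4 : (W.card : ℝ) ≤ k * (2 * (d * l) + 1) := by
      refine h1.trans ?_
      have : 0 ≤ l / A := by positivity
      nlinarith
    have h5 : (k : ℝ) * (2 * (d * l)) ≤ 8 * Real.exp 1 * k ^ 2 * (d * l) := by
      have : (k : ℝ) * 2 ≤ 8 * Real.exp 1 * k ^ 2 := by nlinarith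
      nlinarith
    nlinarith
  · have hsW : s ∉ U := fun h => lt_irrefl _ (hs s (hUW h))
    have hdA : 0 ≤ d * A := by positivity
    set G : ℕ → ℝ → ℝ := fun i x => F i x - (Polynomial.derivative^[i] P).eval x with hGdef
    have hG : IsDerivChain G k (Icc a b) := hF.sub_polynomial P
    have hGk : ∀ x, G k x = F k x := iterate_derivative_sub_eq hP
    have hGW : ∀ n ∈ W, |G 0 n| < δ := fun n hn => by
      have := hm n (Finset.mem_insert_of_mem hn)
      rw [← hPm n hn] at this
      exact this
    have hone := one_le_diffProd_mul_abs_sub hsW hUk m hP (fun n hn => hPm n (hUW hn)) hPs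
    have hV : (diffProd U : ℝ) ≤ (A : ℝ) ^ (k.choose 2) := by
      rw [← hUk]
      exact diffProd_le U A fun x hx y hy => by exact_mod_cast hUA x hx y hy
    set q := (A : ℝ) ^ (k.choose 2) with hq
    have hq0 : 0 < q := by positivity
    have hqc : c * δ * q = (d * A) ^ (k.choose 2) := by rw [mul_pow, hdk]
    have hqle : (d * A) ^ (k.choose 2) ≤ 1 / 2 :=
      (pow_le_of_le_one hdA (by linarith) hM1).trans (by linarith)
    have hGs : 1 ≤ 2 * q * |G 0 s| := by
      have h1 : 1 ≤ q * |m s - P.eval (s : ℝ)| := hone.trans (by gcongr)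
      have h2 : |(m s : ℝ) - P.eval (s : ℝ)| ≤ |G 0 s| + δ := by
        have h3 : (m s : ℝ) - P.eval (s : ℝ) = G 0 s - (F 0 s - m s) := by
          simp only [hGdef, Function.iterate_zero, id]
          ring
        rw [h3]
        have := hm s (Finset.mem_insert_self _ _)
        exact (abs_sub _ _).trans (by linarith)
      have h3 : δ * q ≤ 1 / 2 := by
        have : δ * q ≤ c * δ * q := by
          have : 0 < δ * q := by positivity
          nlinarith
        linarith
      nlinarith
    obtain ⟨W', hW'W, hW'card, hsmall⟩ := exists_large_component (by omega) hG
      (fun x hx h => by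
        have := (hFk x hx).1
        rw [← hGk, h, abs_zero] at this
        linarith) (fun n hn => hI n (Finset.mem_insert_of_mem hn)) hGW
    have hW'card' : (W.card : ℝ) ≤ k * W'.card := by exact_mod_cast hW'card
    have hW'big : (2 * k : ℝ) < W'.card := by
      by_contra! h
      nlinarith
    have hne : W'.Nonempty := Finset.card_pos.mp (by
      have : (0 : ℝ) < W'.card := by linarith
      exact_mod_cast this)
    set p := W'.min' hne with hp
    set r := W'.max' hne with hr
    have hpW : p ∈ W' := Finset.min'_mem _ _
    have hrW : r ∈ W' := Finset.max'_mem _ _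
    have hpr : (p : ℝ) ≤ r := by exact_mod_cast Finset.min'_le_max' _ _
    have h1 := card_le_of_spread (W := W') (k := k) (a := p) (L := r - p) (by omega) hA0
      (by linarith) (fun n hn => by
        have h2 : (p : ℝ) ≤ n := by exact_mod_cast Finset.min'_le _ _ hn
        have h3 : (n : ℝ) ≤ r := by exact_mod_cast Finset.le_max' _ _ hn
        constructor <;> linarith)
      (fun U' hU' hk' => hspread U' (hU'.trans hW'W) hk')
    have hLA : 1 < ((r : ℝ) - p) / A := by
      by_contra! h
      have : 0 ≤ ((r : ℝ) - p) / A := div_nonneg (by linarith) hA0.le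
      nlinarith
    have hprlt : (p : ℝ) < r := by
      rw [lt_div_iff₀ hA0] at hLA
      linarith
    have hrs : (r : ℝ) ≤ s := by exact_mod_cast (hs r (hW'W hrW)).le
    have hsubI : Icc (p : ℝ) s ⊆ Icc a b := Icc_subset_Icc
      (hI p (Finset.mem_insert_of_mem (hW'W hpW))).1 (hI s (Finset.mem_insert_self _ _)).2
    have hgrow := abs_le_of_small_on' (by omega : 1 ≤ k) hprlt hrs (hG.mono hsubI) hc
      (fun x hx => by rw [hGk]; exact hFk x (hsubI hx)) (hsmall p hpW r hrW)
    set y := 2 * Real.exp 1 * (((s : ℝ) - p) / (r - p)) with hy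
    have hy0 : 0 ≤ y := mul_nonneg (by positivity) (div_nonneg (by linarith) (by linarith))
    have h4 : 1 ≤ (2 * (d * A) * y) ^ k := by
      calc (1 : ℝ) ≤ 2 * q * |G 0 s| := hGs
        _ ≤ 2 * q * (2 * (c * δ) * y ^ k) := by gcongr
        _ = 4 * (d * A) ^ (k.choose 2) * y ^ k := by rw [← hqc]; ring
        _ ≤ 2 ^ k * (d * A) ^ k * y ^ k := by
          have h5 : (d * A) ^ (k.choose 2) ≤ (d * A) ^ k :=
            pow_le_pow_of_le_one hdA (by linarith) (le_choose_two hk)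
          have h6 : (4 : ℝ) ≤ 2 ^ k := by
            calc (4 : ℝ) = 2 ^ 2 := by norm_num
              _ ≤ 2 ^ k := pow_le_pow_right₀ (by norm_num) (by omega)
          gcongr
        _ = _ := by rw [← mul_pow, ← mul_pow]
    have h5 : 1 ≤ 2 * (d * A) * y := by
      by_contra! h
      have := pow_lt_one₀ (by positivity) h (show k ≠ 0 by omega)
      linarith
    have h6 : ((r : ℝ) - p) / A ≤ 4 * Real.exp 1 * (d * l) := by
      have hL : (0 : ℝ) < r - p := by linarith
      have h7 : 2 * (d * A) * y * (r - p) = 4 * Real.exp 1 * d * ((s : ℝ) - p) * A := by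
        rw [hy]; field_simp; ring
      have h8 : (r : ℝ) - p ≤ 4 * Real.exp 1 * d * ((s : ℝ) - p) * A := by
        rw [← h7]
        exact le_mul_of_one_le_left hL.le h5
      rw [div_le_iff₀ hA0]
      refine h8.trans ?_
      have := hl p (hW'W hpW)
      calc 4 * Real.exp 1 * d * ((s : ℝ) - p) * A ≤ 4 * Real.exp 1 * d * l * A := by gcongr
        _ = _ := by ring
    have h7 : (W'.card : ℝ) ≤ k * (2 * (4 * Real.exp 1 * (d * l))) := by
      refine h1.trans ?_
      have : (((r : ℝ) - p) / A + 1) ≤ 2 * (4 * Real.exp 1 * (d * l)) := by linarith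
      exact mul_le_mul (by linarith) this (by linarith) (by linarith)
    have h8 := mul_le_mul_of_nonneg_left h7 (by linarith : (0 : ℝ) ≤ k)
    have h9 : (k : ℝ) * (k * (2 * (4 * Real.exp 1 * (d * l)))) =
        8 * Real.exp 1 * k ^ 2 * d * l := by ring
    have h10 : 0 ≤ 2 * (k : ℝ) ^ 2 := by positivity
    linarith

/-- The number of points on a common curve of degree less than `k`. -/
theorem card_on_curve_le {k : ℕ} (hk : 3 ≤ k) {a b : ℝ} {F : ℕ → ℝ → ℝ}
    (hF : IsDerivChain F k (Icc a b)) {lam δ ρ : ℝ} (hlam : 0 < lam)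
    (hρ : 0 ≤ ρ) (hρk : ρ ^ k = δ / lam)
    (hFk : ∀ x ∈ Icc a b, lam ≤ |F k x|)
    {W : Finset ℤ} (hI : ∀ n ∈ W, (n : ℝ) ∈ Icc a b) (m : ℤ → ℤ)
    (hm : ∀ n ∈ W, |F 0 n - m n| < δ)
    {P : Polynomial ℝ} (hP : P.degree < k) (hPm : ∀ n ∈ W, P.eval (n : ℝ) = m n) :
    (W.card : ℝ) ≤ 2 * k ^ 2 * ρ + k := by
  have hk3 : (3 : ℝ) ≤ k := by exact_mod_cast hk
  set G : ℕ → ℝ → ℝ := fun i x => F i x - (Polynomial.derivative^[i] P).eval x with hGdef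
  have hG : IsDerivChain G k (Icc a b) := hF.sub_polynomial P
  have hGk : ∀ x, G k x = F k x := iterate_derivative_sub_eq hP
  have hGW : ∀ n ∈ W, |G 0 n| < δ := fun n hn => by
    have := hm n hn
    rw [← hPm n hn] at this
    exact this
  obtain ⟨W', hW'W, hW'card, hsmall⟩ := exists_large_component (by omega) hG
    (fun x hx h => by
      have := hFk x hx
      rw [← hGk, h, abs_zero] at this
      linarith) hI hGW
  have hW'card' : (W.card : ℝ) ≤ k * W'.card := by exact_mod_cast hW'card
  have hkey : (W'.card : ℝ) ≤ 2 * k * ρ + 1 := by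
    rcases W'.eq_empty_or_nonempty with rfl | hne
    · simp only [Finset.card_empty, Nat.cast_zero]; positivity
    set p := W'.min' hne with hp
    set r := W'.max' hne with hr
    have hpW : p ∈ W' := Finset.min'_mem _ _
    have hrW : r ∈ W' := Finset.max'_mem _ _
    have hpr : p ≤ r := Finset.min'_le_max' _ _
    have hc1 : (W'.card : ℝ) ≤ (r - p) + 1 := by
      have h1 : W' ⊆ Finset.Icc p r := fun n hn =>
        Finset.mem_Icc.mpr ⟨Finset.min'_le _ _ hn, Finset.le_max' _ _ hn⟩
      have h2 := Finset.card_le_card h1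
      rw [Int.card_Icc] at h2
      have h3 : (W'.card : ℤ) ≤ r - p + 1 := by omega
      exact_mod_cast h3
    rcases hpr.eq_or_lt with h | h
    · rw [h, sub_self, zero_add] at hc1
      have : 0 ≤ 2 * k * ρ := by positivity
      linarith
    · have h' : (p : ℝ) < r := by exact_mod_cast h
      have hsubI : Icc (p : ℝ) r ⊆ Icc a b :=
        Icc_subset_Icc (hI p (hW'W hpW)).1 (hI r (hW'W hrW)).2
      have h1 := mul_length_pow_le (by omega : 1 ≤ k) h' (hG.mono hsubI)
        (fun x hx => by rw [hGk]; exact hFk x (hsubI hx)) (hsmall p hpW r hrW)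
      have h2 : ((r : ℝ) - p) ^ k ≤ (2 * k * ρ) ^ k := by
        rw [mul_pow _ ρ, hρk, ← mul_div_assoc, le_div_iff₀ hlam]
        linarith
      have h3 := le_of_pow_le_pow_left₀ (by omega) (by positivity) h2
      linarith
  nlinarith

/-- Greedy decomposition of a finite set of integers into maximal initial segments having a given
property. -/
theorem card_le_of_runs {Good : Finset ℤ → Prop} (hempty : Good ∅) (hsing : ∀ n, Good {n})
    {S : Finset ℤ} {Θ C e : ℝ} (hΘ : 0 ≤ Θ) (hfin : ∀ W ⊆ S, Good W → (W.card : ℝ) ≤ C)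
    (hrun : ∀ W ⊆ S, ∀ s ∈ S, ∀ p ∈ W, (∀ n ∈ W, p ≤ n) → (∀ n ∈ W, n < s) → Good W →
      ¬ Good (insert s W) → (W.card : ℝ) ≤ Θ * (s - p))
    {X : Finset ℤ} (hX : X ⊆ S) {a : ℝ} (hae : a ≤ e) (ha : ∀ n ∈ X, a ≤ n ∧ (n : ℝ) ≤ e) :
    (X.card : ℝ) ≤ Θ * (e - a) + C := by
  classical
  induction hc : X.card using Nat.strong_induction_on generalizing X a with
  | _ c ih =>
  subst hc
  have hnn : ∀ a : ℝ, a ≤ e → 0 ≤ Θ * (e - a) := fun a h => mul_nonneg hΘ (by linarith)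
  by_cases hg : Good X
  · linarith [hfin X hX hg, hnn a hae]
  have hXne : X.Nonempty := Finset.nonempty_iff_ne_empty.mpr fun h => hg (h ▸ hempty)
  set T := X.filter fun t => ¬ Good (X.filter (· ≤ t)) with hT
  have hTne : T.Nonempty := by
    refine ⟨X.max' hXne, Finset.mem_filter.mpr ⟨Finset.max'_mem _ _, ?_⟩⟩
    rwa [Finset.filter_true_of_mem fun n hn => Finset.le_max' _ _ hn]
  set s := T.min' hTne with hs
  obtain ⟨hsX, hsg⟩ := Finset.mem_filter.mp (Finset.min'_mem T hTne)
  set W := X.filter (· < s) with hW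
  have hgW : Good W := by
    rcases W.eq_empty_or_nonempty with h | hne
    · rwa [h]
    · by_contra hng
      obtain ⟨htX, hts⟩ := Finset.mem_filter.mp (Finset.max'_mem W hne)
      have heq : X.filter (· ≤ W.max' hne) = W := by
        ext n
        refine ⟨fun hn => ?_, fun hn => ?_⟩
        · obtain ⟨h1, h2⟩ := Finset.mem_filter.mp hn
          exact Finset.mem_filter.mpr ⟨h1, h2.trans_lt hts⟩
        · exact Finset.mem_filter.mpr ⟨(Finset.mem_filter.mp hn).1, Finset.le_max' _ _ hn⟩
      have : W.max' hne ∈ T := Finset.mem_filter.mpr ⟨htX, by rwa [heq]⟩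
      exact absurd hts (not_lt.mpr (Finset.min'_le _ _ this))
  have hins : insert s W = X.filter (· ≤ s) := by
    ext n
    simp only [hW, Finset.mem_insert, Finset.mem_filter]
    constructor
    · rintro (rfl | ⟨h1, h2⟩)
      · exact ⟨hsX, le_rfl⟩
      · exact ⟨h1, h2.le⟩
    · rintro ⟨h1, h2⟩
      rcases h2.eq_or_lt with h | h
      · exact Or.inl h
      · exact Or.inr ⟨h1, h⟩
  have hngi : ¬ Good (insert s W) := by rwa [hins]
  have hWne : W.Nonempty := by
    by_contra h
    rw [Finset.not_nonempty_iff_eq_empty] at h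
    rw [h] at hngi
    exact hngi (hsing s)
  have hWX : W ⊆ X := Finset.filter_subset _ _
  have h1 := hrun W (hWX.trans hX) s (hX hsX) (W.min' hWne) (Finset.min'_mem _ _)
    (fun n hn => Finset.min'_le _ _ hn) (fun n hn => (Finset.mem_filter.mp hn).2) hgW hngi
  have hsum : W.card + (X.filter fun n => ¬ n < s).card = X.card :=
    Finset.card_filter_add_card_filter_not _
  have hWpos : 0 < W.card := Finset.card_pos.mpr hWne
  have h2 := ih (X.filter fun n => ¬ n < s).card (by omega) (X := X.filter fun n => ¬ n < s)
    ((Finset.filter_subset _ _).trans hX) (ha s hsX).2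
    (fun n hn => by
      obtain ⟨h3, h4⟩ := Finset.mem_filter.mp hn
      exact ⟨by exact_mod_cast not_lt.mp h4, (ha n h3).2⟩) rfl
  have h3 : (X.card : ℝ) = W.card + (X.filter fun n => ¬ n < s).card := by
    exact_mod_cast hsum.symm
  have h4 := (ha _ (hWX (Finset.min'_mem W hWne))).1
  have h5 : Θ * (s - W.min' hWne) ≤ Θ * (s - a) :=
    mul_le_mul_of_nonneg_left (by linarith) hΘ
  rw [h3]
  have h6 : Θ * (e - a) = Θ * (s - a) + Θ * (e - s) := by ring
  linarith

theorem exists_polynomial_of_card_le {k : ℕ} {W : Finset ℤ} (hW : W.card ≤ k) (m : ℤ → ℤ) :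
    ∃ P : Polynomial ℝ, P.degree < k ∧ ∀ n ∈ W, P.eval (n : ℝ) = m n := by
  have hinj : InjOn (fun n : ℤ => (n : ℝ)) W := Int.cast_injective.injOn
  refine ⟨Lagrange.interpolate W (fun n : ℤ => (n : ℝ)) (fun n => (m n : ℝ)), ?_, fun n hn => ?_⟩
  · exact (Lagrange.degree_interpolate_lt _ hinj).trans_le (by exact_mod_cast hW)
  · exact Lagrange.eval_interpolate_at_node _ hinj hn

theorem rpow_choose_two_pow {x e : ℝ} (hx : 0 ≤ x) {n : ℕ} (he : e * n.choose 2 = 1) :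
    (x ^ e) ^ (n.choose 2) = x := by
  rw [← Real.rpow_natCast, ← Real.rpow_mul hx, he, Real.rpow_one]

theorem run_count_arith {k N E u d dc ρ a b b' : ℝ} (hk : 3 ≤ k) (hN : 0 ≤ N) (hE : 1 ≤ E)
    (hdc0 : 0 ≤ dc) (hρ : 0 ≤ ρ) (hu : u = a * b) (hdc : dc = b' * d) :
    (2 * k ^ 2 * (u + 2 * d) + 8 * E * k ^ 2 * dc) * (2 * N - N) + (2 * k ^ 2 * ρ + k) ≤
      2 * k ^ 2 * a * N * b + (30 * E ^ 3 * k ^ 2 * b' + 4 * k ^ 2) * N * d + 16 * k ^ 3 * ρ +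
        2 * k ^ 2 * (5 * E ^ 3 + 1) := by
  have hE3 : E ≤ E ^ 3 := le_self_pow₀ hE (by norm_num)
  have h1 : 8 * E * (k ^ 2 * dc * N) ≤ 30 * E ^ 3 * (k ^ 2 * dc * N) :=
    mul_le_mul_of_nonneg_right (by linarith) (by positivity)
  have hk3 : 2 * k ^ 2 ≤ 16 * k ^ 3 := by nlinarith [sq_nonneg k]
  have h2 : 2 * k ^ 2 * ρ ≤ 16 * k ^ 3 * ρ := mul_le_mul_of_nonneg_right hk3 hρ
  have h3 : 2 * k ^ 2 * 1 ≤ 2 * k ^ 2 * (5 * E ^ 3 + 1) :=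
    mul_le_mul_of_nonneg_left (by linarith) (by positivity)
  have h4 : k ≤ 2 * k ^ 2 := by nlinarith
  have h5 : (30 * E ^ 3 * k ^ 2 * b' + 4 * k ^ 2) * N * d =
      30 * E ^ 3 * (k ^ 2 * dc * N) + 4 * k ^ 2 * N * d := by
    rw [hdc]; ring
  have h6 : (2 * k ^ 2 * (u + 2 * d) + 8 * E * k ^ 2 * dc) * (2 * N - N) =
      2 * k ^ 2 * a * N * b + 4 * k ^ 2 * N * d + 8 * E * (k ^ 2 * dc * N) := by
    rw [hu]; ring
  linarith

theorem stmt_0 (k N : ℕ) (hk : 3 ≤ k) (hN : 4 ≤ N)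
    (δ : ℝ) (hδ0 : 0 < δ) (hδ1 : δ < 1/4)
    (f : ℝ → ℝ) (lam c : ℝ) (hlam : 0 < lam) (hc : 1 ≤ c)
    (hf : ContDiffOn ℝ k f (Set.Icc (N:ℝ) (2*N)))
    (hder : ∀ x ∈ Set.Icc (N:ℝ) (2*N),
      lam ≤ |iteratedDerivWithin k f (Set.Icc (N:ℝ) (2*N)) x| ∧
      |iteratedDerivWithin k f (Set.Icc (N:ℝ) (2*N)) x| ≤ c * lam) :
    (({n : ℤ | (N:ℤ) ≤ n ∧ n ≤ 2*N ∧ |f n - round (f n)| < δ}.ncard : ℝ)) ≤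
      (2*(k:ℝ)^2 * c ^ ((2:ℝ)/((k:ℝ)*((k:ℝ)+1)))) * N * lam ^ ((2:ℝ)/((k:ℝ)*((k:ℝ)+1)))
      + (30 * Real.exp 1 ^ 3 * (k:ℝ)^2 * c ^ ((2:ℝ)/((k:ℝ)*((k:ℝ)-1))) + 4*(k:ℝ)^2)
          * N * δ ^ ((2:ℝ)/((k:ℝ)*((k:ℝ)-1)))
      + 16 * (k:ℝ)^3 * (δ/lam) ^ ((1:ℝ)/(k:ℝ))
      + 2*(k:ℝ)^2 * (5 * Real.exp 1 ^ 3 + 1) := by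
  have hk3 : (3 : ℝ) ≤ k := by exact_mod_cast hk
  have hN4 : (4 : ℝ) ≤ N := by exact_mod_cast hN
  have he : 1 ≤ Real.exp 1 := Real.one_le_exp (by norm_num)
  have hc0 : 0 < c := by linarith
  set F : ℕ → ℝ → ℝ := fun i => iteratedDerivWithin i f (Icc (N : ℝ) (2 * N)) with hFdef
  have hF : IsDerivChain F k (Icc (N : ℝ) (2 * N)) :=
    IsDerivChain.of_contDiffOn (by linarith) hf
  have hF0 : ∀ x, F 0 x = f x := fun x => by simp [hFdef]
  set eF : ℝ := (2 : ℝ) / ((k : ℝ) * ((k : ℝ) + 1)) with heF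
  set eE : ℝ := (2 : ℝ) / ((k : ℝ) * ((k : ℝ) - 1)) with heE
  have heF1 : eF * (k + 1).choose 2 = 1 := by
    rw [Nat.cast_choose_two, heF]
    push_cast
    field_simp
    ring
  have heE1 : eE * k.choose 2 = 1 := by
    have : (k : ℝ) - 1 ≠ 0 := by linarith
    rw [Nat.cast_choose_two, heE]
    field_simp
  set u : ℝ := (c * lam) ^ eF with hu
  set d : ℝ := δ ^ eE with hd
  set dc : ℝ := (c * δ) ^ eE with hdc
  set ρ : ℝ := (δ / lam) ^ ((1 : ℝ) / k) with hρ
  have hu0 : 0 ≤ u := by positivity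
  have hd0 : 0 ≤ d := by positivity
  have hdc0 : 0 ≤ dc := by positivity
  have hρ0 : 0 ≤ ρ := by positivity
  have huM : u ^ ((k + 1).choose 2) = c * lam := rpow_choose_two_pow (by positivity) heF1
  have hdM : d ^ (k.choose 2) = δ := rpow_choose_two_pow (by positivity) heE1
  have hdcM : dc ^ (k.choose 2) = c * δ := rpow_choose_two_pow (by positivity) heE1
  have hρk : ρ ^ k = δ / lam := by
    rw [hρ, one_div, Real.rpow_inv_natCast_pow (by positivity) (by omega)]
  set S : Finset ℤ := (Finset.Icc (N : ℤ) (2 * N)).filter fun n => |f n - round (f n)| < δ with hS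
  have hSset : {n : ℤ | (N : ℤ) ≤ n ∧ n ≤ 2 * N ∧ |f n - round (f n)| < δ} = S := by
    ext n
    simp [hS, and_assoc]
  have hSI : ∀ n ∈ S, (n : ℝ) ∈ Icc (N : ℝ) (2 * N) := by
    intro n hn
    obtain ⟨h1, h2⟩ := Finset.mem_Icc.mp (Finset.mem_filter.mp hn).1
    exact ⟨by exact_mod_cast h1, by exact_mod_cast h2⟩
  let m : ℤ → ℤ := fun n => round (f n)
  have hSm : ∀ n ∈ S, |F 0 n - m n| < δ := fun n hn => by
    rw [hF0]
    exact (Finset.mem_filter.mp hn).2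
  let Good : Finset ℤ → Prop := fun W =>
    ∃ P : Polynomial ℝ, P.degree < k ∧ ∀ n ∈ W, P.eval (n : ℝ) = m n
  set Θ : ℝ := 2 * k ^ 2 * (u + 2 * d) + 8 * Real.exp 1 * k ^ 2 * dc with hΘ
  have hmain : (S.card : ℝ) ≤ Θ * (2 * N - N) + (2 * k ^ 2 * ρ + k) := by
    refine card_le_of_runs (Good := Good) (exists_polynomial_of_card_le (by simp) m)
      (fun n => exists_polynomial_of_card_le (by simp; omega) m) (by positivity) ?_ ?_
      (Finset.Subset.refl S) (by linarith) (fun n hn => hSI n hn)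
    · rintro W hWS ⟨P, hP, hPm⟩
      exact card_on_curve_le hk hF hlam hρ0 hρk (fun x hx => (hder x hx).1)
        (fun n hn => hSI n (hWS hn)) m (fun n hn => hSm n (hWS hn)) hP hPm
    · rintro W hWS s hs p hp hpmin hlt ⟨P, hP, hPm⟩ hng
      have hPs : P.eval (s : ℝ) ≠ m s := fun h =>
        hng ⟨P, hP, fun n hn => by
          rcases Finset.mem_insert.mp hn with rfl | hn
          · exact h
          · exact hPm n hn⟩
      have hsW : s ∉ W := fun h => lt_irrefl _ (hlt s h)
      have hcard : k ≤ W.card := by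
        by_contra! h
        refine hng (exists_polynomial_of_card_le ?_ m)
        rw [Finset.card_insert_of_notMem hsW]
        exact h
      obtain ⟨U, hUW, hUk⟩ := Finset.exists_subset_card_eq hcard
      have hinsS : insert s W ⊆ S := Finset.insert_subset hs hWS
      have hinsU : insert s U ⊆ S := (Finset.insert_subset_insert s hUW).trans hinsS
      have hps : (p : ℝ) < s := by exact_mod_cast hlt p hp
      have h1 : 1 ≤ ((s : ℝ) - p) * (u + 2 * d) := by
        refine one_le_spread_mul hk hF hu0 hd0 (fun x hx => by rw [huM]; exact (hder x hx).2)
          (fun h => hsW (hUW h)) hUk (fun n hn => hSI n (hinsU hn)) m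
          (fun n hn => by rw [hdM]; exact (hSm n (hinsU hn)).le) hP
          (fun n hn => hPm n (hUW hn)) hPs ?_
        have hb : ∀ x ∈ insert s U, p ≤ x ∧ x ≤ s := by
          intro x hx
          rcases Finset.mem_insert.mp hx with rfl | hx
          · exact ⟨(hlt p hp).le, le_rfl⟩
          · exact ⟨hpmin x (hUW hx), (hlt x (hUW hx)).le⟩
        intro x hx y hy
        have : y - x ≤ s - p := by linarith [(hb x hx).1, (hb y hy).2]
        exact_mod_cast this
      have h2 := card_run_le hk hF hlam hc hδ0 hdc0 hdcM (l := (s : ℝ) - p) (by linarith) hder hlt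
        (fun n hn => hSI n (hinsS hn)) m (fun n hn => hSm n (hinsS hn)) hP hPm hPs
        (fun n hn => by
          have : (p : ℝ) ≤ n := by exact_mod_cast hpmin n hn
          linarith)
      refine h2.trans ?_
      have h3 : 2 * (k : ℝ) ^ 2 * 1 ≤ 2 * (k : ℝ) ^ 2 * (((s : ℝ) - p) * (u + 2 * d)) := by
        gcongr
      rw [hΘ]
      linarith
  rw [hSset, Set.ncard_coe_finset]
  refine hmain.trans ?_
  exact run_count_arith hk3 (by linarith) he hdc0 hρ0 (Real.mul_rpow hc0.le hlam.le)
    (Real.mul_rpow hc0.le hδ0.le)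
end

section
/- Let N ≥ 4 be an integer and 0 < δ < 1/8. Let f be a real-valued function of class C² on [N, 2N] such that there exist λ₂ > 0 and c₂ ≥ 1 with λ₂ ≤ |f″(x)| ≤ c₂·λ₂ for all x ∈ [N, 2N], and suppose N·λ₂ ≥ c₂^{−1}. Then R(f,N,δ) ≤ 6·{(3c₂)^{1/3}·N·λ₂^{1/3} + (12c₂)^{1/2}·N·δ^{1/2} + 1}. -/
/-- A finite set of integers of diameter at most `L` has at most `L + 1` elements. -/
theorem card_le_of_sub_le (s : Finset ℤ) (L : ℝ) (hL : 0 ≤ L)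
    (h : ∀ x ∈ s, ∀ y ∈ s, (y : ℝ) - x ≤ L) : (s.card : ℝ) ≤ L + 1 := by
  rcases s.eq_empty_or_nonempty with rfl | hs
  · simp only [Finset.card_empty, Nat.cast_zero]
    positivity
  · have hsub : s ⊆ Finset.Icc (s.min' hs) (s.max' hs) := fun x hx =>
      Finset.mem_Icc.2 ⟨s.min'_le x hx, s.le_max' x hx⟩
    have h1 := Finset.card_le_card hsub
    rw [Int.card_Icc] at h1
    have h2 : s.min' hs ≤ s.max' hs := s.min'_le _ (s.max'_mem hs)
    have h3 : (s.card : ℤ) ≤ s.max' hs + 1 - s.min' hs := by omega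
    have h4 : (s.card : ℝ) ≤ s.max' hs + 1 - s.min' hs := by exact_mod_cast h3
    linarith [h _ (s.min'_mem hs) _ (s.max'_mem hs)]

/-- A finite set of integers in `[N, 2N]` whose elements are pairwise at least `A` apart has at
most `N / A + 1` elements. -/
theorem card_le_of_separated (N A : ℕ) (hA : 1 ≤ A) (s : Finset ℤ)
    (hs : ∀ x ∈ s, (N : ℤ) ≤ x ∧ x ≤ 2 * N)
    (h : ∀ x ∈ s, ∀ y ∈ s, x < y → (A : ℤ) ≤ y - x) : (s.card : ℝ) ≤ N / A + 1 := by
  have hA0 : (0 : ℤ) < A := by exact_mod_cast hA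
  have key : ∀ x ∈ s, ∀ y ∈ s, x < y → (x - N) / A ≠ (y - N) / A := by
    intro x hx y hy hxy heq
    have h1 : ((x - N) + A) / A ≤ (y - N) / A :=
      Int.ediv_le_ediv hA0 (by linarith [h x hx y hy hxy])
    rw [Int.add_ediv_of_dvd_right (dvd_refl _), Int.ediv_self hA0.ne'] at h1
    omega
  have hinj : Set.InjOn (fun x : ℤ => (x - N) / A) s := by
    intro x hx y hy hxy
    rcases lt_trichotomy x y with hlt | heq | hlt
    · exact absurd hxy (key x hx y hy hlt)
    · exact heq
    · exact absurd hxy.symm (key y hy x hx hlt)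
  have hsub : s.image (fun x : ℤ => (x - N) / A) ⊆ Finset.Icc 0 ((N : ℤ) / A) := by
    intro z hz
    obtain ⟨x, hx, rfl⟩ := Finset.mem_image.1 hz
    obtain ⟨h1, h2⟩ := hs x hx
    exact Finset.mem_Icc.2 ⟨Int.ediv_nonneg (by linarith) hA0.le,
      Int.ediv_le_ediv hA0 (by linarith)⟩
  have h1 := Finset.card_le_card hsub
  rw [Finset.card_image_of_injOn hinj, Int.card_Icc] at h1
  have h2 : s.card ≤ N / A + 1 := by
    rw [← Int.natCast_div] at h1
    generalize N / A = k at h1 ⊢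
    omega
  have h3 : (s.card : ℝ) ≤ ((N / A : ℕ) : ℝ) + 1 := by exact_mod_cast h2
  linarith [Nat.cast_div_le (α := ℝ) (m := N) (n := A)]

/-- First derivative test: bound for the number of integers at which a function with increments
between `μ` and `M` per unit step comes close to an integer. -/
theorem card_near_int_le (g : ℤ → ℝ) (s : Finset ℤ) (N : ℕ) (μ M ε : ℝ) (hμ : 0 < μ)
    (hμM : μ ≤ M) (hε : 0 < ε)
    (hs : ∀ x ∈ s, (N : ℤ) ≤ x ∧ x ≤ 2 * N)
    (hlow : ∀ x ∈ s, ∀ y ∈ s, x ≤ y → μ * (y - x) ≤ g y - g x)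
    (hup : ∀ x ∈ s, ∀ y ∈ s, x ≤ y → g y - g x ≤ M * (y - x))
    (m : ℤ → ℤ) (hm : ∀ x ∈ s, |g x - m x| < ε) :
    (s.card : ℝ) ≤ (M * N + 2 * ε + 1) * (2 * ε / μ + 1) := by
  have hM : 0 ≤ M := hμ.le.trans hμM
  have him : ((s.image m).card : ℝ) ≤ (M * N + 2 * ε) + 1 := by
    refine card_le_of_sub_le _ _ (by positivity) ?_
    intro u hu v hv
    obtain ⟨x, hx, rfl⟩ := Finset.mem_image.1 hu
    obtain ⟨y, hy, rfl⟩ := Finset.mem_image.1 hv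
    have hx1 := abs_lt.1 (hm x hx)
    have hy1 := abs_lt.1 (hm y hy)
    suffices g y - g x ≤ M * N by linarith
    rcases le_total x y with hxy | hxy
    · refine (hup x hx y hy hxy).trans (mul_le_mul_of_nonneg_left ?_ hM)
      have : y - x ≤ N := by linarith [hs x hx, hs y hy]
      exact_mod_cast this
    · have h1 := hlow y hy x hx hxy
      have h2 : (y : ℝ) ≤ x := by exact_mod_cast hxy
      have h3 : 0 ≤ μ * ((x : ℝ) - y) := mul_nonneg hμ.le (by linarith)
      have h4 : 0 ≤ M * (N : ℝ) := by positivity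
      linarith
  have hfib : ∀ k ∈ s.image m, ((s.filter (fun x => m x = k)).card : ℝ) ≤ 2 * ε / μ + 1 := by
    intro k _
    refine card_le_of_sub_le _ _ (by positivity) ?_
    intro x hx y hy
    obtain ⟨hx, hxk⟩ := Finset.mem_filter.1 hx
    obtain ⟨hy, hyk⟩ := Finset.mem_filter.1 hy
    have hx1 := abs_lt.1 (hm x hx)
    have hy1 := abs_lt.1 (hm y hy)
    rw [hxk] at hx1
    rw [hyk] at hy1
    rcases le_total x y with hxy | hxy
    · rw [le_div_iff₀ hμ]
      linarith [hlow x hx y hy hxy]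
    · have h2 : (y : ℝ) ≤ x := by exact_mod_cast hxy
      have : 0 ≤ 2 * ε / μ := by positivity
      linarith
  rw [Finset.card_eq_sum_card_image m s]
  push_cast
  calc _ ≤ ∑ k ∈ s.image m, (2 * ε / μ + 1) := Finset.sum_le_sum hfib
    _ = ((s.image m).card : ℝ) * (2 * ε / μ + 1) := by rw [Finset.sum_const, nsmul_eq_mul]
    _ ≤ _ := mul_le_mul_of_nonneg_right him (by positivity)

/-- Reduction principle: an integer set either is sparse or has many pairs of close elements. -/
theorem card_le_add_sum_card_shift (N A : ℕ) (hA : 1 ≤ A) (s : Finset ℤ)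
    (hs : ∀ x ∈ s, (N : ℤ) ≤ x ∧ x ≤ 2 * N) :
    (s.card : ℝ) ≤ (N / A + 1) +
      ∑ a ∈ Finset.Icc 1 A, ((s.filter (fun x => x + (a : ℤ) ∈ s)).card : ℝ) := by
  set B := (Finset.Icc 1 A).biUnion (fun a => s.filter (fun x => x + (a : ℤ) ∈ s)) with hB
  have h1 : s.card ≤ (s \ B).card + B.card := by
    rw [← Finset.card_sdiff_add_card_inter s B]
    exact Nat.add_le_add_left (Finset.card_le_card Finset.inter_subset_right) _
  have h2 : B.card ≤ ∑ a ∈ Finset.Icc 1 A, (s.filter (fun x => x + (a : ℤ) ∈ s)).card :=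
    Finset.card_biUnion_le
  have h3 : ((s \ B).card : ℝ) ≤ N / A + 1 := by
    refine card_le_of_separated N A hA _ (fun x hx => hs x (Finset.mem_sdiff.1 hx).1) ?_
    intro x hx y hy hxy
    by_contra! hlt
    obtain ⟨hxs, hxB⟩ := Finset.mem_sdiff.1 hx
    refine hxB (Finset.mem_biUnion.2 ⟨(y - x).toNat, ?_, ?_⟩)
    · rw [Finset.mem_Icc]
      omega
    · rw [Finset.mem_filter]
      refine ⟨hxs, ?_⟩
      have : x + ((y - x).toNat : ℤ) = y := by omega
      rw [this]
      exact (Finset.mem_sdiff.1 hy).1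
  have h4 : (s.card : ℝ) ≤ (s \ B).card + B.card := by exact_mod_cast h1
  have h5 : (B.card : ℝ) ≤ ∑ a ∈ Finset.Icc 1 A,
      ((s.filter (fun x => x + (a : ℤ) ∈ s)).card : ℝ) := by exact_mod_cast h2
  linarith

/-- Bound for the number of integers at which a function with controlled second differences comes
close to an integer, with a free parameter `A`. -/
theorem card_near_int_le_of_second_diff (f : ℝ → ℝ) (N A : ℕ) (hA : 1 ≤ A) (lam c δ : ℝ)
    (hlam : 0 < lam) (hc : 1 ≤ c) (hδ0 : 0 < δ) (hδ1 : δ < 1 / 8) (hNlam : 1 ≤ N * (c * lam))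
    (s : Finset ℤ) (hs : ∀ x ∈ s, (N : ℤ) ≤ x ∧ x ≤ 2 * N) (m : ℤ → ℤ)
    (hm : ∀ x ∈ s, |f x - m x| < δ)
    (hdiff : ∀ a x y : ℝ, 0 < a → (N : ℝ) ≤ x → x ≤ y → y + a ≤ 2 * N →
      a * lam * (y - x) ≤ (f (y + a) - f y) - (f (x + a) - f x) ∧
      (f (y + a) - f y) - (f (x + a) - f x) ≤ a * (c * lam) * (y - x)) :
    (s.card : ℝ) ≤ N / A + 1 + (3 * (N * (c * lam)) * A ^ 2 + 12 * (N * (c * δ)) * A) := by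
  refine (card_le_add_sum_card_shift N A hA s hs).trans (add_le_add_right ?_ _)
  have hbound : ∀ a ∈ Finset.Icc 1 A, ((s.filter (fun x => x + (a : ℤ) ∈ s)).card : ℝ) ≤
      3 * (N * (c * lam)) * A + 12 * (N * (c * δ)) := by
    intro a ha
    obtain ⟨ha1, ha2⟩ := Finset.mem_Icc.1 ha
    have ha1' : (1 : ℝ) ≤ a := by exact_mod_cast ha1
    have ha2' : (a : ℝ) ≤ A := by exact_mod_cast ha2
    have ha0 : (0 : ℝ) < a := by linarith
    have hinc : ∀ x ∈ s.filter (fun x => x + (a : ℤ) ∈ s), ∀ y ∈ s.filter (fun x => x + (a : ℤ) ∈ s),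
        x ≤ y → a * lam * ((y : ℝ) - x) ≤ (f (y + a) - f y) - (f (x + a) - f x) ∧
          (f (y + a) - f y) - (f (x + a) - f x) ≤ a * (c * lam) * (y - x) := by
      intro x hx y hy hxy
      refine hdiff a x y ha0 ?_ (by exact_mod_cast hxy) ?_
      · exact_mod_cast (hs x (Finset.mem_filter.1 hx).1).1
      · exact_mod_cast (hs _ (Finset.mem_filter.1 hy).2).2
    have h := card_near_int_le (fun x : ℤ => f (x + a) - f x)
      (s.filter (fun x => x + (a : ℤ) ∈ s)) N (a * lam) (a * (c * lam)) (2 * δ) (by positivity)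
      (mul_le_mul_of_nonneg_left (by nlinarith) ha0.le) (by positivity)
      (fun x hx => hs x (Finset.mem_filter.1 hx).1)
      (fun x hx y hy hxy => (hinc x hx y hy hxy).1)
      (fun x hx y hy hxy => (hinc x hx y hy hxy).2)
      (fun x => m (x + a) - m x) (by
        intro x hx
        obtain ⟨hx1, hx2⟩ := Finset.mem_filter.1 hx
        have h1 := abs_lt.1 (hm x hx1)
        have h2 := abs_lt.1 (hm _ hx2)
        push_cast at h2 ⊢
        rw [abs_lt]
        constructor <;> linarith)
    refine h.trans ?_
    have hK : 1 ≤ a * (c * lam) * N := by nlinarith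
    have h1 : a * (c * lam) * N + 2 * (2 * δ) + 1 ≤ 3 * (a * (c * lam) * N) := by linarith
    refine (mul_le_mul_of_nonneg_right h1 (by positivity)).trans ?_
    have h2 : 3 * (a * (c * lam) * N) * (2 * (2 * δ) / (a * lam) + 1) =
        3 * (N * (c * lam)) * a + 12 * (N * (c * δ)) := by
      field_simp
      ring
    rw [h2]
    gcongr
  calc _ ≤ ∑ a ∈ Finset.Icc 1 A, (3 * (N * (c * lam)) * (A : ℝ) + 12 * (N * (c * δ))) :=
        Finset.sum_le_sum hbound
    _ = _ := by
      rw [Finset.sum_const, Nat.card_Icc, nsmul_eq_mul]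
      simp only [Nat.add_sub_cancel]
      ring

/-- The optimised form of `card_near_int_le_of_second_diff`. -/
theorem card_near_int_le_of_second_diff_optimised (f : ℝ → ℝ) (N : ℕ) (lam c δ u v : ℝ)
    (hlam : 0 < lam) (hc : 1 ≤ c) (hδ0 : 0 < δ) (hδ1 : δ < 1 / 8) (hNlam : 1 ≤ N * (c * lam))
    (hu : 0 < u) (hv : 0 < v) (hu3 : u ^ 3 = c * lam) (hv2 : v ^ 2 = c * δ)
    (s : Finset ℤ) (hs : ∀ x ∈ s, (N : ℤ) ≤ x ∧ x ≤ 2 * N) (m : ℤ → ℤ)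
    (hm : ∀ x ∈ s, |f x - m x| < δ)
    (hdiff : ∀ a x y : ℝ, 0 < a → (N : ℝ) ≤ x → x ≤ y → y + a ≤ 2 * N →
      a * lam * (y - x) ≤ (f (y + a) - f y) - (f (x + a) - f x) ∧
      (f (y + a) - f y) - (f (x + a) - f x) ≤ a * (c * lam) * (y - x)) :
    (s.card : ℝ) ≤ N * (5 * u + 14 * v) + 1 := by
  have hN0 : (0 : ℝ) ≤ N := Nat.cast_nonneg N
  rcases le_total 1 (u + v) with huv | huv
  · have h1 : (s.card : ℝ) ≤ N + 1 := by
      refine card_le_of_sub_le s N hN0 fun x hx y hy => ?_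
      have : y - x ≤ N := by linarith [hs x hx, hs y hy]
      exact_mod_cast this
    nlinarith
  · set X := 1 / (u + v) with hX
    have huv0 : 0 < u + v := by positivity
    have hX1 : 1 ≤ X := by rw [hX, le_div_iff₀ huv0]; linarith
    set A := ⌊X⌋₊ with hAdef
    have hA : 1 ≤ A := Nat.le_floor (by exact_mod_cast hX1)
    have hA1 : (1 : ℝ) ≤ A := by exact_mod_cast hA
    have hAX : (A : ℝ) ≤ X := Nat.floor_le (by linarith)
    have hXA : X < A + 1 := Nat.lt_floor_add_one X
    have hAuv : A * (u + v) ≤ 1 := by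
      rwa [hX, le_div_iff₀ huv0] at hAX
    have huvA : 1 ≤ 2 * A * (u + v) := by
      have : X ≤ 2 * A := by linarith
      rwa [hX, div_le_iff₀ huv0] at this
    have hAu : A * u ≤ 1 := by nlinarith
    have hAv : A * v ≤ 1 := by nlinarith
    have h := card_near_int_le_of_second_diff f N A hA lam c δ hlam hc hδ0 hδ1 hNlam s hs m hm hdiff
    have e1 : (N : ℝ) / A ≤ N * (2 * (u + v)) := by
      rw [div_le_iff₀ (by linarith)]
      nlinarith
    have e2 : 3 * (N * (c * lam)) * (A : ℝ) ^ 2 ≤ N * (3 * u) := by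
      have : (A * u) ^ 2 ≤ 1 := pow_le_one₀ (by positivity) hAu
      calc 3 * (N * (c * lam)) * (A : ℝ) ^ 2 = N * (3 * u) * (A * u) ^ 2 := by rw [← hu3]; ring
        _ ≤ N * (3 * u) * 1 := by gcongr
        _ = _ := mul_one _
    have e3 : 12 * (N * (c * δ)) * (A : ℝ) ≤ N * (12 * v) := by
      calc 12 * (N * (c * δ)) * (A : ℝ) = N * (12 * v) * (A * v) := by rw [← hv2]; ring
        _ ≤ N * (12 * v) * 1 := by gcongr
        _ = _ := mul_one _
    linarith

/-- Mean value bounds for second differences. -/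
theorem second_diff_bounds (f : ℝ → ℝ) (p q l M : ℝ) (hcont : ContinuousOn f (Set.Icc p q))
    (hd : ∀ x ∈ Set.Ioo p q, DifferentiableAt ℝ f x)
    (hd2 : ∀ x ∈ Set.Ioo p q, DifferentiableAt ℝ (deriv f) x)
    (hl : ∀ x ∈ Set.Ioo p q, l ≤ deriv (deriv f) x)
    (hM : ∀ x ∈ Set.Ioo p q, deriv (deriv f) x ≤ M)
    (a x y : ℝ) (ha : 0 < a) (hpx : p ≤ x) (hxy : x ≤ y) (hyq : y + a ≤ q) :
    a * l * (y - x) ≤ (f (y + a) - f y) - (f (x + a) - f x) ∧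
      (f (y + a) - f y) - (f (x + a) - f x) ≤ a * M * (y - x) := by
  have hD : ∀ t ∈ Set.Ioo p (q - a),
      a * l ≤ deriv f (t + a) - deriv f t ∧ deriv f (t + a) - deriv f t ≤ a * M := by
    intro t ht
    have ht1 : t ∈ Set.Ioo p q := ⟨ht.1, by linarith [ht.2]⟩
    have ht2 : t + a ∈ Set.Ioo p q := ⟨by linarith [ht.1], by linarith [ht.2]⟩
    have hc' : ContinuousOn (deriv f) (Set.Ioo p q) := fun z hz =>
      (hd2 z hz).continuousAt.continuousWithinAt
    have hd' : DifferentiableOn ℝ (deriv f) (interior (Set.Ioo p q)) := by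
      rw [interior_Ioo]
      exact fun z hz => (hd2 z hz).differentiableWithinAt
    have h1 := (convex_Ioo p q).mul_sub_le_image_sub_of_le_deriv hc' hd'
      (by rwa [interior_Ioo]) t ht1 (t + a) ht2 (by linarith)
    have h2 := (convex_Ioo p q).image_sub_le_mul_sub_of_deriv_le hc' hd'
      (by rwa [interior_Ioo]) t ht1 (t + a) ht2 (by linarith)
    constructor <;> linarith
  have hder : ∀ t ∈ Set.Ioo p (q - a),
      HasDerivAt (fun t => f (t + a) - f t) (deriv f (t + a) - deriv f t) t := by
    intro t ht
    have h1 := (hd (t + a) ⟨by linarith [ht.1], by linarith [ht.2]⟩).hasDerivAt.comp_add_const t a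
    exact h1.sub (hd t ⟨ht.1, by linarith [ht.2]⟩).hasDerivAt
  have hg : ContinuousOn (fun t => f (t + a) - f t) (Set.Icc p (q - a)) := by
    refine ContinuousOn.sub (hcont.comp (by fun_prop) ?_) (hcont.mono ?_)
    · exact fun t ht => ⟨by linarith [ht.1], by linarith [ht.2]⟩
    · exact Set.Icc_subset_Icc_right (by linarith)
  have hg' : DifferentiableOn ℝ (fun t => f (t + a) - f t) (interior (Set.Icc p (q - a))) := by
    rw [interior_Icc]
    exact fun z hz => (hder z hz).differentiableAt.differentiableWithinAt
  have hx : x ∈ Set.Icc p (q - a) := ⟨hpx, by linarith⟩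
  have hy : y ∈ Set.Icc p (q - a) := ⟨by linarith, by linarith⟩
  constructor
  · refine (convex_Icc p (q - a)).mul_sub_le_image_sub_of_le_deriv hg hg' ?_ x hx y hy hxy
    rw [interior_Icc]
    intro z hz
    rw [(hder z hz).deriv]
    exact (hD z hz).1
  · refine (convex_Icc p (q - a)).image_sub_le_mul_sub_of_deriv_le hg hg' ?_ x hx y hy hxy
    rw [interior_Icc]
    intro z hz
    rw [(hder z hz).deriv]
    exact (hD z hz).2

/-- A `C²` function whose second derivative lies between `l > 0` and `M` in absolute value has, up
to sign, second differences controlled by `l` and `M`. -/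
theorem exists_sign_second_diff_bounds (f : ℝ → ℝ) (p q l M : ℝ) (hpq : p < q) (hl0 : 0 < l)
    (hf : ContDiffOn ℝ 2 f (Set.Icc p q))
    (hder : ∀ x ∈ Set.Icc p q, l ≤ |iteratedDerivWithin 2 f (Set.Icc p q) x| ∧
      |iteratedDerivWithin 2 f (Set.Icc p q) x| ≤ M) :
    ∃ σ : ℤ, (σ = 1 ∨ σ = -1) ∧
      ∀ a x y : ℝ, 0 < a → p ≤ x → x ≤ y → y + a ≤ q →
        a * l * (y - x) ≤ (σ * f (y + a) - σ * f y) - (σ * f (x + a) - σ * f x) ∧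
        (σ * f (y + a) - σ * f y) - (σ * f (x + a) - σ * f x) ≤ a * M * (y - x) := by
  have hU := uniqueDiffOn_Icc hpq
  have hcont2 : ContinuousOn (iteratedDerivWithin 2 f (Set.Icc p q)) (Set.Icc p q) :=
    hf.continuousOn_iteratedDerivWithin le_rfl hU
  have hat : ∀ x ∈ Set.Ioo p q, ContDiffAt ℝ 2 f x := fun x hx =>
    hf.contDiffAt (Icc_mem_nhds hx.1 hx.2)
  have hd : ∀ x ∈ Set.Ioo p q, DifferentiableAt ℝ f x := fun x hx =>
    (hat x hx).differentiableAt (by norm_num)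
  have hd2 : ∀ x ∈ Set.Ioo p q, DifferentiableAt ℝ (deriv f) x := fun x hx =>
    ((hat x hx).derivWithin (m := 1) (by norm_num)).differentiableAt (by norm_num)
  have heq : ∀ x ∈ Set.Ioo p q,
      iteratedDerivWithin 2 f (Set.Icc p q) x = deriv (deriv f) x := by
    intro x hx
    rw [iteratedDerivWithin_eq_iteratedDeriv hU (hat x hx) (Set.Ioo_subset_Icc_self hx),
      iteratedDeriv_succ, iteratedDeriv_one]
  have hne : ∀ x ∈ Set.Icc p q, iteratedDerivWithin 2 f (Set.Icc p q) x ≠ 0 := fun x hx h0 => by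
    have := (hder x hx).1
    rw [h0, abs_zero] at this
    linarith
  have hsign : (∀ x ∈ Set.Icc p q, 0 < iteratedDerivWithin 2 f (Set.Icc p q) x) ∨
      (∀ x ∈ Set.Icc p q, iteratedDerivWithin 2 f (Set.Icc p q) x < 0) := by
    by_contra! hcon
    obtain ⟨⟨x, hx, hx0⟩, ⟨y, hy, hy0⟩⟩ := hcon
    obtain ⟨z, hz, hz0⟩ := isPreconnected_Icc.intermediate_value hx hy hcont2 ⟨hx0, hy0⟩
    exact hne z hz hz0
  rcases hsign with hpos | hneg
  · refine ⟨1, Or.inl rfl, fun a x y ha hpx hxy hyq => ?_⟩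
    have h := second_diff_bounds f p q l M hf.continuousOn hd hd2
      (fun z hz => by
        have hz' := Set.Ioo_subset_Icc_self hz
        have := (hder z hz').1
        rwa [abs_of_pos (hpos z hz'), heq z hz] at this)
      (fun z hz => by
        have hz' := Set.Ioo_subset_Icc_self hz
        have := (hder z hz').2
        rwa [abs_of_pos (hpos z hz'), heq z hz] at this) a x y ha hpx hxy hyq
    simpa using h
  · refine ⟨-1, Or.inr rfl, fun a x y ha hpx hxy hyq => ?_⟩
    have h := second_diff_bounds f p q (-M) (-l) hf.continuousOn hd hd2
      (fun z hz => by
        have hz' := Set.Ioo_subset_Icc_self hz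
        have := (hder z hz').2
        rw [abs_of_neg (hneg z hz'), heq z hz] at this
        linarith)
      (fun z hz => by
        have hz' := Set.Ioo_subset_Icc_self hz
        have := (hder z hz').1
        rw [abs_of_neg (hneg z hz'), heq z hz] at this
        linarith) a x y ha hpx hxy hyq
    push_cast
    constructor <;> linarith [h.1, h.2]


theorem stmt_3 (N : ℕ) (hN : 4 ≤ N)
    (δ : ℝ) (hδ0 : 0 < δ) (hδ1 : δ < 1/8)
    (f : ℝ → ℝ) (lam c : ℝ) (hlam : 0 < lam) (hc : 1 ≤ c)
    (hf : ContDiffOn ℝ 2 f (Set.Icc (N:ℝ) (2*N)))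
    (hder : ∀ x ∈ Set.Icc (N:ℝ) (2*N),
      lam ≤ |iteratedDerivWithin 2 f (Set.Icc (N:ℝ) (2*N)) x| ∧
      |iteratedDerivWithin 2 f (Set.Icc (N:ℝ) (2*N)) x| ≤ c * lam)
    (hNlam : (N:ℝ) * lam ≥ c⁻¹) :
    (({n : ℤ | (N:ℤ) ≤ n ∧ n ≤ 2*N ∧ |f n - round (f n)| < δ}.ncard : ℝ)) ≤
      6 * ((3*c) ^ ((1:ℝ)/3) * N * lam ^ ((1:ℝ)/3)
        + (12*c) ^ ((1:ℝ)/2) * N * δ ^ ((1:ℝ)/2) + 1) := by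
  have hc0 : 0 < c := by linarith
  have hN0 : (0 : ℝ) < N := by
    have : 0 < N := by omega
    exact_mod_cast this
  have hNlam' : 1 ≤ N * (c * lam) := by
    have h1 := mul_le_mul_of_nonneg_left hNlam hc0.le
    rw [mul_inv_cancel₀ hc0.ne'] at h1
    linarith
  obtain ⟨σ, hσ, hdiff⟩ := exists_sign_second_diff_bounds f N (2 * N) lam (c * lam) (by linarith)
    hlam hf hder
  have hfin : {n : ℤ | (N : ℤ) ≤ n ∧ n ≤ 2 * N ∧ |f n - round (f n)| < δ}.Finite :=
    (Set.finite_Icc (N : ℤ) (2 * N)).subset fun n hn => ⟨hn.1, hn.2.1⟩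
  have hu3 : ((c * lam) ^ ((1 : ℝ) / 3)) ^ 3 = c * lam := by
    rw [← Real.rpow_natCast, ← Real.rpow_mul (by positivity)]
    norm_num
  have hv2 : ((c * δ) ^ ((1 : ℝ) / 2)) ^ 2 = c * δ := by
    rw [← Real.rpow_natCast, ← Real.rpow_mul (by positivity)]
    norm_num
  have hmain := card_near_int_le_of_second_diff_optimised (fun x => σ * f x) N lam c δ
    ((c * lam) ^ ((1 : ℝ) / 3)) ((c * δ) ^ ((1 : ℝ) / 2)) hlam hc hδ0 hδ1 hNlam' (by positivity)
    (by positivity) hu3 hv2 hfin.toFinset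
    (fun x hx => by
      rw [Set.Finite.mem_toFinset] at hx
      exact ⟨hx.1, hx.2.1⟩)
    (fun n => σ * round (f n))
    (fun x hx => by
      rw [Set.Finite.mem_toFinset] at hx
      have h : |f x - round (f x)| < δ := hx.2.2
      push_cast
      rw [← mul_sub, abs_mul]
      rcases hσ with rfl | rfl <;> simpa using h)
    hdiff
  rw [Set.ncard_eq_toFinset_card _ hfin]
  have h3 : (1 : ℝ) ≤ 3 ^ ((1 : ℝ) / 3) := Real.one_le_rpow (by norm_num) (by norm_num)
  have h12 : (3 : ℝ) ≤ 12 ^ ((1 : ℝ) / 2) := by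
    rw [← Real.sqrt_eq_rpow]
    exact Real.le_sqrt_of_sq_le (by norm_num)
  have e1 : (3 * c) ^ ((1 : ℝ) / 3) * N * lam ^ ((1 : ℝ) / 3) =
      3 ^ ((1 : ℝ) / 3) * (N * (c * lam) ^ ((1 : ℝ) / 3)) := by
    rw [Real.mul_rpow (by norm_num) hc0.le, Real.mul_rpow hc0.le hlam.le]
    ring
  have e2 : (12 * c) ^ ((1 : ℝ) / 2) * N * δ ^ ((1 : ℝ) / 2) =
      12 ^ ((1 : ℝ) / 2) * (N * (c * δ) ^ ((1 : ℝ) / 2)) := by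
    rw [Real.mul_rpow (by norm_num) hc0.le, Real.mul_rpow hc0.le hδ0.le]
    ring
  rw [e1, e2]
  have hU : 0 ≤ N * (c * lam) ^ ((1 : ℝ) / 3) := by positivity
  have hV : 0 ≤ N * (c * δ) ^ ((1 : ℝ) / 2) := by positivity
  have k1 := mul_le_mul_of_nonneg_right h3 hU
  have k2 := mul_le_mul_of_nonneg_right h12 hV
  linarith
end

section
/- For every integer k ≥ 1 and every real C ≥ 1, there exists a constant K > 0 (depending only on k and C) with the following property: for every integer N ≥ 4, every real 0 < δ < 1/4, every real T ≥ 1 with N·δ ≤ T ≤ δ^{−1}, and every smooth function f on [N, 2N] satisfying C^{−1}·T/N^{j} ≤ |f^{(j)}(x)| ≤ C·T/N^{j} for all integers j ≥ 0 and all x ∈ [N, 2N], we have R(f,N,δ) ≤ K·T^{2/(k(k+1))}·N^{(k−1)/(k+1)}. -/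
open Finset Polynomial

/-- Iterated Rolle theorem. -/
theorem exists_eq_zero_of_zeros {a b : ℝ} (k : ℕ) :
    ∀ (F : ℕ → ℝ → ℝ) (x : ℕ → ℝ),
      (∀ j, ∀ t ∈ Set.Icc a b, HasDerivWithinAt (F j) (F (j + 1) t) (Set.Icc a b) t) →
      (∀ i ≤ k, x i ∈ Set.Icc a b) → (∀ i < k, x i < x (i + 1)) →
      (∀ i ≤ k, F 0 (x i) = 0) → ∃ t ∈ Set.Icc a b, F k t = 0 := by
  induction k with
  | zero => intro F x _ hx _ h0; exact ⟨x 0, hx 0 le_rfl, h0 0 le_rfl⟩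
  | succ k ih =>
    intro F x hF hx hlt h0
    have key : ∀ i, ∃ y, i ≤ k → x i < y ∧ y < x (i + 1) ∧ F 1 y = 0 := by
      intro i
      by_cases hi : i ≤ k
      · have h1 := hx i (by omega)
        have h2 := hx (i + 1) (by omega)
        have hsub : Set.Icc (x i) (x (i + 1)) ⊆ Set.Icc a b := Set.Icc_subset_Icc h1.1 h2.2
        obtain ⟨y, hy, hy0⟩ := exists_hasDerivAt_eq_zero (f := F 0) (f' := F 1)
          (hlt i (by omega))
          (fun t ht => ((hF 0 t (hsub ht)).continuousWithinAt).mono hsub)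
          ((h0 i (by omega)).trans (h0 (i + 1) (by omega)).symm)
          (fun t ht => (hF 0 t (hsub (Set.Ioo_subset_Icc_self ht))).hasDerivAt
            (Icc_mem_nhds (h1.1.trans_lt ht.1) (ht.2.trans_le h2.2)))
        exact ⟨y, fun _ => ⟨hy.1, hy.2, hy0⟩⟩
      · exact ⟨0, fun h => absurd h hi⟩
    choose y hy using key
    exact ih (fun j => F (j + 1)) y (fun j => hF (j + 1))
      (fun i hi => ⟨(hx i (by omega)).1.trans (hy i hi).1.le,
        (hy i hi).2.1.le.trans (hx (i + 1) (by omega)).2⟩)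
      (fun i hi => (hy i (by omega)).2.1.trans (hy (i + 1) (by omega)).1)
      (fun i hi => (hy i hi).2.2)

theorem strictMonoOn_of_step {α : Type*} [Preorder α] {k : ℕ} {x : ℕ → α}
    (h : ∀ i < k, x i < x (i + 1)) : ∀ i j, i < j → j ≤ k → x i < x j := by
  intro i j hij
  induction j, hij using Nat.le_induction with
  | base => intro hj; exact h i (by omega)
  | succ j hj ih => intro hjk; exact (ih (by omega)).trans (h j (by omega))

/-- Mean value theorem for divided differences. -/
theorem exists_divided_difference_eq {a b : ℝ} (k : ℕ) (F : ℕ → ℝ → ℝ) (x : ℕ → ℝ)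
    (hF : ∀ j, ∀ t ∈ Set.Icc a b, HasDerivWithinAt (F j) (F (j + 1) t) (Set.Icc a b) t)
    (hx : ∀ i ≤ k, x i ∈ Set.Icc a b) (hlt : ∀ i < k, x i < x (i + 1)) :
    ∃ t ∈ Set.Icc a b, F k t = k.factorial *
      ∑ i ∈ range (k + 1), F 0 (x i) / ∏ j ∈ (range (k + 1)).erase i, (x i - x j) := by
  have hmono := strictMonoOn_of_step hlt
  have hinj : Set.InjOn x (range (k + 1)) := by
    intro i hi j hj hij
    simp only [coe_range, Set.mem_Iio] at hi hj
    rcases lt_trichotomy i j with h | h | h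
    · exact absurd hij (hmono i j h (by omega)).ne
    · exact h
    · exact absurd hij (hmono j i h (by omega)).ne'
  set P := Lagrange.interpolate (range (k + 1)) x (fun i => F 0 (x i)) with hP
  have hdeg : P.degree < #(range (k + 1)) := Lagrange.degree_interpolate_lt _ hinj
  have heval : ∀ i ≤ k, P.eval (x i) = F 0 (x i) := fun i hi =>
    Lagrange.eval_interpolate_at_node _ hinj (by simp; omega)
  obtain ⟨t, ht, h0⟩ := exists_eq_zero_of_zeros k
    (fun j t => F j t - (derivative^[j] P).eval t) x
    (fun j t ht => by
      rw [Function.iterate_succ_apply']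
      exact (hF j t ht).sub ((derivative^[j] P).hasDerivAt t).hasDerivWithinAt)
    hx hlt (fun i hi => by simp [heval i hi])
  refine ⟨t, ht, ?_⟩
  have hnat : P.natDegree ≤ k := natDegree_le_of_degree_le <| by
    have := Lagrange.degree_interpolate_le (fun i => F 0 (x i)) hinj
    rwa [card_range, Nat.add_sub_cancel] at this
  have hconst : derivative^[k] P = Polynomial.C ((k.factorial : ℝ) * P.coeff k) := by
    rw [eq_C_of_natDegree_eq_zero (p := derivative^[k] P)
      (by have := natDegree_iterate_derivative P k; omega), coeff_iterate_derivative]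
    simp [Nat.descFactorial_self]
  have hcoeff := Lagrange.coeff_eq_sum hinj hdeg
  rw [card_range, Nat.add_sub_cancel] at hcoeff
  rw [hconst, eval_C, sub_eq_zero, hcoeff] at h0
  rw [h0]
  congr 1
  refine sum_congr rfl fun i hi => ?_
  rw [heval i (by simp at hi; omega)]

/-- Product of the distances between the pairs of distinct indices in `s`. -/
def pairProd (n : ℕ → ℤ) (s : Finset ℕ) : ℤ :=
  ∏ a ∈ s, ∏ b ∈ s, if b < a then |n a - n b| else 1

theorem pairProd_insert (n : ℕ → ℤ) {s : Finset ℕ} {i : ℕ} (hi : i ∉ s) :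
    pairProd n (insert i s) = pairProd n s * ∏ j ∈ s, |n i - n j| := by
  have : ∏ j ∈ s, |n i - n j| =
      (∏ b ∈ s, if b < i then |n i - n b| else 1) * ∏ a ∈ s, if i < a then |n a - n i| else 1 := by
    rw [← prod_mul_distrib]
    refine prod_congr rfl fun j hj => ?_
    have : j ≠ i := by rintro rfl; exact hi hj
    rcases lt_or_gt_of_ne this with h | h
    · simp [h, h.not_gt]
    · simp [h, h.not_gt, abs_sub_comm]
  simp only [pairProd]
  rw [prod_insert hi, prod_insert hi, this]
  simp only [prod_insert hi, prod_mul_distrib]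
  simp
  ring

theorem pairProd_nonneg (n : ℕ → ℤ) (s : Finset ℕ) : 0 ≤ pairProd n s :=
  prod_nonneg fun a _ => prod_nonneg fun b _ => by split_ifs <;> positivity

theorem pairProd_le (n : ℕ → ℤ) (s : Finset ℕ) {H : ℝ} (hH : 0 ≤ H)
    (h : ∀ i ∈ s, ∀ j ∈ s, |(n i : ℝ) - n j| ≤ H) :
    (pairProd n s : ℝ) ≤ H ^ (#s).choose 2 := by
  induction s using Finset.induction_on with
  | empty => simp [pairProd]
  | insert i s hi ih =>
    rw [pairProd_insert n hi, card_insert_of_notMem hi, Nat.choose_succ_succ' (#s) 1,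
      Nat.choose_one_right, add_comm (#s), pow_add]
    push_cast
    have h1 := ih fun i hi j hj => h i (mem_insert_of_mem hi) j (mem_insert_of_mem hj)
    have h2 : ∏ j ∈ s, |(n i : ℝ) - n j| ≤ H ^ #s := by
      rw [← prod_const]
      exact prod_le_prod (fun _ _ => abs_nonneg _)
        fun j hj => h i (mem_insert_self _ _) j (mem_insert_of_mem hj)
    exact mul_le_mul h1 h2 (prod_nonneg fun _ _ => abs_nonneg _) (by positivity)

theorem pairProd_erase (n : ℕ → ℤ) {s : Finset ℕ} {i : ℕ} (hi : i ∈ s) :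
    pairProd n s = pairProd n (s.erase i) * ∏ j ∈ s.erase i, |n i - n j| := by
  rw [← pairProd_insert n (notMem_erase i s), insert_erase hi]

/-- A divided difference of integers at integer nodes has denominator dividing `pairProd`. -/
theorem exists_int_eq_divided_difference_mul_pairProd (n m : ℕ → ℤ) (s : Finset ℕ)
    (hn : ∀ i ∈ s, ∀ j ∈ s, i ≠ j → n i ≠ n j) :
    ∃ z : ℤ, (∑ i ∈ s, (m i : ℝ) / ∏ j ∈ s.erase i, ((n i : ℝ) - n j)) * pairProd n s = z := by
  have key : ∀ i, ∃ z : ℤ, i ∈ s →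
      (m i : ℝ) / (∏ j ∈ s.erase i, ((n i : ℝ) - n j)) * pairProd n s = z := by
    intro i
    by_cases hi : i ∈ s
    · have hw : ∏ j ∈ s.erase i, ((n i : ℝ) - n j) ≠ 0 := by
        refine prod_ne_zero_iff.2 fun j hj => ?_
        rw [mem_erase] at hj
        have := hn i hi j hj.2 hj.1.symm
        exact sub_ne_zero.2 (by exact_mod_cast this)
      rw [pairProd_erase n hi]
      push_cast
      rw [← abs_prod]
      rcases abs_choice (∏ j ∈ s.erase i, ((n i : ℝ) - n j)) with h | h
      · refine ⟨m i * pairProd n (s.erase i), fun _ => ?_⟩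
        rw [h]; push_cast; field_simp
      · refine ⟨-(m i * pairProd n (s.erase i)), fun _ => ?_⟩
        rw [h]; push_cast; field_simp
    · exact ⟨0, fun h => absurd h hi⟩
  choose z hz using key
  refine ⟨∑ i ∈ s, z i, ?_⟩
  rw [sum_mul]
  push_cast
  exact sum_congr rfl fun i hi => hz i hi

/-- If `f` has at least `k + 1` points close to integers in a short window, then some gap between
them is small. -/
theorem mul_gap_pow_le {a b : ℝ} (k : ℕ) (F : ℕ → ℝ → ℝ) (n : ℕ → ℤ)
    (hF : ∀ j, ∀ t ∈ Set.Icc a b, HasDerivWithinAt (F j) (F (j + 1) t) (Set.Icc a b) t)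
    {L U δ g H : ℝ} (hδ : 0 ≤ δ) (hg : 0 < g) (hH : 0 ≤ H)
    (hL : ∀ t ∈ Set.Icc a b, L ≤ |F k t|) (hU : ∀ t ∈ Set.Icc a b, |F k t| ≤ U)
    (hn : ∀ i ≤ k, (n i : ℝ) ∈ Set.Icc a b)
    (hclose : ∀ i ≤ k, |F 0 (n i) - round (F 0 (n i))| < δ)
    (hgap : ∀ i < k, (n i : ℝ) + g < n (i + 1)) (hspan : (n k : ℝ) - n 0 ≤ H)
    (hsmall : U * H ^ (k + 1).choose 2 + (k + 1) * δ * H ^ k.choose 2 < 1) :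
    L * g ^ k ≤ (k + 1).factorial * δ := by
  have hmono := strictMonoOn_of_step (x := fun i => (n i : ℝ)) (k := k)
    fun i hi => by have := hgap i hi; show (n i : ℝ) < n (i + 1); linarith
  have hmono' : ∀ i j, i ≤ j → j ≤ k → (n i : ℝ) ≤ n j := fun i j hij hj => by
    rcases hij.eq_or_lt with rfl | h
    · rfl
    · exact (hmono i j h hj).le
  have hdist : ∀ i j, i < j → j ≤ k → g ≤ (n j : ℝ) - n i := fun i j hij hj => by
    have h1 := hgap i (by omega)
    have h2 := hmono' (i + 1) j hij hj
    linarith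
  have hne : ∀ i ∈ range (k + 1), ∀ j ∈ range (k + 1), i ≠ j → g ≤ |(n i : ℝ) - n j| := by
    intro i hi j hj hij
    simp only [mem_range] at hi hj
    rcases lt_or_gt_of_ne hij with h | h
    · rw [abs_sub_comm]
      exact (hdist i j h (by omega)).trans (le_abs_self _)
    · exact (hdist j i h (by omega)).trans (le_abs_self _)
  have hle : ∀ i ∈ range (k + 1), ∀ j ∈ range (k + 1), |(n i : ℝ) - n j| ≤ H := by
    intro i hi j hj
    simp only [mem_range] at hi hj
    have h1 := hmono' 0 i (by omega) (by omega)
    have h2 := hmono' 0 j (by omega) (by omega)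
    have h3 := hmono' i k (by omega) le_rfl
    have h4 := hmono' j k (by omega) le_rfl
    rw [abs_le]
    constructor <;> linarith
  obtain ⟨t, ht, hmv⟩ := exists_divided_difference_eq k F (fun i => (n i : ℝ)) hF hn
    fun i hi => by have := hgap i hi; linarith
  set m : ℕ → ℤ := fun i => round (F 0 (n i))
  set w : ℕ → ℝ := fun i => ∏ j ∈ (range (k + 1)).erase i, ((n i : ℝ) - n j) with hw
  obtain ⟨z, hz⟩ := exists_int_eq_divided_difference_mul_pairProd n m (range (k + 1))
    fun i hi j hj hij h => by
      have := hne i hi j hj hij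
      rw [h, sub_self, abs_zero] at this
      linarith
  set V := ((pairProd n (range (k + 1)) : ℤ) : ℝ) with hV
  have hV0 : 0 ≤ V := by rw [hV]; exact_mod_cast pairProd_nonneg _ _
  have hVle : V ≤ H ^ (k + 1).choose 2 := by
    simpa using pairProd_le n (range (k + 1)) hH hle
  have hwge : ∀ i ∈ range (k + 1), g ^ k ≤ |w i| := by
    intro i hi
    have hc : #((range (k + 1)).erase i) = k := by rw [card_erase_of_mem hi]; simp
    calc g ^ k = ∏ _j ∈ (range (k + 1)).erase i, g := by rw [prod_const, hc]
      _ ≤ _ := by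
        rw [hw, abs_prod]
        exact prod_le_prod (fun _ _ => hg.le)
          fun j hj => hne i hi j (mem_of_mem_erase hj) (ne_of_mem_erase hj).symm
  have hVi : ∀ i ∈ range (k + 1), V / |w i| ≤ H ^ k.choose 2 := by
    intro i hi
    have hc : #((range (k + 1)).erase i) = k := by rw [card_erase_of_mem hi]; simp
    have hwpos : 0 < |w i| := (pow_pos hg k).trans_le (hwge i hi)
    have h1 : V = pairProd n ((range (k + 1)).erase i) * |w i| := by
      rw [hV, pairProd_erase n hi, hw, abs_prod]; push_cast; rfl
    rw [h1, mul_div_assoc, div_self hwpos.ne', mul_one]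
    have := pairProd_le n ((range (k + 1)).erase i) hH
      fun i hi j hj => hle i (mem_of_mem_erase hi) j (mem_of_mem_erase hj)
    rwa [hc] at this
  set D : ℝ := ∑ i ∈ range (k + 1), (m i : ℝ) / w i with hD
  set E : ℝ := ∑ i ∈ range (k + 1), F 0 (n i) / w i with hE
  have hfac : (0 : ℝ) < k.factorial := by positivity
  have hfac1 : (1 : ℝ) ≤ k.factorial := by exact_mod_cast k.factorial_pos
  have hED : |E - D| ≤ ∑ i ∈ range (k + 1), δ / |w i| := by
    rw [hE, hD, ← sum_sub_distrib]
    refine (abs_sum_le_sum_abs _ _).trans (sum_le_sum fun i hi => ?_)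
    rw [← sub_div, abs_div]
    gcongr
    exact (hclose i (by simp at hi; omega)).le
  have hEt : |F k t| = k.factorial * |E| := by
    rw [hmv, abs_mul, abs_of_pos hfac]
  have hEU : |E| ≤ U := by
    have := hU t ht
    nlinarith [abs_nonneg E]
  have hD0 : D = 0 := by
    have hlt : |D * V| < 1 := by
      have h1 : |D| ≤ U + ∑ i ∈ range (k + 1), δ / |w i| := by
        have : |D| ≤ |E| + |E - D| := by
          have := abs_sub_abs_le_abs_sub D E
          rw [abs_sub_comm] at this; linarith
        linarith
      have h2 : (∑ i ∈ range (k + 1), δ / |w i|) * V ≤ (k + 1) * δ * H ^ k.choose 2 := by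
        rw [sum_mul]
        calc ∑ i ∈ range (k + 1), δ / |w i| * V ≤ ∑ _i ∈ range (k + 1), δ * H ^ k.choose 2 := by
              refine sum_le_sum fun i hi => ?_
              rw [div_mul_eq_mul_div, mul_div_assoc]
              exact mul_le_mul_of_nonneg_left (hVi i hi) hδ
          _ = _ := by simp; ring
      rw [abs_mul, abs_of_nonneg hV0]
      have hU0 : 0 ≤ U := (abs_nonneg E).trans hEU
      calc |D| * V ≤ (U + ∑ i ∈ range (k + 1), δ / |w i|) * V := by gcongr
        _ = U * V + (∑ i ∈ range (k + 1), δ / |w i|) * V := by ring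
        _ ≤ U * H ^ (k + 1).choose 2 + (k + 1) * δ * H ^ k.choose 2 := by gcongr
        _ < 1 := hsmall
    have hVpos : V ≠ 0 := by
      rw [hV, Int.cast_ne_zero, pairProd]
      refine prod_ne_zero_iff.2 fun i hi => prod_ne_zero_iff.2 fun j hj => ?_
      split_ifs with h
      · have := hg.trans_le (hne i hi j hj h.ne')
        exact_mod_cast this.ne'
      · exact one_ne_zero
    rw [hz] at hlt
    have hz0 : z = 0 := Int.abs_lt_one_iff.1 (by exact_mod_cast hlt)
    rw [hz0, Int.cast_zero] at hz
    exact (mul_eq_zero.1 hz).resolve_right hVpos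
  rw [hD0, sub_zero] at hED
  have hsum : ∑ i ∈ range (k + 1), δ / |w i| ≤ (k + 1) * (δ / g ^ k) := by
    calc _ ≤ ∑ _i ∈ range (k + 1), δ / g ^ k := by
          refine sum_le_sum fun i hi => ?_
          have := hwge i hi
          gcongr
      _ = _ := by simp
  have hfin : L ≤ k.factorial * ((k + 1) * (δ / g ^ k)) :=
    (hL t ht).trans (hEt.le.trans (by gcongr; exact hED.trans hsum))
  rw [Nat.factorial_succ]
  push_cast
  calc L * g ^ k ≤ k.factorial * ((k + 1) * (δ / g ^ k)) * g ^ k := by gcongr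
    _ = _ := by field_simp

/-- The points of `S` in the real window `[y, y + h]`. -/
noncomputable def windowPoints (S : Finset ℤ) (y h : ℝ) : Finset ℤ :=
  S.filter fun n => y ≤ n ∧ (n : ℝ) ≤ y + h

/-- Greedy selection: a set whose windows of length `g` hold few points contains many points with
consecutive gaps larger than `g`. -/
theorem exists_separated_of_lt_card (k : ℕ) {g B : ℝ} :
    ∀ S : Finset ℤ, (∀ y, (#(windowPoints S y g) : ℝ) ≤ B) → (k : ℝ) * B < #S →
      ∃ n : ℕ → ℤ, (∀ i ≤ k, n i ∈ S) ∧ ∀ i < k, (n i : ℝ) + g < n (i + 1) := by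
  induction k with
  | zero =>
    intro S _ h
    have : S.Nonempty := by
      rw [← card_pos]; simpa using h
    obtain ⟨a, ha⟩ := this
    exact ⟨fun _ => a, fun _ _ => ha, fun i hi => by omega⟩
  | succ k ih =>
    intro S hB h
    have hB0 : 0 ≤ B := (Nat.cast_nonneg _).trans (hB 0)
    have hne : S.Nonempty := by
      rw [← card_pos]
      have : (0 : ℝ) < #S := lt_of_le_of_lt (by positivity) h
      exact_mod_cast this
    set a := S.min' hne with ha
    set S' := S.filter fun n : ℤ => (a : ℝ) + g < n with hS'
    have hcard : (#S : ℝ) ≤ B + #S' := by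
      have h1 : S ⊆ windowPoints S a g ∪ S' := by
        intro n hn
        rw [mem_union, windowPoints, mem_filter, hS', mem_filter]
        have : (a : ℝ) ≤ n := by exact_mod_cast S.min'_le n hn
        rcases le_or_gt (n : ℝ) (a + g) with h | h
        · exact Or.inl ⟨hn, this, h⟩
        · exact Or.inr ⟨hn, h⟩
      have h2 := (card_le_card h1).trans (card_union_le _ _)
      have h3 : (#S : ℝ) ≤ #(windowPoints S a g) + #S' := by exact_mod_cast h2
      linarith [hB a]
    obtain ⟨n, hnS, hn⟩ := ih S'
      (fun y => le_trans (by
        exact_mod_cast card_le_card (filter_subset_filter _ (filter_subset _ _))) (hB y))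
      (by push_cast at h; linarith)
    refine ⟨fun i => if i = 0 then a else n (i - 1), fun i hi => ?_, fun i hi => ?_⟩
    · by_cases h0 : i = 0
      · simp [h0, ha, S.min'_mem hne]
      · simp only [h0, if_false]
        exact (mem_filter.1 (hnS (i - 1) (by omega))).1
    · by_cases h0 : i = 0
      · subst h0
        simpa using (mem_filter.1 (hnS 0 (by omega))).2
      · have := hn (i - 1) (by omega)
        simpa [h0, Nat.sub_add_cancel (Nat.pos_of_ne_zero h0)] using this

theorem card_le_of_window_le {S : Finset ℤ} {x H h B : ℝ} (hh : 0 < h) (hH : 0 ≤ H)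
    (hS : ∀ n ∈ S, x ≤ n ∧ (n : ℝ) ≤ x + H) (hB : ∀ y, (#(windowPoints S y h) : ℝ) ≤ B) :
    (#S : ℝ) ≤ (H / h + 1) * B := by
  have hB0 : 0 ≤ B := (Nat.cast_nonneg _).trans (hB 0)
  have hmap : ∀ n ∈ S, ⌊((n : ℝ) - x) / h⌋₊ ∈ range (⌊H / h⌋₊ + 1) := by
    intro n hn
    rw [mem_range, Nat.lt_succ_iff]
    exact Nat.floor_le_floor (by gcongr; linarith [(hS n hn).2])
  have hcard := card_eq_sum_card_fiberwise hmap
  have hfib : ∀ j, (#(S.filter fun n : ℤ => ⌊((n : ℝ) - x) / h⌋₊ = j) : ℝ) ≤ B := by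
    intro j
    refine le_trans ?_ (hB (x + j * h))
    have : (S.filter fun n : ℤ => ⌊((n : ℝ) - x) / h⌋₊ = j) ⊆ windowPoints S (x + j * h) h := by
      intro n hn
      rw [mem_filter] at hn
      have h0 : 0 ≤ ((n : ℝ) - x) / h := div_nonneg (by linarith [(hS n hn.1).1]) hh.le
      have h1 := (Nat.floor_eq_iff h0).1 hn.2
      rw [le_div_iff₀ hh, div_lt_iff₀ hh] at h1
      exact mem_filter.2 ⟨hn.1, by linarith [h1.1], by linarith [h1.2]⟩
    exact_mod_cast card_le_card this
  calc (#S : ℝ) = ∑ j ∈ range (⌊H / h⌋₊ + 1),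
        (#(S.filter fun n : ℤ => ⌊((n : ℝ) - x) / h⌋₊ = j) : ℝ) := by
        exact_mod_cast hcard
    _ ≤ ∑ _j ∈ range (⌊H / h⌋₊ + 1), B := sum_le_sum fun j _ => hfib j
    _ = (⌊H / h⌋₊ + 1) * B := by simp
    _ ≤ _ := by gcongr; exact Nat.floor_le (by positivity)

theorem card_windowPoints_le (S : Finset ℤ) (y : ℝ) {h : ℝ} (hh : 0 ≤ h) :
    (#(windowPoints S y h) : ℝ) ≤ 2 * h + 1 := by
  have := card_le_of_window_le (S := windowPoints S y h) (x := y) (H := h) (h := 1 / 2) (B := 1)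
    (by norm_num) hh (fun n hn => (mem_filter.1 hn).2) (fun z => by
      have : #(windowPoints (windowPoints S y h) z (1 / 2)) ≤ 1 := by
        refine card_le_one.2 fun m hm n hn => ?_
        have h1 := (mem_filter.1 hm).2
        have h2 := (mem_filter.1 hn).2
        have h3 : (m : ℝ) < n + 1 := by linarith
        have h4 : (n : ℝ) < m + 1 := by linarith
        have h5 : m < n + 1 := by exact_mod_cast h3
        have h6 : n < m + 1 := by exact_mod_cast h4
        omega
      exact_mod_cast this)
  linarith

theorem card_le_of_gap {a b : ℝ} (k : ℕ) (F : ℕ → ℝ → ℝ)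
    (hF : ∀ j, ∀ t ∈ Set.Icc a b, HasDerivWithinAt (F j) (F (j + 1) t) (Set.Icc a b) t)
    {L U δ g H B x : ℝ} (hδ : 0 ≤ δ) (hg : 0 < g) (hH : 0 ≤ H)
    (hL : ∀ t ∈ Set.Icc a b, L ≤ |F k t|) (hU : ∀ t ∈ Set.Icc a b, |F k t| ≤ U)
    {S : Finset ℤ} (hS : ∀ n ∈ S, (n : ℝ) ∈ Set.Icc a b ∧ |F 0 n - round (F 0 n)| < δ)
    (hSx : ∀ n ∈ S, x ≤ n ∧ (n : ℝ) ≤ x + H)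
    (hsmall : U * H ^ (k + 1).choose 2 + (k + 1) * δ * H ^ k.choose 2 < 1)
    (hgap : (k + 1).factorial * δ < L * g ^ k)
    (hB : ∀ y, (#(windowPoints S y g) : ℝ) ≤ B) : (#S : ℝ) ≤ k * B := by
  by_contra! h
  obtain ⟨n, hnS, hn⟩ := exists_separated_of_lt_card k S hB h
  have := mul_gap_pow_le k F n hF hδ hg hH hL hU (fun i hi => (hS _ (hnS i hi)).1)
    (fun i hi => (hS _ (hnS i hi)).2) hn
    (by linarith [(hSx _ (hnS 0 (by omega))).1, (hSx _ (hnS k le_rfl)).2]) hsmall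
  linarith

theorem two_mul_choose_two (d : ℕ) : 2 * (d + 1).choose 2 = (d + 1) * d := by
  induction d with
  | zero => rfl
  | succ d ih =>
    rw [Nat.choose_succ_succ' (d + 1) 1, Nat.choose_one_right, mul_add, ih]; ring

theorem pow_choose_le_of_mul_pow_choose_eq {d : ℕ} {N T l : ℝ} (hT : 1 ≤ T)
    (hN : 0 ≤ N) (hl : 0 ≤ l) (hNT : N ^ d ≤ T ^ 2) (h : T * l ^ (d + 2).choose 2 = N ^ (d + 1)) :
    l ^ (d + 1).choose 2 ≤ T := by
  refine (pow_le_pow_iff_left₀ (by positivity) (by positivity) (n := d + 2) (by omega)).1 ?_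
  have he : (d + 1).choose 2 * (d + 2) = (d + 2).choose 2 * d := by
    have h1 := two_mul_choose_two d
    have h2 := two_mul_choose_two (d + 1)
    have : 2 * ((d + 1).choose 2 * (d + 2)) = 2 * ((d + 2).choose 2 * d) := by
      rw [← mul_assoc, h1, ← mul_assoc, h2]; ring
    omega
  rw [← pow_mul, he, pow_mul]
  have hTd : (0 : ℝ) < T ^ d := by positivity
  refine le_of_mul_le_mul_left ?_ hTd
  calc T ^ d * (l ^ (d + 2).choose 2) ^ d = (N ^ d) ^ (d + 1) := by
        rw [← mul_pow, h]; ring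
    _ ≤ (T ^ 2) ^ (d + 1) := by gcongr
    _ = _ := by ring

theorem mul_pow_choose_le_of_mul_pow_eq {d : ℕ} {N T A δ : ℝ} (hd : 1 ≤ d) (hT : 1 ≤ T)
    (hN : 0 ≤ N) (hA : 0 ≤ A) (hNT : N ^ d ≤ T ^ 2) (hδ0 : 0 ≤ δ) (hδ : δ * T ≤ 1)
    (h : T * A ^ (d + 1) = δ * N ^ (d + 1)) : T * A ^ (d + 1).choose 2 ≤ N ^ d := by
  obtain ⟨e, rfl⟩ := Nat.exists_eq_add_of_le' hd
  refine (pow_le_pow_iff_left₀ (by positivity) (by positivity) (n := 2) (by omega)).1 ?_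
  have hTe : (0 : ℝ) < T ^ (2 * e) := by positivity
  refine le_of_mul_le_mul_left ?_ hTe
  have hA2 : (A ^ (e + 1 + 1).choose 2) ^ 2 = (A ^ (e + 1 + 1)) ^ (e + 1) := by
    rw [← pow_mul, ← pow_mul, mul_comm _ 2, two_mul_choose_two]
  calc T ^ (2 * e) * (T * A ^ (e + 1 + 1).choose 2) ^ 2
      = (T * (T * A ^ (e + 1 + 1))) ^ (e + 1) := by
        rw [mul_pow, hA2, mul_pow, mul_pow]; ring
    _ = (δ * T * N ^ (e + 1 + 1)) ^ (e + 1) := by rw [h]; ring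
    _ ≤ (1 * N ^ (e + 1 + 1)) ^ (e + 1) := by gcongr
    _ = (N ^ (e + 1)) ^ e * (N ^ (e + 1)) ^ 2 := by ring
    _ ≤ (T ^ 2) ^ e * (N ^ (e + 1)) ^ 2 := by gcongr
    _ = _ := by ring

theorem pow_choose_le_of_mul_pow_choose_le {d : ℕ} {N T A : ℝ} (hT : 1 ≤ T)
    (hA : 0 ≤ A) (hNT : N ^ d ≤ T ^ 2) (h : T * A ^ (d + 1).choose 2 ≤ N ^ d) :
    A ^ d.choose 2 ≤ T := by
  rcases le_total A 1 with h1 | h1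
  · exact (pow_le_one₀ hA h1).trans hT
  · refine (pow_le_pow_right₀ h1 (Nat.choose_le_choose 2 (Nat.le_succ d))).trans ?_
    nlinarith

/-- A short multiple `c * l` of `l` meets the smallness condition of `mul_gap_pow_le`. -/
theorem small_of_scale {k : ℕ} (hk : 1 ≤ k) {C M l δ c : ℝ} (hC : 1 ≤ C) (hl : 0 ≤ l)
    (hc : c = 1 / (4 * C * (k + 1))) (hδ0 : 0 ≤ δ) (hδ4 : δ < 1 / 4)
    (h1 : M * l ^ (k + 1).choose 2 ≤ 1) (hM : 0 ≤ M) (h2 : δ * l ^ k.choose 2 ≤ 1) :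
    C * M * (c * l) ^ (k + 1).choose 2 + (k + 1) * δ * (c * l) ^ k.choose 2 < 1 := by
  have hC0 : 0 < C := by linarith
  have hk0 : (0 : ℝ) < k + 1 := by positivity
  have hk1 : (1 : ℝ) ≤ k := by exact_mod_cast hk
  have hc0 : 0 < c := by rw [hc]; positivity
  have hcC : C * (k + 1) * c = 1 / 4 := by rw [hc]; field_simp
  have hC1 : C * c ≤ 1 / 4 := by nlinarith [mul_pos hC0 hc0]
  have hk2 : (k + 1) * c ≤ 1 / 4 := by nlinarith [mul_pos hk0 hc0]
  have hc1 : c ≤ 1 := by nlinarith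
  have hp : c ^ (k + 1).choose 2 ≤ c :=
    pow_le_of_le_one hc0.le hc1 (Nat.choose_pos (by omega)).ne'
  have t1 : C * M * (c * l) ^ (k + 1).choose 2 ≤ 1 / 4 := by
    calc C * M * (c * l) ^ (k + 1).choose 2
        = C * c ^ (k + 1).choose 2 * (M * l ^ (k + 1).choose 2) := by rw [mul_pow]; ring
      _ ≤ C * c * 1 := by gcongr
      _ ≤ 1 / 4 := by linarith
  have t2 : (k + 1) * δ * (c * l) ^ k.choose 2 ≤ 1 / 2 := by
    rcases hk.eq_or_lt with rfl | hk'
    · norm_num; linarith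
    · have hq : c ^ k.choose 2 ≤ c :=
        pow_le_of_le_one hc0.le hc1 (Nat.choose_pos hk').ne'
      calc (k + 1) * δ * (c * l) ^ k.choose 2
          = (k + 1) * c ^ k.choose 2 * (δ * l ^ k.choose 2) := by rw [mul_pow]; ring
        _ ≤ (k + 1) * c * 1 := by gcongr
        _ ≤ 1 / 2 := by linarith
  linarith

theorem card_le_of_one {C T δ : ℝ} {N : ℝ} (hC : 1 ≤ C) (hN : 1 ≤ N) (hT : 1 ≤ T) (hδ : 0 < δ)
    (hδ4 : δ < 1 / 4) (hNδ : N * δ ≤ T) (F : ℕ → ℝ → ℝ)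
    (hF : ∀ j, ∀ t ∈ Set.Icc N (2 * N), HasDerivWithinAt (F j) (F (j + 1) t) (Set.Icc N (2 * N)) t)
    (hFb : ∀ j, ∀ t ∈ Set.Icc N (2 * N), C⁻¹ * T / N ^ j ≤ |F j t| ∧ |F j t| ≤ C * T / N ^ j)
    {S : Finset ℤ} (hS : ∀ n ∈ S, (n : ℝ) ∈ Set.Icc N (2 * N) ∧ |F 0 n - round (F 0 n)| < δ) :
    (#S : ℝ) ≤ 63 * C ^ 2 * T := by
  have hC0 : 0 < C := by linarith
  have hN0 : 0 < N := by linarith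
  have hT0 : 0 < T := by linarith
  have hwin : ∀ y, (#(windowPoints S y (1 / (4 * C * ((1 : ℕ) + 1)) * (N / T))) : ℝ) ≤
      (1 : ℕ) * (2 * (3 * C) + 1) := fun y => by
    refine card_le_of_gap 1 F hF (g := 3 * C) hδ.le (by positivity) (by positivity)
      (fun t ht => (hFb 1 t ht).1) (fun t ht => (hFb 1 t ht).2)
      (fun n hn => hS n (mem_filter.1 hn).1) (fun n hn => (mem_filter.1 hn).2) ?_ ?_
      (fun z => card_windowPoints_le _ _ (by positivity))
    · rw [mul_div_assoc]
      refine small_of_scale le_rfl hC (by positivity) rfl hδ.le hδ4 ?_ (by positivity) ?_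
      · refine le_of_eq ?_
        simp only [Nat.reduceAdd, Nat.choose_self, pow_one]
        field_simp
      · norm_num; linarith
    · have : C⁻¹ * T / N ^ 1 * (3 * C) ^ 1 = 3 * (T / N) := by field_simp
      rw [this]
      have h1 : δ ≤ T / N := by rw [le_div_iff₀ hN0]; linarith
      norm_num [Nat.factorial]; linarith
  have := card_le_of_window_le (x := N) (H := N) (by positivity) hN0.le
    (fun n hn => ⟨(hS n hn).1.1, by linarith [(hS n hn).1.2]⟩) hwin
  refine this.trans ?_
  have h1 : N / (1 / (4 * C * ((1 : ℕ) + 1)) * (N / T)) = 8 * C * T := by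
    push_cast; field_simp; norm_num
  rw [h1]
  have hCT : 1 ≤ C * T := one_le_mul_of_one_le_of_one_le hC hT
  calc (8 * C * T + 1) * ((1 : ℕ) * (2 * (3 * C) + 1)) ≤ (9 * (C * T)) * (7 * C) :=
        mul_le_mul (by linarith) (by push_cast; linarith) (by positivity) (by positivity)
    _ = _ := by ring

/-- In the range `N ^ d ≤ T ^ 2`, windows of length comparable to `l` contain boundedly many
points. -/
theorem exists_card_le_of_pow_le (d : ℕ) (hd : 1 ≤ d) (C : ℝ) (hC : 1 ≤ C) :
    ∃ K : ℝ, 0 < K ∧ ∀ N T δ l : ℝ, 1 ≤ N → 1 ≤ T → 0 < δ → δ < 1 / 4 → δ * T ≤ 1 →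
      N ^ d ≤ T ^ 2 → 0 < l → T * l ^ (d + 2).choose 2 = N ^ (d + 1) → ∀ F : ℕ → ℝ → ℝ,
      (∀ j, ∀ t ∈ Set.Icc N (2 * N),
        HasDerivWithinAt (F j) (F (j + 1) t) (Set.Icc N (2 * N)) t) →
      (∀ j, ∀ t ∈ Set.Icc N (2 * N), C⁻¹ * T / N ^ j ≤ |F j t| ∧ |F j t| ≤ C * T / N ^ j) →
      ∀ S : Finset ℤ,
      (∀ n ∈ S, (n : ℝ) ∈ Set.Icc N (2 * N) ∧ |F 0 n - round (F 0 n)| < δ) →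
      (#S : ℝ) ≤ K * (N / l + 1) := by
  have hC0 : 0 < C := by linarith
  set c₁ : ℝ := 1 / (4 * C * ((d + 1 : ℕ) + 1)) with hc₁
  set c₂ : ℝ := 1 / (4 * C * (d + 1)) with hc₂
  set g₁ : ℝ := C * ((d + 2).factorial + 1) with hg₁
  set g₂ : ℝ := C * ((d + 1).factorial + 1) with hg₂
  have hc₁0 : 0 < c₁ := by positivity
  have hc₂0 : 0 < c₂ := by positivity
  have hg₁0 : 0 < g₁ := by positivity
  have hg₂0 : 0 < g₂ := by positivity
  have hg₁1 : 1 ≤ g₁ := one_le_mul_of_one_le_of_one_le hC (by simp)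
  have hg₂1 : 1 ≤ g₂ := one_le_mul_of_one_le_of_one_le hC (by simp)
  set B : ℝ := (d + 1 : ℕ) * ((g₁ / c₂ + 1) * (d * (2 * g₂ + 1))) with hB
  have hd0 : (0 : ℝ) < d := by exact_mod_cast hd
  have hB0 : 0 < B := by positivity
  refine ⟨(1 / c₁ + 1) * B, by positivity, ?_⟩
  intro N T δ l hN hT hδ hδ4 hδT hNT hl hlT F hF hFb S hS
  have hN0 : 0 < N := by linarith
  have hT0 : 0 < T := by linarith
  obtain ⟨A, hA0, hA⟩ : ∃ A : ℝ, 0 < A ∧ T * A ^ (d + 1) = δ * N ^ (d + 1) := by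
    refine ⟨(δ * N ^ (d + 1) / T) ^ ((d + 1 : ℕ) : ℝ)⁻¹, by positivity, ?_⟩
    rw [Real.rpow_inv_natCast_pow (by positivity) (by omega)]
    field_simp
  have hlq := pow_choose_le_of_mul_pow_choose_eq hT hN0.le hl.le hNT hlT
  have hAq := mul_pow_choose_le_of_mul_pow_eq hd hT hN0.le hA0.le hNT hδ.le hδT hA
  have hAr := pow_choose_le_of_mul_pow_choose_le hT hA0.le hNT hAq
  have hinner : ∀ S' ⊆ S, ∀ y, (#(windowPoints S' y (c₂ * A)) : ℝ) ≤ d * (2 * g₂ + 1) := by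
    intro S' hS' y
    refine card_le_of_gap d F hF hδ.le hg₂0 (by positivity)
      (fun t ht => (hFb d t ht).1) (fun t ht => (hFb d t ht).2)
      (fun n hn => hS n (hS' (mem_filter.1 hn).1)) (fun n hn => (mem_filter.1 hn).2) ?_ ?_
      (fun z => card_windowPoints_le _ _ hg₂0.le)
    · rw [mul_div_assoc]
      refine small_of_scale hd hC hA0.le hc₂ hδ.le hδ4 ?_ (by positivity) ?_
      · rw [div_mul_eq_mul_div, div_le_one (by positivity)]; exact hAq
      · exact (mul_le_mul_of_nonneg_left hAr hδ.le).trans hδT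
    · have h1 : δ ≤ T / N ^ d := by
        rw [le_div_iff₀ (by positivity)]
        calc δ * N ^ d ≤ δ * T ^ 2 := by gcongr
          _ = δ * T * T := by ring
          _ ≤ 1 * T := by gcongr
          _ = T := one_mul T
      have h2 : g₂ ≤ g₂ ^ d := le_self_pow₀ hg₂1 (by omega)
      calc (d + 1).factorial * δ < ((d + 1).factorial + 1) * δ := by linarith
        _ ≤ ((d + 1).factorial + 1) * (T / N ^ d) := by gcongr
        _ = C⁻¹ * T / N ^ d * g₂ := by rw [hg₂]; field_simp
        _ ≤ _ := by gcongr
  have houter : ∀ y, (#(windowPoints S y (c₁ * l)) : ℝ) ≤ B := by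
    intro y
    refine card_le_of_gap (d + 1) F hF (g := g₁ * A) hδ.le (by positivity) (by positivity)
      (fun t ht => (hFb (d + 1) t ht).1) (fun t ht => (hFb (d + 1) t ht).2)
      (fun n hn => hS n (mem_filter.1 hn).1) (fun n hn => (mem_filter.1 hn).2) ?_ ?_
      (fun z => ?_)
    · rw [mul_div_assoc]
      refine small_of_scale (by omega) hC hl.le hc₁ hδ.le hδ4 ?_ (by positivity) ?_
      · rw [div_mul_eq_mul_div, div_le_one (by positivity)]; exact hlT.le
      · exact (mul_le_mul_of_nonneg_left hlq hδ.le).trans hδT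
    · have h1 : T / N ^ (d + 1) * A ^ (d + 1) = δ := by
        rw [div_mul_eq_mul_div, hA]; field_simp
      have h2 : g₁ ≤ g₁ ^ (d + 1) := le_self_pow₀ hg₁1 (by omega)
      calc ((d + 1 + 1).factorial : ℝ) * δ < ((d + 2).factorial + 1) * δ := by linarith
        _ = C⁻¹ * g₁ * (T / N ^ (d + 1) * A ^ (d + 1)) := by rw [hg₁, h1]; field_simp
        _ ≤ C⁻¹ * g₁ ^ (d + 1) * (T / N ^ (d + 1) * A ^ (d + 1)) := by gcongr
        _ = _ := by rw [mul_pow g₁ A]; ring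
    · have := card_le_of_window_le (x := z) (H := g₁ * A) (h := c₂ * A)
        (S := windowPoints (windowPoints S y (c₁ * l)) z (g₁ * A)) (by positivity) (by positivity)
        (fun n hn => (mem_filter.1 hn).2)
        (hinner _ ((filter_subset _ _).trans (filter_subset _ _)))
      rwa [mul_div_mul_right _ _ hA0.ne'] at this
  refine (card_le_of_window_le (x := N) (H := N) (by positivity) hN0.le
    (fun n hn => ⟨(hS n hn).1.1, by linarith [(hS n hn).1.2]⟩) houter).trans ?_
  have h1 : N / (c₁ * l) = 1 / c₁ * (N / l) := by field_simp
  have h2 : 0 < N / l := by positivity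
  have h3 : 0 < 1 / c₁ := by positivity
  rw [h1, mul_right_comm]
  gcongr
  nlinarith

theorem rpow_bound_le_succ {k : ℕ} (hk : 1 ≤ k) {N T : ℝ} (hN : 1 ≤ N) (hT : 1 ≤ T)
    (hNT : T ^ 2 ≤ N ^ k) :
    T ^ ((2 : ℝ) / ((k : ℝ) * ((k : ℝ) + 1))) * N ^ (((k : ℝ) - 1) / ((k : ℝ) + 1)) ≤
      T ^ ((2 : ℝ) / (((k + 1 : ℕ) : ℝ) * (((k + 1 : ℕ) : ℝ) + 1))) *
        N ^ ((((k + 1 : ℕ) : ℝ) - 1) / (((k + 1 : ℕ) : ℝ) + 1)) := by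
  have hN0 : 0 < N := by linarith
  have hT0 : 0 < T := by linarith
  have hk0 : (0 : ℝ) < k := by exact_mod_cast hk
  push_cast
  set e : ℝ := 2 / (k * (k + 1) * (k + 2)) with he
  have h1 : T ^ (2 * e) ≤ N ^ (k * e) := by
    rw [Real.rpow_mul hT0.le, Real.rpow_mul hN0.le]
    exact Real.rpow_le_rpow (by positivity) (by exact_mod_cast hNT) (by positivity)
  have e1 : (2 : ℝ) / (k * (k + 1)) = 2 / ((k + 1) * (k + 1 + 1)) + 2 * e := by
    rw [he]; field_simp; ring
  have e2 : ((k : ℝ) + 1 - 1) / (k + 1 + 1) = (k - 1) / (k + 1) + k * e := by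
    rw [he]; field_simp; ring
  rw [e1, e2, Real.rpow_add hT0, Real.rpow_add hN0]
  calc _ ≤ T ^ ((2 : ℝ) / ((k + 1) * (k + 1 + 1))) * N ^ (k * e) * N ^ (((k : ℝ) - 1) / (k + 1)) := by
        gcongr
    _ = _ := by ring

theorem exists_scale {d : ℕ} {N T : ℝ} (hN : 1 ≤ N) (hT : 1 ≤ T) :
    ∃ l : ℝ, 0 < l ∧ T * l ^ (d + 2).choose 2 = N ^ (d + 1) ∧
      N / l = T ^ ((2 : ℝ) / (((d + 1 : ℕ) : ℝ) * (((d + 1 : ℕ) : ℝ) + 1))) *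
        N ^ ((((d + 1 : ℕ) : ℝ) - 1) / (((d + 1 : ℕ) : ℝ) + 1)) := by
  have hN0 : 0 < N := by linarith
  have hT0 : 0 < T := by linarith
  have hp0 : (d + 2).choose 2 ≠ 0 := (Nat.choose_pos (by omega)).ne'
  have hp : (((d + 2).choose 2 : ℕ) : ℝ)⁻¹ = 2 / ((d + 1) * (d + 2)) := by
    have h : (2 : ℝ) * (((d + 2).choose 2 : ℕ) : ℝ) = (d + 2) * (d + 1) := by
      exact_mod_cast two_mul_choose_two (d + 1)
    rw [inv_eq_one_div, div_eq_div_iff (by exact_mod_cast hp0) (by positivity)]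
    linarith
  refine ⟨(N ^ (d + 1) / T) ^ (((d + 2).choose 2 : ℕ) : ℝ)⁻¹, by positivity, ?_, ?_⟩
  · rw [Real.rpow_inv_natCast_pow (by positivity) hp0]
    field_simp
  · rw [hp, Real.div_rpow (by positivity) hT0.le, ← Real.rpow_natCast N, ← Real.rpow_mul hN0.le]
    push_cast
    have e1 : ((d : ℝ) + 1 - 1) / (d + 1 + 1) = 1 - (d + 1) * (2 / ((d + 1) * (d + 2))) := by
      field_simp; ring
    have e2 : (2 : ℝ) / ((d + 1) * (d + 1 + 1)) = 2 / ((d + 1) * (d + 2)) := by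
      congr 2; ring
    rw [e1, e2, Real.rpow_sub hN0, Real.rpow_one]
    field_simp

/-- The bound for the points of `S`, with the derivatives of `F 0` given as a family. -/
theorem exists_card_le (k : ℕ) (hk : 1 ≤ k) (C : ℝ) (hC : 1 ≤ C) :
    ∃ K : ℝ, 0 < K ∧ ∀ N T δ : ℝ, 1 ≤ N → 1 ≤ T → 0 < δ → δ < 1 / 4 → N * δ ≤ T → δ * T ≤ 1 →
      ∀ F : ℕ → ℝ → ℝ,
      (∀ j, ∀ t ∈ Set.Icc N (2 * N),
        HasDerivWithinAt (F j) (F (j + 1) t) (Set.Icc N (2 * N)) t) →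
      (∀ j, ∀ t ∈ Set.Icc N (2 * N), C⁻¹ * T / N ^ j ≤ |F j t| ∧ |F j t| ≤ C * T / N ^ j) →
      ∀ S : Finset ℤ,
      (∀ n ∈ S, (n : ℝ) ∈ Set.Icc N (2 * N) ∧ |F 0 n - round (F 0 n)| < δ) →
      (#S : ℝ) ≤ K * (T ^ ((2 : ℝ) / ((k : ℝ) * ((k : ℝ) + 1))) *
        N ^ (((k : ℝ) - 1) / ((k : ℝ) + 1))) := by
  induction k, hk using Nat.le_induction with
  | base =>
    refine ⟨63 * C ^ 2, by positivity, ?_⟩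
    intro N T δ hN hT hδ hδ4 hNδ _ F hF hFb S hS
    have := card_le_of_one hC hN hT hδ hδ4 hNδ F hF hFb hS
    norm_num
    exact this
  | succ k hk ih =>
    obtain ⟨K₁, hK₁, h₁⟩ := ih
    obtain ⟨K₂, hK₂, h₂⟩ := exists_card_le_of_pow_le k hk C hC
    refine ⟨K₁ + 2 * K₂, by positivity, ?_⟩
    intro N T δ hN hT hδ hδ4 hNδ hδT F hF hFb S hS
    have hN0 : 0 < N := by linarith
    have hT0 : 0 < T := by linarith
    set M := T ^ ((2 : ℝ) / (((k + 1 : ℕ) : ℝ) * (((k + 1 : ℕ) : ℝ) + 1))) *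
        N ^ ((((k + 1 : ℕ) : ℝ) - 1) / (((k + 1 : ℕ) : ℝ) + 1)) with hM
    have hM1 : 1 ≤ M := by
      refine one_le_mul_of_one_le_of_one_le (Real.one_le_rpow hT (by positivity))
        (Real.one_le_rpow hN ?_)
      push_cast
      rw [add_sub_cancel_right]
      positivity
    rcases le_total (N ^ k) (T ^ 2) with h | h
    · obtain ⟨l, hl, hlT, hlM⟩ := exists_scale (d := k) hN hT
      have := h₂ N T δ l hN hT hδ hδ4 hδT h hl hlT F hF hFb S hS
      rw [hlM, ← hM] at this
      nlinarith
    · have := h₁ N T δ hN hT hδ hδ4 hNδ hδT F hF hFb S hS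
      have h3 := rpow_bound_le_succ hk hN hT h
      rw [← hM] at h3
      nlinarith

theorem stmt_16 (k : ℕ) (hk : 1 ≤ k) (C : ℝ) (hC : 1 ≤ C) :
    ∃ K : ℝ, 0 < K ∧
      ∀ (N : ℕ), 4 ≤ N → ∀ δ : ℝ, 0 < δ → δ < 1/4 →
      ∀ T : ℝ, 1 ≤ T → (N:ℝ) * δ ≤ T → T ≤ δ⁻¹ →
      ∀ f : ℝ → ℝ, ContDiffOn ℝ (⊤ : ℕ∞) f (Set.Icc (N:ℝ) (2*N)) →
      (∀ j : ℕ, ∀ x ∈ Set.Icc (N:ℝ) (2*N),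
        C⁻¹ * T / (N:ℝ)^j ≤ |iteratedDerivWithin j f (Set.Icc (N:ℝ) (2*N)) x| ∧
        |iteratedDerivWithin j f (Set.Icc (N:ℝ) (2*N)) x| ≤ C * T / (N:ℝ)^j) →
      (({n : ℤ | (N:ℤ) ≤ n ∧ n ≤ 2*N ∧ |f n - round (f n)| < δ}.ncard : ℝ)) ≤
        K * T ^ ((2:ℝ)/((k:ℝ)*((k:ℝ)+1))) * (N:ℝ) ^ (((k:ℝ)-1)/((k:ℝ)+1)) := by
  obtain ⟨K, hK, h⟩ := exists_card_le k hk C hC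
  refine ⟨K, hK, ?_⟩
  intro N hN δ hδ hδ4 T hT hNδ hTδ f hf hfb
  have hN1 : (1 : ℝ) ≤ N := by exact_mod_cast (by omega : 1 ≤ N)
  have hset : {n : ℤ | (N:ℤ) ≤ n ∧ n ≤ 2*N ∧ |f n - round (f n)| < δ} =
      ((Finset.Icc (N : ℤ) (2 * N)).filter fun n : ℤ => |f n - round (f n)| < δ : Finset ℤ) := by
    ext n; simp [and_assoc]
  have huniq : UniqueDiffOn ℝ (Set.Icc (N : ℝ) (2 * N)) := uniqueDiffOn_Icc (by linarith)
  rw [hset, Set.ncard_coe_finset, mul_assoc]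
  refine h N T δ hN1 hT hδ hδ4 hNδ ?_
    (fun j => iteratedDerivWithin j f (Set.Icc (N : ℝ) (2 * N))) (fun j t ht => ?_) hfb _ ?_
  · calc δ * T ≤ δ * δ⁻¹ := by gcongr
      _ = 1 := mul_inv_cancel₀ hδ.ne'
  · rw [iteratedDerivWithin_succ]
    exact (hf.differentiableOn_iteratedDerivWithin (by exact_mod_cast ENat.natCast_lt_top j) huniq
      t ht).hasDerivWithinAt
  · intro n hn
    rw [mem_filter, Finset.mem_Icc] at hn
    exact ⟨⟨by exact_mod_cast hn.1.1, by exact_mod_cast hn.1.2⟩,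
      by simpa [iteratedDerivWithin_zero] using hn.2⟩
end

section
/- For every real C ≥ 1 there exists a constant K > 0 (depending only on C) with the following property: for every integer N ≥ 4, every real 0 < δ < 1/4, every λ₂ > 0, and every function f of class C² on [N, 2N] satisfying C^{−1}·λ₂ ≤ |f″(x)| ≤ C·λ₂ for all x ∈ [N, 2N], we have R(f,N,δ) ≤ K·( N·λ₂^{1/3} + N·δ + (δ/λ₂)^{1/2} + 1 ). -/
/-- Weighted chain bound: if the weight of each element is controlled by its distance to every
smaller element, then the total weight is controlled by one maximal weight and the total span. -/
lemma sum_weight_le_of_gap {α : Type*} [LinearOrder α] (F : Finset α) (w lo hi : α → ℝ)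
    {W κ V : ℝ} (hκ : 0 ≤ κ) (hW : 0 ≤ W) (hlo : ∀ x ∈ F, V ≤ lo x) (hlohi : ∀ x ∈ F, lo x ≤ hi x)
    (hw : ∀ x ∈ F, w x ≤ W) (hgap : ∀ x ∈ F, ∀ y ∈ F, x < y → w y ≤ κ * (lo y - hi x)) :
    ∀ U : ℝ, V ≤ U → (∀ x ∈ F, hi x ≤ U) →
      ∑ x ∈ F, (w x + κ * (hi x - lo x)) ≤ W + κ * (U - V) := by
  induction F using Finset.induction_on_max with
  | empty =>
    intro U hU _
    simpa using add_nonneg hW (mul_nonneg hκ (sub_nonneg.2 hU))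
  | insert m F hm ih =>
    intro U hU hhi
    have hmF : m ∉ F := fun h => lt_irrefl _ (hm m h)
    rw [Finset.sum_insert hmF]
    have hmU := hhi m (Finset.mem_insert_self _ _)
    have hmV := hlo m (Finset.mem_insert_self _ _)
    have hmW := hw m (Finset.mem_insert_self _ _)
    rcases F.eq_empty_or_nonempty with rfl | hne
    · simp only [Finset.sum_empty, add_zero]
      have : κ * (hi m - lo m) ≤ κ * (U - V) := mul_le_mul_of_nonneg_left (by linarith) hκ
      linarith
    · obtain ⟨x, hx, hxmax⟩ := F.exists_max_image hi hne
      have hxm := Finset.mem_insert_of_mem (b := m) hx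
      have hg := hgap x hxm m (Finset.mem_insert_self _ _) (hm x hx)
      have := ih (fun y hy => hlo y (Finset.mem_insert_of_mem hy))
        (fun y hy => hlohi y (Finset.mem_insert_of_mem hy))
        (fun y hy => hw y (Finset.mem_insert_of_mem hy))
        (fun y hy z hz => hgap y (Finset.mem_insert_of_mem hy) z (Finset.mem_insert_of_mem hz))
        (hi x) ((hlo x hxm).trans (hlohi x hxm)) hxmax
      have h2 : κ * hi m ≤ κ * U := mul_le_mul_of_nonneg_left hmU hκ
      linarith

/-- A set of integers in `[V, U]` whose elements are `d`-separated has at most `1 + (U - V) / d`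
elements. -/
lemma card_le_of_separated_s17 (F : Finset ℤ) {d U V : ℝ} (hd : 0 < d) (hVU : V ≤ U)
    (hV : ∀ x ∈ F, V ≤ (x : ℝ)) (hU : ∀ x ∈ F, (x : ℝ) ≤ U)
    (hsep : ∀ x ∈ F, ∀ y ∈ F, x < y → d ≤ (y : ℝ) - x) :
    (F.card : ℝ) ≤ 1 + (U - V) / d := by
  have h := sum_weight_le_of_gap F (fun _ => 1) (fun x => (x : ℝ)) (fun x => (x : ℝ))
    (W := 1) (κ := 1 / d) (by positivity) zero_le_one hV (fun _ _ => le_rfl) (fun _ _ => le_rfl)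
    (fun x hx y hy hxy => by
      rw [one_div_mul_eq_div, le_div_iff₀ hd, one_mul]
      exact hsep x hx y hy hxy) U hVU hU
  simpa [div_eq_inv_mul] using h

/-- Points near the levels `b / q` on the increasing part of a convex function. -/
lemma card_le_of_levels_of_nonneg (P : Finset ℤ) (g g' : ℤ → ℝ) (b : ℤ → ℤ) {q : ℕ} (hq : 0 < q)
    {δ h κ W U V : ℝ} (hδ : 0 < δ) (hh : 0 < h) (hδh : δ * h ≤ 1 / 32) (hqh : (q : ℝ) ≤ h)
    (hκ : 0 < κ) (hW : 0 ≤ W) (hδW : 2 * δ ≤ κ * W ^ 2)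
    (hb : ∀ x ∈ P, |g x - b x / q| < δ)
    (hT : ∀ x ∈ P, ∀ y ∈ P, g' x * ((y : ℝ) - x) + κ * ((y : ℝ) - x) ^ 2 ≤ g y - g x)
    (hg0 : ∀ x ∈ P, 0 ≤ g' x) (hg1 : ∀ x ∈ P, g' x ≤ 1 / (8 * q * h))
    (hmod : ∀ x ∈ P, ∀ y ∈ P, b x = b y → (q : ℤ) ∣ y - x)
    (hVU : V ≤ U) (hV : ∀ x ∈ P, V ≤ (x : ℝ)) (hU : ∀ x ∈ P, (x : ℝ) ≤ U) :
    (P.card : ℝ) ≤ 1 + W / q + 1 / (2 * h) * (U - V) := by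
  have hq' : (0 : ℝ) < q := by exact_mod_cast hq
  have hends : ∀ β : ℤ, ∃ l r : ℤ, β ∈ P.image b → l ∈ P ∧ b l = β ∧ r ∈ P ∧ b r = β ∧
      ∀ x ∈ P, b x = β → l ≤ x ∧ x ≤ r := by
    intro β
    by_cases hβ : β ∈ P.image b
    · have hne : (P.filter (b · = β)).Nonempty := by
        obtain ⟨x, hx, hxb⟩ := Finset.mem_image.1 hβ
        exact ⟨x, by simpa using ⟨hx, hxb⟩⟩
      have h1 := Finset.mem_filter.1 (Finset.min'_mem _ hne)
      have h2 := Finset.mem_filter.1 (Finset.max'_mem _ hne)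
      refine ⟨_, _, fun _ => ⟨h1.1, h1.2, h2.1, h2.2, fun x hx hxb => ?_⟩⟩
      have hxm : x ∈ P.filter (b · = β) := Finset.mem_filter.2 ⟨hx, hxb⟩
      exact ⟨Finset.min'_le _ _ hxm, Finset.le_max' _ _ hxm⟩
    · exact ⟨0, 0, fun h => absurd h hβ⟩
  choose l r hlr using hends
  have hle : ∀ β ∈ P.image b, (l β : ℝ) ≤ r β := by
    intro β hβ
    obtain ⟨h1, h2, h3, h4, h5⟩ := hlr β hβ
    exact_mod_cast (h5 _ h1 h2).2
  have hfib : ∀ β ∈ P.image b,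
      (((P.filter (b · = β)).card : ℕ) : ℝ) ≤ 1 + ((r β : ℝ) - l β) / q := by
    intro β hβ
    obtain ⟨h1, h2, h3, h4, h5⟩ := hlr β hβ
    refine card_le_of_separated_s17 _ hq' (hle β hβ) ?_ ?_ ?_
    · intro x hx
      rw [Finset.mem_filter] at hx
      exact_mod_cast (h5 x hx.1 hx.2).1
    · intro x hx
      rw [Finset.mem_filter] at hx
      exact_mod_cast (h5 x hx.1 hx.2).2
    · intro x hx y hy hxy
      rw [Finset.mem_filter] at hx hy
      have := Int.le_of_dvd (by linarith) (hmod x hx.1 y hy.1 (hx.2.trans hy.2.symm))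
      exact_mod_cast this
  have hδq : 2 * δ ≤ 1 / (2 * q) := by
    rw [le_div_iff₀ (by positivity)]
    nlinarith
  have hinc : ∀ x ∈ P, ∀ y ∈ P, g y - g x ≤ g' y * ((y : ℝ) - x) := by
    intro x hx y hy
    have := hT y hy x hx
    nlinarith [sq_nonneg ((x : ℝ) - y)]
  have hchain := sum_weight_le_of_gap (P.image b) (fun β => 1 + ((r β : ℝ) - l β) / q)
    (fun β => (l β : ℝ)) (fun β => (r β : ℝ)) (W := 1 + W / q) (κ := 1 / (2 * h)) (V := V)
    (by positivity) (by positivity) (fun β hβ => hV _ (hlr β hβ).1) hle ?_ ?_ U hVU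
    (fun β hβ => hU _ (hlr β hβ).2.2.1)
  · rw [Finset.card_eq_sum_card_image b P]
    push_cast
    refine le_trans (Finset.sum_le_sum fun β hβ => ?_) hchain
    have : 0 ≤ 1 / (2 * h) * ((r β : ℝ) - l β) :=
      mul_nonneg (by positivity) (sub_nonneg.2 (hle β hβ))
    linarith [hfib β hβ]
  · intro β hβ
    obtain ⟨h1, h2, h3, h4, h5⟩ := hlr β hβ
    have ht := hT _ h1 _ h3
    have hb1 := abs_lt.1 (hb _ h1)
    have hb2 := abs_lt.1 (hb _ h3)
    rw [h2] at hb1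
    rw [h4] at hb2
    have hp := mul_nonneg (hg0 _ h1) (sub_nonneg.2 (hle β hβ))
    have hsq : ((r β : ℝ) - l β) ^ 2 ≤ W ^ 2 := by
      refine le_of_mul_le_mul_left ?_ hκ
      linarith
    have := abs_le_of_sq_le_sq' hsq hW
    have := div_le_div_of_nonneg_right this.2 hq'.le
    linarith
  · intro β hβ γ hγ hlt
    obtain ⟨-, -, hx, hxb, -⟩ := hlr β hβ
    obtain ⟨hy, hyb, hz, hzb, -⟩ := hlr γ hγ
    have hb1 := abs_lt.1 (hb _ hx)
    have hb2 := abs_lt.1 (hb _ hy)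
    have hb3 := abs_lt.1 (hb _ hz)
    rw [hxb] at hb1
    rw [hyb] at hb2
    rw [hzb] at hb3
    have hzy := sub_nonneg.2 (hle γ hγ)
    have hyz := hT _ hy _ hz
    have hxy := hinc _ hx _ hy
    have hy0 := hg0 _ hy
    have hy1 := hg1 _ hy
    set x : ℝ := (r β : ℝ)
    set y : ℝ := (l γ : ℝ)
    set z : ℝ := (r γ : ℝ)
    set d : ℝ := g' (l γ)
    have hstep : 1 / (q : ℝ) ≤ γ / q - β / q := by
      rw [← sub_div]
      have : (1 : ℝ) ≤ γ - β := by
        have : (β : ℝ) + 1 ≤ γ := by exact_mod_cast hlt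
        linarith
      gcongr
    have hhalf : 1 / (q : ℝ) = 1 / (2 * q) + 1 / (2 * q) := by field_simp; norm_num
    have hd : 1 / (2 * q) ≤ d * (y - x) := by linarith
    have hpos : 0 < y - x := by
      by_contra hcon
      have : d * (y - x) ≤ 0 := mul_nonpos_of_nonneg_of_nonpos hy0 (not_lt.1 hcon)
      have : (0 : ℝ) < 1 / (2 * q) := by positivity
      linarith
    have hdz : d * (z - y) ≤ 2 * δ := by
      have := mul_nonneg hκ.le (sq_nonneg (z - y))
      linarith
    have h4h : 4 * h ≤ y - x := by
      have := hd.trans (mul_le_mul_of_nonneg_right hy1 hpos.le)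
      rw [div_mul_eq_mul_div, one_mul, div_le_div_iff₀ (by positivity) (by positivity)] at this
      have : (4 * h) * (2 * q) ≤ (y - x) * (2 * q) := by linarith
      exact le_of_mul_le_mul_right this (by positivity)
    have hlen : (z - y) / q ≤ 4 * δ * (y - x) := by
      have h1 := mul_le_mul_of_nonneg_right hd hzy
      have h2 := mul_le_mul_of_nonneg_right hdz hpos.le
      have h3 : (z - y) / q = 2 * (1 / (2 * q) * (z - y)) := by field_simp
      rw [h3]
      linarith
    rw [one_div_mul_eq_div, le_div_iff₀ (by positivity)]
    have h5 : (z - y) / q * (2 * h) ≤ 4 * δ * (y - x) * (2 * h) := by gcongr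
    have h6 : (δ * h) * (y - x) ≤ 1 / 32 * (y - x) := by gcongr
    linarith

/-- Points near the levels `b / q` of a convex function with small derivative. -/
lemma card_le_of_levels (P : Finset ℤ) (g g' : ℤ → ℝ) (b : ℤ → ℤ) {q : ℕ} (hq : 0 < q)
    {δ h κ W U V : ℝ} (hδ : 0 < δ) (hh : 0 < h) (hδh : δ * h ≤ 1 / 32) (hqh : (q : ℝ) ≤ h)
    (hκ : 0 < κ) (hW : 0 ≤ W) (hδW : 2 * δ ≤ κ * W ^ 2)
    (hb : ∀ x ∈ P, |g x - b x / q| < δ)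
    (hT : ∀ x ∈ P, ∀ y ∈ P, g' x * ((y : ℝ) - x) + κ * ((y : ℝ) - x) ^ 2 ≤ g y - g x)
    (hg : ∀ x ∈ P, |g' x| ≤ 1 / (8 * q * h))
    (hmod : ∀ x ∈ P, ∀ y ∈ P, b x = b y → (q : ℤ) ∣ y - x)
    (hVU : V ≤ U) (hV : ∀ x ∈ P, V ≤ (x : ℝ)) (hU : ∀ x ∈ P, (x : ℝ) ≤ U) :
    (P.card : ℝ) ≤ 2 + 2 * W / q + 1 / h * (U - V) := by
  have h1 := card_le_of_levels_of_nonneg (P.filter (0 ≤ g' ·)) g g' b hq hδ hh hδh hqh hκ hW hδW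
    (fun x hx => hb x (Finset.mem_filter.1 hx).1)
    (fun x hx y hy => hT x (Finset.mem_filter.1 hx).1 y (Finset.mem_filter.1 hy).1)
    (fun x hx => (Finset.mem_filter.1 hx).2)
    (fun x hx => (abs_le.1 (hg x (Finset.mem_filter.1 hx).1)).2)
    (fun x hx y hy => hmod x (Finset.mem_filter.1 hx).1 y (Finset.mem_filter.1 hy).1) hVU
    (fun x hx => hV x (Finset.mem_filter.1 hx).1) (fun x hx => hU x (Finset.mem_filter.1 hx).1)
  have hmem : ∀ x ∈ (P.filter (¬ 0 ≤ g' ·)).image (- ·), -x ∈ P ∧ g' (-x) < 0 := by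
    intro x hx
    obtain ⟨y, hy, rfl⟩ := Finset.mem_image.1 hx
    rw [Finset.mem_filter] at hy
    simpa using hy
  have h2 := card_le_of_levels_of_nonneg ((P.filter (¬ 0 ≤ g' ·)).image (- ·))
    (fun x => g (-x)) (fun x => -g' (-x)) (fun x => b (-x)) (U := -V) (V := -U)
    hq hδ hh hδh hqh hκ hW hδW
    (fun x hx => hb _ (hmem x hx).1)
    (fun x hx y hy => by
      have := hT _ (hmem x hx).1 _ (hmem y hy).1
      push_cast at this
      linarith)
    (fun x hx => by linarith [(hmem x hx).2])
    (fun x hx => by linarith [(abs_le.1 (hg _ (hmem x hx).1)).1])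
    (fun x hx y hy hxy => by
      have := hmod _ (hmem x hx).1 _ (hmem y hy).1 hxy
      rwa [← dvd_neg, neg_sub'])
    (by linarith)
    (fun x hx => by
      have := hU _ (hmem x hx).1
      push_cast at this
      linarith)
    (fun x hx => by
      have := hV _ (hmem x hx).1
      push_cast at this
      linarith)
  rw [Finset.card_image_of_injective _ neg_injective] at h2
  have h3 : (P.card : ℝ) = (P.filter (0 ≤ g' ·)).card + (P.filter (¬ 0 ≤ g' ·)).card := by
    exact_mod_cast (Finset.card_filter_add_card_filter_not (s := P) (0 ≤ g' ·)).symm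
  have h4 : 1 / h * (U - V) = 1 / (2 * h) * (U - V) + 1 / (2 * h) * (-V - -U) := by
    have : 1 / h = 2 * (1 / (2 * h)) := by field_simp
    rw [this]
    ring
  have h5 : 2 * W / q = W / q + W / q := by ring
  rw [h3, h4, h5]
  linarith

/-- Distinct rationals are at least the inverse of the product of their denominators apart. -/
lemma one_div_den_mul_den_le_sub {s t : ℚ} (h : s < t) :
    1 / ((s.den : ℝ) * t.den) ≤ (t : ℝ) - s := by
  have hs : (0 : ℝ) < s.den := by exact_mod_cast s.den_pos
  have ht : (0 : ℝ) < t.den := by exact_mod_cast t.den_pos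
  rw [Rat.lt_iff] at h
  have h' : (s.num : ℝ) * t.den + 1 ≤ t.num * s.den := by exact_mod_cast h
  rw [Rat.cast_def s, Rat.cast_def t, div_sub_div _ _ ht.ne' hs.ne', mul_comm (s.den : ℝ)]
  gcongr
  linarith

/-- A quantitative convexity bound: a sequence with second derivative about `lam` is rarely
within `δ` of an integer. -/
lemma card_close_to_integers_le (S : Finset ℤ) (f f' : ℤ → ℝ) (m : ℤ → ℤ)
    {C lam δ h W U V : ℝ} (hC : 1 ≤ C) (hlam : 0 < lam) (hδ : 0 < δ) (hh : 0 < h) (hW : 0 ≤ W)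
    (hδh : δ * h ≤ 1 / 32) (hlh : C * lam * h ^ 3 ≤ 1 / 32) (hδW : 2 * δ ≤ lam / (2 * C) * W ^ 2)
    (hWh : C * lam * h ^ 2 * W ≤ C / 16)
    (hm : ∀ x ∈ S, |f x - m x| < δ)
    (hT : ∀ x ∈ S, ∀ y ∈ S,
      f' x * ((y : ℝ) - x) + lam / (2 * C) * ((y : ℝ) - x) ^ 2 ≤ f y - f x)
    (hL : ∀ x ∈ S, ∀ y ∈ S, |f' y - f' x| ≤ C * lam * |(y : ℝ) - x|)
    (hVU : V ≤ U) (hV : ∀ x ∈ S, V ≤ (x : ℝ)) (hU : ∀ x ∈ S, (x : ℝ) ≤ U) :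
    (S.card : ℝ) ≤ 3 + 2 * W + 2 * C * ((U - V) / h) := by
  classical
  have hC0 : 0 < C := by linarith
  have hκ : 0 < lam / (2 * C) := by positivity
  set G := S.filter (fun x => ∃ y ∈ S, y ≠ x ∧ |(y : ℝ) - x| < h) with hG
  have hGS : ∀ x ∈ G, x ∈ S := fun x hx => (Finset.mem_filter.1 hx).1
  have hisolated : ((S.filter (fun x => ¬ ∃ y ∈ S, y ≠ x ∧ |(y : ℝ) - x| < h)).card : ℝ)
      ≤ 1 + (U - V) / h := by
    refine card_le_of_separated_s17 _ hh hVU (fun x hx => hV x (Finset.mem_filter.1 hx).1)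
      (fun x hx => hU x (Finset.mem_filter.1 hx).1) ?_
    intro x hx y hy hxy
    by_contra hcon
    refine (Finset.mem_filter.1 hx).2 ⟨y, (Finset.mem_filter.1 hy).1, hxy.ne', ?_⟩
    have : (x : ℝ) < y := by exact_mod_cast hxy
    rw [abs_of_pos (by linarith)]
    exact not_le.1 hcon
  have hslope : ∀ x : ℤ, ∃ s : ℚ, x ∈ G →
      (s.den : ℝ) ≤ h ∧ |f' x - s| ≤ 1 / (8 * s.den * h) := by
    intro x
    by_cases hx : x ∈ G
    swap
    · exact ⟨0, fun h => absurd h hx⟩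
    obtain ⟨hxS, y, hyS, hne, hlt⟩ := Finset.mem_filter.1 hx
    set s : ℚ := Rat.divInt (m y - m x) (y - x) with hs
    refine ⟨s, fun _ => ?_⟩
    have hd0 : (y - x : ℤ) ≠ 0 := sub_ne_zero.2 hne
    have hd0' : (y : ℝ) - x ≠ 0 := by exact_mod_cast hd0
    have habs : 0 < |(y : ℝ) - x| := abs_pos.2 hd0'
    have hden : (s.den : ℝ) ≤ |(y : ℝ) - x| := by
      have h1 : (s.den : ℤ) ∣ y - x := Rat.den_dvd _ _
      have h2 := Int.le_of_dvd (abs_pos.2 hd0) ((dvd_abs _ _).2 h1)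
      exact_mod_cast h2
    have hq : (0 : ℝ) < s.den := by exact_mod_cast s.den_pos
    refine ⟨hden.trans hlt.le, ?_⟩
    have hsd : (s : ℝ) * ((y : ℝ) - x) = m y - m x := by
      have : (s : ℝ) = ((m y : ℝ) - m x) / ((y : ℝ) - x) := by
        rw [hs, Rat.divInt_eq_div]
        push_cast
        rfl
      rw [this, div_mul_cancel₀ _ hd0']
    have h1 := hT x hxS y hyS
    have h2 := hT y hyS x hxS
    have h4 := abs_lt.1 (hm x hxS)
    have h5 := abs_lt.1 (hm y hyS)
    have hsq : 0 ≤ lam / (2 * C) * ((y : ℝ) - x) ^ 2 := by positivity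
    have hsq' : 0 ≤ lam / (2 * C) * ((x : ℝ) - y) ^ 2 := by positivity
    have hLd : (f' y - f' x) * ((y : ℝ) - x) ≤ C * lam * |(y : ℝ) - x| * |(y : ℝ) - x| := by
      refine (le_abs_self _).trans ?_
      rw [abs_mul]
      exact mul_le_mul_of_nonneg_right (hL x hxS y hyS) (abs_nonneg _)
    have hkey : |f' x - s| * |(y : ℝ) - x| ≤
        2 * δ + C * lam * |(y : ℝ) - x| * |(y : ℝ) - x| := by
      rw [← abs_mul, sub_mul, hsd, abs_le]
      constructor <;> linarith
    have hkey2 : |f' x - s| ≤ 2 * δ / |(y : ℝ) - x| + C * lam * |(y : ℝ) - x| := by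
      rw [← mul_le_mul_iff_left₀ habs, add_mul, div_mul_cancel₀ _ habs.ne']
      exact hkey
    have h6 : 2 * δ / |(y : ℝ) - x| ≤ 2 * δ / s.den := by gcongr
    have h7 : C * lam * |(y : ℝ) - x| ≤ C * lam * h := by gcongr
    refine (hkey2.trans (add_le_add h6 h7)).trans ?_
    rw [le_div_iff₀ (by positivity)]
    have h8 : (2 * δ / s.den + C * lam * h) * (8 * s.den * h) =
        16 * (δ * h) + 8 * (C * lam * h ^ 2 * s.den) := by
      field_simp
      ring
    have h9 : C * lam * h ^ 2 * s.den ≤ C * lam * h ^ 2 * h := by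
      gcongr
      exact hden.trans hlt.le
    rw [h8]
    linarith
  choose s hs using hslope
  have hgap : ∀ x ∈ G, ∀ y ∈ G, s x < s y →
      3 / 4 * (1 / ((s x).den * (s y).den)) ≤ C * lam * ((y : ℝ) - x) := by
    intro x hx y hy hlt
    obtain ⟨hqx, hfx⟩ := hs x hx
    obtain ⟨hqy, hfy⟩ := hs y hy
    have hp : (0 : ℝ) < (s x).den := by exact_mod_cast (s x).den_pos
    have hq : (0 : ℝ) < (s y).den := by exact_mod_cast (s y).den_pos
    have h1 := one_div_den_mul_den_le_sub hlt
    set p : ℝ := ((s x).den : ℝ)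
    set q : ℝ := ((s y).den : ℝ)
    have h2 : 1 / (8 * p * h) ≤ 1 / 8 * (1 / (p * q)) := by
      rw [one_div_mul_one_div]
      gcongr 1 / ?_
      nlinarith
    have h3 : 1 / (8 * q * h) ≤ 1 / 8 * (1 / (p * q)) := by
      rw [one_div_mul_one_div]
      gcongr 1 / ?_
      nlinarith
    have h4 := abs_le.1 hfx
    have h5 := abs_le.1 hfy
    have h6 : 3 / 4 * (1 / (p * q)) ≤ f' y - f' x := by linarith
    have h7 := abs_le.1 (hL x (hGS x hx) y (hGS y hy))
    have hpos : 0 < (y : ℝ) - x := by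
      have ha := hT x (hGS x hx) y (hGS y hy)
      have hb := hT y (hGS y hy) x (hGS x hx)
      have hsq : 0 ≤ lam / (2 * C) * ((y : ℝ) - x) ^ 2 := by positivity
      have hsq' : 0 ≤ lam / (2 * C) * ((x : ℝ) - y) ^ 2 := by positivity
      have h8 : 0 ≤ (f' y - f' x) * ((y : ℝ) - x) := by linarith
      have h9 : 0 < f' y - f' x := lt_of_lt_of_le (by positivity) h6
      have h10 : 0 ≤ (y : ℝ) - x := nonneg_of_mul_nonneg_right h8 h9
      refine lt_of_le_of_ne h10 fun h0 => ?_
      have : x = y := by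
        have : (x : ℝ) = y := by linarith
        exact_mod_cast this
      rw [this] at hlt
      exact lt_irrefl _ hlt
    rw [abs_of_pos hpos] at h7
    linarith
  have hends : ∀ σ : ℚ, ∃ l r : ℤ, σ ∈ G.image s → l ∈ G ∧ s l = σ ∧ r ∈ G ∧ s r = σ ∧
      ∀ x ∈ G, s x = σ → l ≤ x ∧ x ≤ r := by
    intro σ
    by_cases hσ : σ ∈ G.image s
    · have hne : (G.filter (s · = σ)).Nonempty := by
        obtain ⟨x, hx, hxb⟩ := Finset.mem_image.1 hσ
        exact ⟨x, Finset.mem_filter.2 ⟨hx, hxb⟩⟩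
      have h1 := Finset.mem_filter.1 (Finset.min'_mem _ hne)
      have h2 := Finset.mem_filter.1 (Finset.max'_mem _ hne)
      refine ⟨_, _, fun _ => ⟨h1.1, h1.2, h2.1, h2.2, fun x hx hxb => ?_⟩⟩
      have hxm : x ∈ G.filter (s · = σ) := Finset.mem_filter.2 ⟨hx, hxb⟩
      exact ⟨Finset.min'_le _ _ hxm, Finset.le_max' _ _ hxm⟩
    · exact ⟨0, 0, fun h => absurd h hσ⟩
  choose l r hlr using hends
  have hle : ∀ σ ∈ G.image s, (l σ : ℝ) ≤ r σ := by
    intro σ hσ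
    obtain ⟨h1, h2, h3, h4, h5⟩ := hlr σ hσ
    exact_mod_cast (h5 _ h1 h2).2
  have hfib : ∀ σ ∈ G.image s, (((G.filter (s · = σ)).card : ℕ) : ℝ) ≤
      2 + 2 * W / σ.den + 1 / h * ((r σ : ℝ) - l σ) := by
    intro σ hσ
    obtain ⟨h1, h2, h3, h4, h5⟩ := hlr σ hσ
    have hqh := (hs _ h1).1
    rw [h2] at hqh
    have hq : (0 : ℝ) < σ.den := by exact_mod_cast σ.den_pos
    refine card_le_of_levels _ (fun x => f x - σ * x) (fun x => f' x - σ)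
      (fun x => σ.den * m x - σ.num * x) σ.den_pos hδ hh hδh hqh hκ hW hδW ?_ ?_ ?_ ?_
      (hle σ hσ) ?_ ?_
    · intro x hx
      rw [Finset.mem_filter] at hx
      convert hm x (hGS x hx.1) using 2
      push_cast
      rw [Rat.cast_def σ]
      field_simp
      ring
    · intro x hx y hy
      rw [Finset.mem_filter] at hx hy
      have := hT x (hGS x hx.1) y (hGS y hy.1)
      linarith
    · intro x hx
      rw [Finset.mem_filter] at hx
      have := (hs x hx.1).2
      rw [hx.2] at this
      exact this
    · intro x _ y _ hxy
      have h6 : (σ.den : ℤ) ∣ σ.num * (y - x) := ⟨m y - m x, by linarith⟩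
      refine IsCoprime.dvd_of_dvd_mul_left ?_ h6
      exact (Rat.isCoprime_num_den σ).symm
    · intro x hx
      rw [Finset.mem_filter] at hx
      exact_mod_cast (h5 x hx.1 hx.2).1
    · intro x hx
      rw [Finset.mem_filter] at hx
      exact_mod_cast (h5 x hx.1 hx.2).2
  have hchain := sum_weight_le_of_gap (G.image s) (fun σ => 2 + 2 * W / σ.den)
    (fun σ => (l σ : ℝ)) (fun σ => (r σ : ℝ)) (W := 2 + 2 * W) (κ := C / h) (V := V)
    (by positivity) (by positivity) (fun σ hσ => hV _ (hGS _ (hlr σ hσ).1)) hle ?_ ?_ U hVU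
    (fun σ hσ => hU _ (hGS _ (hlr σ hσ).2.2.1))
  · have hGcard : (G.card : ℝ) ≤ 2 + 2 * W + C / h * (U - V) := by
      rw [Finset.card_eq_sum_card_image s G]
      push_cast
      refine le_trans (Finset.sum_le_sum fun σ hσ => ?_) hchain
      refine (hfib σ hσ).trans ?_
      have := sub_nonneg.2 (hle σ hσ)
      gcongr
    have hcard : (S.card : ℝ) = G.card +
        (S.filter (fun x => ¬ ∃ y ∈ S, y ≠ x ∧ |(y : ℝ) - x| < h)).card := by
      rw [hG, ← Nat.cast_add, Finset.card_filter_add_card_filter_not]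
    have h1 : (U - V) / h ≤ C * ((U - V) / h) :=
      le_mul_of_one_le_left (div_nonneg (sub_nonneg.2 hVU) hh.le) hC
    have h2 : C / h * (U - V) = C * ((U - V) / h) := by ring
    rw [hcard]
    linarith
  · intro σ _
    have : 2 * W / (σ.den : ℝ) ≤ 2 * W :=
      div_le_self (by positivity) (by exact_mod_cast σ.den_pos)
    linarith
  · intro σ hσ τ hτ hlt
    obtain ⟨-, -, hx, hxs, -⟩ := hlr σ hσ
    obtain ⟨hy, hys, -, -, -⟩ := hlr τ hτ
    have hg := hgap _ hx _ hy (by rwa [hxs, hys])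
    have hpx := (hs _ hx).1
    have hqy := (hs _ hy).1
    rw [hxs] at hg hpx
    rw [hys] at hg hqy
    have hp : (0 : ℝ) < σ.den := by exact_mod_cast σ.den_pos
    have hq : (0 : ℝ) < τ.den := by exact_mod_cast τ.den_pos
    set D : ℝ := (l τ : ℝ) - r σ
    set p : ℝ := (σ.den : ℝ)
    set q : ℝ := (τ.den : ℝ)
    have h1 : 1 / q ≤ 4 / 3 * (C * lam * h * D) := by
      have h2 : 1 / q = 4 / 3 * (3 / 4 * (1 / (p * q)) * p) := by field_simp
      rw [h2]
      have h3 : 3 / 4 * (1 / (p * q)) * p ≤ C * lam * D * h := by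
        gcongr
        exact le_trans (by positivity) hg
      linarith
    have hD : 0 ≤ D := by
      have : 0 ≤ C * lam * D := le_trans (by positivity) hg
      exact nonneg_of_mul_nonneg_right this (by positivity)
    have h4 : 24 * h ≤ D := by
      have h5 : 1 ≤ 4 / 3 * (C * lam * h * D) * h := by
        calc (1 : ℝ) = 1 / q * q := by field_simp
          _ ≤ _ := by gcongr
      have h6 : (C * lam * h ^ 3) * D ≤ 1 / 32 * D := by gcongr
      nlinarith
    have h7 : 2 * W / q * h ≤ C / 6 * D := by
      calc 2 * W / q * h = 1 / q * (2 * W * h) := by ring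
        _ ≤ 4 / 3 * (C * lam * h * D) * (2 * W * h) := by gcongr
        _ = 8 / 3 * D * (C * lam * h ^ 2 * W) := by ring
        _ ≤ 8 / 3 * D * (C / 16) := by gcongr
        _ = C / 6 * D := by ring
    rw [div_mul_eq_mul_div, le_div_iff₀ hh]
    have h8 : D ≤ C * D := le_mul_of_one_le_left hD hC
    linarith

/-- Quadratic lower bound for a function whose derivative grows at rate at least `k`. -/
lemma add_sq_le_of_deriv_growth {f f' : ℝ → ℝ} {u v k : ℝ}
    (hf : ∀ x ∈ Set.Icc u v, HasDerivWithinAt f (f' x) (Set.Icc u v) x)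
    (hk : ∀ x ∈ Set.Icc u v, ∀ y ∈ Set.Icc u v, x ≤ y → k * (y - x) ≤ f' y - f' x)
    {x y : ℝ} (hx : x ∈ Set.Icc u v) (hy : y ∈ Set.Icc u v) :
    f' x * (y - x) + k / 2 * (y - x) ^ 2 ≤ f y - f x := by
  set φ : ℝ → ℝ := fun t => f t - (f' x * (t - x) + k / 2 * (t - x) ^ 2) with hφ
  have hder : ∀ t ∈ Set.Icc u v,
      HasDerivWithinAt φ (f' t - (f' x + k * (t - x))) (Set.Icc u v) t := by
    intro t ht
    have h1 : HasDerivAt (fun t : ℝ => f' x * (t - x) + k / 2 * (t - x) ^ 2)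
        (f' x + k * (t - x)) t := by
      have h2 := (hasDerivAt_id t).sub_const x
      refine ((h2.const_mul (f' x)).add ((h2.pow 2).const_mul (k / 2))).congr_deriv ?_
      simp
      ring
    exact (hf t ht).sub h1.hasDerivWithinAt
  have hint : ∀ a ∈ Set.Icc u v, ∀ b ∈ Set.Icc u v, ∀ t ∈ interior (Set.Icc a b),
      HasDerivAt φ (f' t - (f' x + k * (t - x))) t := by
    intro a ha b hb t ht
    rw [interior_Icc] at ht
    have h1 : u < t := ha.1.trans_lt ht.1
    have h2 : t < v := ht.2.trans_le hb.2
    exact (hder t ⟨h1.le, h2.le⟩).hasDerivAt (Icc_mem_nhds h1 h2)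
  have hcont : ∀ a ∈ Set.Icc u v, ∀ b ∈ Set.Icc u v, ContinuousOn φ (Set.Icc a b) := by
    intro a ha b hb
    have : ContinuousOn φ (Set.Icc u v) := fun t ht => (hder t ht).continuousWithinAt
    exact this.mono (Set.Icc_subset_Icc ha.1 hb.2)
  have hφx : φ x = f x := by simp [hφ]
  suffices φ x ≤ φ y by
    rw [hφx] at this
    simp only [hφ] at this
    linarith
  rcases le_total x y with hxy | hyx
  · refine monotoneOn_of_deriv_nonneg (convex_Icc x y) (hcont x hx y hy)
      (fun t ht => (hint x hx y hy t ht).differentiableAt.differentiableWithinAt)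
      (fun t ht => ?_) (Set.left_mem_Icc.2 hxy) (Set.right_mem_Icc.2 hxy) hxy
    rw [(hint x hx y hy t ht).deriv]
    rw [interior_Icc] at ht
    linarith [hk x hx t ⟨hx.1.trans ht.1.le, ht.2.le.trans hy.2⟩ ht.1.le]
  · refine antitoneOn_of_deriv_nonpos (convex_Icc y x) (hcont y hy x hx)
      (fun t ht => (hint y hy x hx t ht).differentiableAt.differentiableWithinAt)
      (fun t ht => ?_) (Set.left_mem_Icc.2 hyx) (Set.right_mem_Icc.2 hyx) hyx
    rw [(hint y hy x hx t ht).deriv]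
    rw [interior_Icc] at ht
    linarith [hk t ⟨hy.1.trans ht.1.le, ht.2.le.trans hx.2⟩ x hx ht.2.le]

/-- The bound for functions with positive second derivative. -/
lemma card_close_to_integers_le_of_pos_second_deriv {C δ lam : ℝ} (hC : 1 ≤ C) (hδ : 0 < δ)
    (hlam : 0 < lam) (N : ℕ) (f f' f'' : ℝ → ℝ)
    (hf : ∀ x ∈ Set.Icc (N : ℝ) (2 * N), HasDerivWithinAt f (f' x) (Set.Icc (N : ℝ) (2 * N)) x)
    (hf' : ∀ x ∈ Set.Icc (N : ℝ) (2 * N), HasDerivWithinAt f' (f'' x) (Set.Icc (N : ℝ) (2 * N)) x)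
    (hl : ∀ x ∈ Set.Icc (N : ℝ) (2 * N), C⁻¹ * lam ≤ f'' x)
    (hu : ∀ x ∈ Set.Icc (N : ℝ) (2 * N), f'' x ≤ C * lam)
    (S : Finset ℤ) (hS : ∀ n ∈ S, (N : ℤ) ≤ n ∧ n ≤ 2 * N ∧ ∃ m : ℤ, |f n - m| < δ) :
    (S.card : ℝ) ≤ (64 * C ^ 2 + 4 * C + 3) *
      ((N : ℝ) * lam ^ ((1 : ℝ) / 3) + (N : ℝ) * δ + (δ / lam) ^ ((1 : ℝ) / 2) + 1) := by
  set I := Set.Icc (N : ℝ) (2 * N) with hI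
  have hC0 : 0 < C := by linarith
  have hmemI : ∀ n ∈ S, (n : ℝ) ∈ I := fun n hn =>
    ⟨by exact_mod_cast (hS n hn).1, by exact_mod_cast (hS n hn).2.1⟩
  have hcont : ContinuousOn f' I := fun t ht => (hf' t ht).continuousWithinAt
  have hint : ∀ t ∈ interior I, HasDerivAt f' (f'' t) t := fun t ht =>
    (hf' t (interior_subset ht)).hasDerivAt (mem_interior_iff_mem_nhds.1 ht)
  have hdiff : DifferentiableOn ℝ f' (interior I) := fun t ht =>
    (hint t ht).differentiableAt.differentiableWithinAt
  have hlow : ∀ x ∈ I, ∀ y ∈ I, x ≤ y → C⁻¹ * lam * (y - x) ≤ f' y - f' x := fun x hx y hy hxy =>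
    (convex_Icc _ _).mul_sub_le_image_sub_of_le_deriv hcont hdiff
      (fun t ht => by rw [(hint t ht).deriv]; exact hl t (interior_subset ht)) x hx y hy hxy
  have hupp : ∀ x ∈ I, ∀ y ∈ I, x ≤ y → f' y - f' x ≤ C * lam * (y - x) := fun x hx y hy hxy =>
    (convex_Icc _ _).image_sub_le_mul_sub_of_deriv_le hcont hdiff
      (fun t ht => by rw [(hint t ht).deriv]; exact hu t (interior_subset ht)) x hx y hy hxy
  have hlip : ∀ x ∈ I, ∀ y ∈ I, x ≤ y → |f' y - f' x| ≤ C * lam * |y - x| := by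
    intro x hx y hy hxy
    have h1 : 0 ≤ C⁻¹ * lam * (y - x) := mul_nonneg (by positivity) (sub_nonneg.2 hxy)
    rw [abs_of_nonneg (h1.trans (hlow x hx y hy hxy)), abs_of_nonneg (sub_nonneg.2 hxy)]
    exact hupp x hx y hy hxy
  set c : ℝ := lam ^ ((1 : ℝ) / 3) with hc
  set ρ : ℝ := (δ / lam) ^ ((1 : ℝ) / 2) with hρ
  have hc0 : 0 < c := by positivity
  have hρ0 : 0 < ρ := by positivity
  have hc3 : c ^ 3 = lam := by
    rw [hc, ← Real.rpow_natCast, ← Real.rpow_mul hlam.le]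
    norm_num
  have hρ2 : lam * ρ ^ 2 = δ := by
    rw [hρ, ← Real.rpow_natCast, ← Real.rpow_mul (by positivity)]
    norm_num
    field_simp
  set h : ℝ := 1 / (32 * C * (δ + c)) with hh
  have hh0 : 0 < h := by positivity
  have hhC : h * (δ + c) = 1 / 32 * C⁻¹ := by
    rw [hh]
    field_simp
  have hCinv : C⁻¹ ≤ 1 := inv_le_one_of_one_le₀ hC
  have hδh : δ * h ≤ 1 / 32 * C⁻¹ := by nlinarith [mul_pos hh0 hc0]
  have hch : c * h ≤ 1 / 32 * C⁻¹ := by nlinarith [mul_pos hh0 hδ]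
  have hlh : C * lam * h ^ 3 ≤ 1 / 32 := by
    have h1 : c * h ≤ 1 / 32 := by linarith
    have h2 : C * (c * h) ≤ 1 / 32 := by
      calc C * (c * h) ≤ C * (1 / 32 * C⁻¹) := by gcongr
        _ = 1 / 32 := by field_simp
    calc C * lam * h ^ 3 = C * (c * h) * (c * h) ^ 2 := by rw [← hc3]; ring
      _ ≤ 1 / 32 * (1 / 32) ^ 2 := by gcongr
      _ ≤ 1 / 32 := by norm_num
  have hm : ∀ n : ℤ, ∃ m : ℤ, n ∈ S → |f n - m| < δ := by
    intro n
    by_cases hn : n ∈ S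
    · obtain ⟨m, hm⟩ := (hS n hn).2.2
      exact ⟨m, fun _ => hm⟩
    · exact ⟨0, fun h => absurd h hn⟩
  choose m hm using hm
  have hmain := card_close_to_integers_le S (fun n => f n) (fun n => f' n) m
    (W := 2 * C * ρ) (h := h) (U := 2 * N) (V := N) hC hlam hδ hh0 (by positivity)
    (by linarith) hlh ?_ ?_ hm ?_ ?_ (by linarith [Nat.cast_nonneg (α := ℝ) N])
    (fun n hn => (hmemI n hn).1) (fun n hn => (hmemI n hn).2)
  · have h1 : ((2 * N : ℝ) - N) / h = 32 * C * (N * c + N * δ) := by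
      rw [hh]
      field_simp
      ring
    rw [h1] at hmain
    refine hmain.trans ?_
    have hX : 0 ≤ (N : ℝ) * c + N * δ := by positivity
    nlinarith [mul_nonneg hC0.le hX, mul_nonneg hC0.le hρ0.le, mul_nonneg (sq_nonneg C) hρ0.le,
      sq_nonneg C]
  · have : lam / (2 * C) * (2 * C * ρ) ^ 2 = C * (2 * (lam * ρ ^ 2)) := by field_simp
    rw [this, hρ2]
    exact le_mul_of_one_le_left (by positivity) hC
  · refine abs_le_of_sq_le_sq' ?_ (by positivity) |>.2
    calc (C * lam * h ^ 2 * (2 * C * ρ)) ^ 2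
        = 4 * C ^ 3 * (C * lam * h ^ 3) * (lam * ρ ^ 2 * h) := by ring
      _ ≤ 4 * C ^ 3 * (1 / 32) * (1 / 32 * C⁻¹) := by
        rw [hρ2]
        gcongr
      _ = (C / 16) ^ 2 := by field_simp; norm_num
  · intro x hx y hy
    have := add_sq_le_of_deriv_growth hf hlow (hmemI x hx) (hmemI y hy)
    convert this using 3
    field_simp
  · intro x hx y hy
    rcases le_total (x : ℝ) y with hxy | hxy
    · exact hlip _ (hmemI x hx) _ (hmemI y hy) hxy
    · rw [abs_sub_comm, abs_sub_comm (y : ℝ)]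
      exact hlip _ (hmemI y hy) _ (hmemI x hx) hxy

theorem stmt_17 (C : ℝ) (hC : 1 ≤ C) :
    ∃ K : ℝ, 0 < K ∧
      ∀ (N : ℕ), 4 ≤ N → ∀ δ : ℝ, 0 < δ → δ < 1/4 →
      ∀ lam : ℝ, 0 < lam →
      ∀ f : ℝ → ℝ, ContDiffOn ℝ 2 f (Set.Icc (N:ℝ) (2*N)) →
      (∀ x ∈ Set.Icc (N:ℝ) (2*N),
        C⁻¹ * lam ≤ |iteratedDerivWithin 2 f (Set.Icc (N:ℝ) (2*N)) x| ∧
        |iteratedDerivWithin 2 f (Set.Icc (N:ℝ) (2*N)) x| ≤ C * lam) →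
      (({n : ℤ | (N:ℤ) ≤ n ∧ n ≤ 2*N ∧ |f n - round (f n)| < δ}.ncard : ℝ)) ≤
        K * ((N:ℝ) * lam ^ ((1:ℝ)/3) + (N:ℝ) * δ + (δ / lam) ^ ((1:ℝ)/2) + 1) := by
  refine ⟨64 * C ^ 2 + 4 * C + 3, by positivity, ?_⟩
  intro N hN δ hδ _ lam hlam f hf hbd
  have hC0 : 0 < C := by linarith
  have hNpos : (N : ℝ) < 2 * N := by
    have : (4 : ℝ) ≤ N := by exact_mod_cast hN
    linarith
  set I := Set.Icc (N : ℝ) (2 * N) with hI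
  have hU : UniqueDiffOn ℝ I := uniqueDiffOn_Icc hNpos
  set A := {n : ℤ | (N:ℤ) ≤ n ∧ n ≤ 2*N ∧ |f n - round (f n)| < δ} with hA
  have hfin : A.Finite := (Set.finite_Icc (N : ℤ) (2 * N)).subset fun n hn => ⟨hn.1, hn.2.1⟩
  rw [Set.ncard_eq_toFinset_card A hfin]
  have hd1 : ∀ x ∈ I, HasDerivWithinAt f (derivWithin f I x) I x := fun x hx =>
    (hf.differentiableOn (by norm_num) x hx).hasDerivWithinAt
  have hf1 : ContDiffOn ℝ 1 (derivWithin f I) I := hf.derivWithin hU (by norm_num)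
  have hiter : iteratedDerivWithin 2 f I = derivWithin (derivWithin f I) I := by
    ext x
    rw [iteratedDerivWithin_succ, iteratedDerivWithin_one]
  have hd2 : ∀ x ∈ I, HasDerivWithinAt (derivWithin f I) (iteratedDerivWithin 2 f I x) I x := by
    intro x hx
    rw [hiter]
    exact (hf1.differentiableOn (by norm_num) x hx).hasDerivWithinAt
  have hcont : ContinuousOn (iteratedDerivWithin 2 f I) I :=
    hf.continuousOn_iteratedDerivWithin (by norm_num) hU
  have hlam' : 0 < C⁻¹ * lam := by positivity
  have hsign : (∀ x ∈ I, 0 ≤ iteratedDerivWithin 2 f I x) ∨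
      (∀ x ∈ I, iteratedDerivWithin 2 f I x ≤ 0) := by
    by_contra! hcon
    obtain ⟨⟨x, hx, hx0⟩, y, hy, hy0⟩ := hcon
    obtain ⟨z, hz, hz0⟩ := isPreconnected_Icc.intermediate_value hx hy hcont ⟨hx0.le, hy0.le⟩
    have := (hbd z hz).1
    rw [hz0, abs_zero] at this
    linarith
  rcases hsign with hs | hs
  · refine card_close_to_integers_le_of_pos_second_deriv hC hδ hlam N f _ _ hd1 hd2
      (fun x hx => ?_) (fun x hx => ?_) _ (fun n hn => ?_)
    · simpa only [abs_of_nonneg (hs x hx)] using (hbd x hx).1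
    · simpa only [abs_of_nonneg (hs x hx)] using (hbd x hx).2
    · have hn' : n ∈ A := by simpa using hn
      exact ⟨hn'.1, hn'.2.1, _, hn'.2.2⟩
  · refine card_close_to_integers_le_of_pos_second_deriv hC hδ hlam N (fun x => -f x)
      (fun x => -derivWithin f I x) (fun x => -iteratedDerivWithin 2 f I x)
      (fun x hx => (hd1 x hx).neg) (fun x hx => (hd2 x hx).neg)
      (fun x hx => ?_) (fun x hx => ?_) _ (fun n hn => ?_)
    · simpa only [abs_of_nonpos (hs x hx)] using (hbd x hx).1
    · simpa only [abs_of_nonpos (hs x hx)] using (hbd x hx).2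
    · have hn' : n ∈ A := by simpa using hn
      refine ⟨hn'.1, hn'.2.1, -round (f n), ?_⟩
      rw [← abs_neg]
      convert hn'.2.2 using 2
      push_cast
      ring
end
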